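/- Let Γ be a non-uniform lattice in G = SL(2,ℝ) and let x₀ = Γg₀ ∈ Γ\G be a point whose forward H-trajectory diverges, i.e. for every compact subset C ⊆ Γ\G there is s₁ > 0 with x₀h(s) ∉ C for all s ≥ s₁. Let ψ : Γ\G → ℝ be a smooth function with compact support. Then there exist constants C₀ > 0 and M > 0 such that for every real T with |T| ≥ 1: (i) ∫₀^∞ ψ(x₀h(s)a(T)) ds = ∫₀^{|T|+M} ψ(x₀h(s)a(T)) ds, and (ii) |∫₀^∞ ψ(x₀h(s)a(T)) ds − |T|·∫_{Γ\G} ψ dμ| ≤ C₀. -/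

import Mathlib

noncomputable section
open MeasureTheory Matrix Filter Topology

abbrev SL2 : Type := Matrix.SpecialLinearGroup (Fin 2) ℝ

instance : TopologicalSpace SL2 :=
  TopologicalSpace.induced (fun g : SL2 => (g : Matrix (Fin 2) (Fin 2) ℝ)) inferInstance

instance : MeasurableSpace SL2 := borel SL2

/-- `h(s) = [[cosh(s/2), sinh(s/2)], [sinh(s/2), cosh(s/2)]]` -/
def hmat (s : ℝ) : SL2 :=
  ⟨!![Real.cosh (s/2), Real.sinh (s/2); Real.sinh (s/2), Real.cosh (s/2)], by
    rw [Matrix.det_fin_two_of]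
    nlinarith [Real.cosh_sq_sub_sinh_sq (s/2)]⟩

/-- `a(t) = [[e^{t/2}, 0], [0, e^{-t/2}]]` -/
def amat (t : ℝ) : SL2 :=
  ⟨!![Real.exp (t/2), 0; 0, Real.exp (-(t/2))], by
    rw [Matrix.det_fin_two_of]
    rw [← Real.exp_add]
    simp⟩

/-- the quotient `Γ\G` by right cosets `Γg` -/
def XQuot (Γ : Subgroup SL2) : Type := Quotient (QuotientGroup.rightRel Γ)

instance (Γ : Subgroup SL2) : TopologicalSpace (XQuot Γ) :=
  inferInstanceAs (TopologicalSpace (Quotient (QuotientGroup.rightRel Γ)))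

instance (Γ : Subgroup SL2) : MeasurableSpace (XQuot Γ) := borel (XQuot Γ)

/-- the natural projection `G → Γ\G`, `g ↦ Γg` -/
def qmk (Γ : Subgroup SL2) (g : SL2) : XQuot Γ := Quotient.mk (QuotientGroup.rightRel Γ) g

/-- the right action of `G` on `Γ\G`: `(Γg)g' = Γgg'`. -/
def rmul (Γ : Subgroup SL2) (x : XQuot Γ) (g : SL2) : XQuot Γ :=
  Quotient.map' (fun h => h * g)
    (fun a b hab => by
      rw [QuotientGroup.rightRel_apply] at hab ⊢
      simpa [mul_assoc] using hab) x

/-- `Γ` is a lattice in `SL(2,ℝ)`: a discrete subgroup of finite covolume. -/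
def IsLatticeSL2 (Γ : Subgroup SL2) : Prop :=
  DiscreteTopology Γ ∧
    ∃ μG : Measure SL2, μG.IsHaarMeasure ∧
      ∃ F : Set SL2, IsFundamentalDomain Γ F μG ∧ μG F ≠ ⊤

/-- a function on `Γ\G` is smooth iff its lift to `G ⊆ M₂(ℝ) = ℝ⁴` extends to a smooth
function on the ambient matrix space (equivalently, it is smooth on the manifold `Γ\G`). -/
def IsSmoothQuot (Γ : Subgroup SL2) (ψ : XQuot Γ → ℝ) : Prop :=
  ∃ Ψ : (Fin 2 → Fin 2 → ℝ) → ℝ, ContDiff ℝ (⊤ : ℕ∞) Ψ ∧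
    ∀ g : SL2, ψ (qmk Γ g) = Ψ (fun i j => (g : Matrix (Fin 2) (Fin 2) ℝ) i j)

instance : BorelSpace SL2 := ⟨rfl⟩

instance (Γ : Subgroup SL2) : BorelSpace (XQuot Γ) := ⟨rfl⟩

theorem isClosedEmbedding_coe_SL2 :
    IsClosedEmbedding (fun g : SL2 => (g : Matrix (Fin 2) (Fin 2) ℝ)) := by
  refine ⟨⟨⟨rfl⟩, Subtype.val_injective⟩, ?_⟩
  have : Set.range (fun g : SL2 => (g : Matrix (Fin 2) (Fin 2) ℝ)) = {M | M.det = 1} := by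
    ext M
    exact ⟨by rintro ⟨g, rfl⟩; exact g.2, fun h => ⟨⟨M, h⟩, rfl⟩⟩
  rw [this]
  exact isClosed_eq (Continuous.matrix_det continuous_id) continuous_const

instance : LocallyCompactSpace SL2 :=
  have : LocallyCompactSpace (Matrix (Fin 2) (Fin 2) ℝ) :=
    inferInstanceAs (LocallyCompactSpace (Fin 2 → Fin 2 → ℝ))
  isClosedEmbedding_coe_SL2.locallyCompactSpace

instance : SecondCountableTopology SL2 :=
  have : SecondCountableTopology (Matrix (Fin 2) (Fin 2) ℝ) :=
    inferInstanceAs (SecondCountableTopology (Fin 2 → Fin 2 → ℝ))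
  isClosedEmbedding_coe_SL2.isEmbedding.secondCountableTopology

theorem continuous_SL2_apply (i j : Fin 2) : Continuous fun g : SL2 => g i j :=
  (continuous_apply_apply i j).comp isClosedEmbedding_coe_SL2.continuous

theorem continuous_SL2_iff {α : Type*} [TopologicalSpace α] {f : α → SL2} :
    Continuous f ↔ ∀ i j, Continuous fun a => f a i j := by
  refine ⟨fun h i j => (continuous_SL2_apply i j).comp h, fun h => ?_⟩
  rw [isClosedEmbedding_coe_SL2.isEmbedding.continuous_iff]
  exact continuous_matrix h

instance : T2Space SL2 := isClosedEmbedding_coe_SL2.isEmbedding.t2Space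

instance : IsTopologicalGroup SL2 where
  continuous_mul := by
    rw [continuous_SL2_iff]
    intro i j
    simp only [Matrix.SpecialLinearGroup.coe_mul, Matrix.mul_apply, Fin.sum_univ_two]
    have h1 := fun i j => (continuous_SL2_apply i j).comp (continuous_fst (X := SL2) (Y := SL2))
    have h2 := fun i j => (continuous_SL2_apply i j).comp (continuous_snd (X := SL2) (Y := SL2))
    exact ((h1 i 0).mul (h2 0 j)).add ((h1 i 1).mul (h2 1 j))
  continuous_inv := by
    rw [continuous_SL2_iff]
    intro i j
    have h1 := continuous_SL2_apply
    fin_cases i <;> fin_cases j <;>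
      simp [Matrix.SpecialLinearGroup.coe_inv, Matrix.adjugate_fin_two, h1]
    · exact (h1 0 1).neg
    · exact (h1 1 0).neg

/-- lower triangular unipotent matrices -/
def lmat (x : ℝ) : SL2 := ⟨!![1, 0; x, 1], by simp [Matrix.det_fin_two_of]⟩

/-- upper triangular unipotent matrices -/
def umat (z : ℝ) : SL2 := ⟨!![1, z; 0, 1], by simp [Matrix.det_fin_two_of]⟩

theorem coe_lmat (x : ℝ) : (lmat x : Matrix (Fin 2) (Fin 2) ℝ) = !![1, 0; x, 1] := rfl

theorem coe_umat (z : ℝ) : (umat z : Matrix (Fin 2) (Fin 2) ℝ) = !![1, z; 0, 1] := rfl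

theorem coe_amat (t : ℝ) : (amat t : Matrix (Fin 2) (Fin 2) ℝ) =
    !![Real.exp (t / 2), 0; 0, Real.exp (-(t / 2))] := rfl

theorem coe_hmat (s : ℝ) : (hmat s : Matrix (Fin 2) (Fin 2) ℝ) =
    !![Real.cosh (s / 2), Real.sinh (s / 2); Real.sinh (s / 2), Real.cosh (s / 2)] := rfl

theorem continuous_lmat : Continuous lmat := by
  rw [continuous_SL2_iff]
  intro i j
  fin_cases i <;> fin_cases j <;> simp [lmat] <;> fun_prop

theorem continuous_amat : Continuous amat := by
  rw [continuous_SL2_iff]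
  intro i j
  fin_cases i <;> fin_cases j <;> simp [amat] <;> fun_prop

theorem lmat_add (x y : ℝ) : lmat (x + y) = lmat x * lmat y := by
  apply Subtype.ext
  change _ = (lmat x * lmat y : SL2).1
  rw [Matrix.SpecialLinearGroup.coe_mul]
  simp [coe_lmat]

theorem lmat_zero : lmat 0 = 1 := by
  ext i j; fin_cases i <;> fin_cases j <;> simp [lmat]

theorem umat_zero : umat 0 = 1 := by
  ext i j; fin_cases i <;> fin_cases j <;> simp [umat]

theorem amat_zero : amat 0 = 1 := by
  ext i j; fin_cases i <;> fin_cases j <;> simp [amat]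

theorem SL2_ext' {g h : SL2} (H : (g : Matrix (Fin 2) (Fin 2) ℝ) = h) : g = h := Subtype.ext H

theorem amat_add (x y : ℝ) : amat (x + y) = amat x * amat y := by
  apply SL2_ext'
  rw [Matrix.SpecialLinearGroup.coe_mul, coe_amat, coe_amat, coe_amat, Matrix.mul_fin_two]
  simp only [← Real.exp_add, mul_zero, zero_mul, add_zero, zero_add]
  congr! 4 <;> ring_nf

theorem lmat_inv (x : ℝ) : (lmat x)⁻¹ = lmat (-x) := by
  rw [inv_eq_iff_mul_eq_one, ← lmat_add, add_neg_cancel, lmat_zero]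

theorem amat_inv (x : ℝ) : (amat x)⁻¹ = amat (-x) := by
  rw [inv_eq_iff_mul_eq_one, ← amat_add, add_neg_cancel, amat_zero]

theorem amat_mul_lmat (t x : ℝ) : amat t * lmat x = lmat (Real.exp (-t) * x) * amat t := by
  have h : Real.exp (-(t / 2)) = Real.exp (-t) * Real.exp (t / 2) := by
    rw [← Real.exp_add]; ring_nf
  apply SL2_ext'
  rw [Matrix.SpecialLinearGroup.coe_mul, Matrix.SpecialLinearGroup.coe_mul, coe_amat, coe_lmat,
    coe_lmat, Matrix.mul_fin_two, Matrix.mul_fin_two, h]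
  ext i j; fin_cases i <;> fin_cases j <;> simp; ring

theorem lmat_mul_amat (t x : ℝ) : lmat x * amat t = amat t * lmat (Real.exp t * x) := by
  rw [amat_mul_lmat, ← mul_assoc, ← Real.exp_add]; simp

theorem umat_mul_amat (t z : ℝ) : umat z * amat t = amat t * umat (Real.exp (-t) * z) := by
  have h : Real.exp (-(t / 2)) = Real.exp (-t) * Real.exp (t / 2) := by
    rw [← Real.exp_add]; ring_nf
  apply SL2_ext'
  rw [Matrix.SpecialLinearGroup.coe_mul, Matrix.SpecialLinearGroup.coe_mul, coe_amat, coe_umat,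
    coe_umat, Matrix.mul_fin_two, Matrix.mul_fin_two, h]
  ext i j; fin_cases i <;> fin_cases j <;> simp; ring

theorem exp_log_half {r : ℝ} (hr : 0 < r) : Real.exp (2 * Real.log r / 2) = r := by
  rw [mul_div_cancel_left₀ _ two_ne_zero, Real.exp_log hr]

theorem det_SL2 (g : SL2) : g 0 0 * g 1 1 - g 0 1 * g 1 0 = 1 := by
  rw [← Matrix.det_fin_two]; exact g.2

theorem eq_lmat_mul_amat_mul_umat (g : SL2) (hg : 0 < g 0 0) :
    g = lmat (g 1 0 / g 0 0) * amat (2 * Real.log (g 0 0)) * umat (g 0 1 / g 0 0) := by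
  have hd := det_SL2 g
  have h1 := exp_log_half hg
  apply SL2_ext'
  rw [Matrix.SpecialLinearGroup.coe_mul, Matrix.SpecialLinearGroup.coe_mul, coe_amat, coe_umat,
    coe_lmat, Matrix.mul_fin_two, Matrix.mul_fin_two, Real.exp_neg, h1]
  ext i j
  fin_cases i <;> fin_cases j <;> simp <;> field_simp
  linarith

theorem umat_mul_lmat (z x : ℝ) (h : 0 < 1 + x * z) :
    umat z * lmat x = lmat (x / (1 + x * z)) * amat (2 * Real.log (1 + x * z)) *
      umat (z / (1 + x * z)) := by
  have e : ((umat z * lmat x : SL2) : Matrix (Fin 2) (Fin 2) ℝ) = !![1 + x * z, z; x, 1] := by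
    rw [Matrix.SpecialLinearGroup.coe_mul, coe_umat, coe_lmat, Matrix.mul_fin_two]
    ext i j; fin_cases i <;> fin_cases j <;> simp; ring
  have := eq_lmat_mul_amat_mul_umat (umat z * lmat x) (by rw [e]; exact h)
  rw [e] at this
  simpa using this

/-! ### The entrywise `ℓ¹` norm on matrices and traceless parts -/

/-- the entrywise `ℓ¹` norm -/
def nrm (A : Matrix (Fin 2) (Fin 2) ℝ) : ℝ := |A 0 0| + |A 0 1| + |A 1 0| + |A 1 1|

theorem nrm_nonneg (A : Matrix (Fin 2) (Fin 2) ℝ) : 0 ≤ nrm A := by unfold nrm; positivity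

theorem nrm_mul_le (A B : Matrix (Fin 2) (Fin 2) ℝ) : nrm (A * B) ≤ nrm A * nrm B := by
  have key : ∀ i j, |(A * B) i j| ≤ |A i 0| * |B 0 j| + |A i 1| * |B 1 j| := fun i j => by
    rw [Matrix.mul_apply, Fin.sum_univ_two, ← abs_mul, ← abs_mul]
    exact abs_add_le _ _
  have h1 := key 0 0
  have h2 := key 0 1
  have h3 := key 1 0
  have h4 := key 1 1
  have : 0 ≤ (|A 0 0| + |A 1 0|) * (|B 1 0| + |B 1 1|) +
      (|A 0 1| + |A 1 1|) * (|B 0 0| + |B 0 1|) := by positivity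
  unfold nrm
  nlinarith

theorem nrm_add_le (A B : Matrix (Fin 2) (Fin 2) ℝ) : nrm (A + B) ≤ nrm A + nrm B := by
  unfold nrm
  simp only [Matrix.add_apply]
  linarith [abs_add_le (A 0 0) (B 0 0), abs_add_le (A 0 1) (B 0 1),
    abs_add_le (A 1 0) (B 1 0), abs_add_le (A 1 1) (B 1 1)]

theorem nrm_smul (c : ℝ) (A : Matrix (Fin 2) (Fin 2) ℝ) : nrm (c • A) = |c| * nrm A := by
  simp [nrm, abs_mul, mul_add]

theorem nrm_neg (A : Matrix (Fin 2) (Fin 2) ℝ) : nrm (-A) = nrm A := by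
  simp [nrm]

theorem nrm_one : nrm (1 : Matrix (Fin 2) (Fin 2) ℝ) = 2 := by
  norm_num [nrm]

theorem nrm_eq_zero {A : Matrix (Fin 2) (Fin 2) ℝ} : nrm A = 0 ↔ A = 0 := by
  refine ⟨fun h => ?_, fun h => by simp [h, nrm]⟩
  unfold nrm at h
  have h1 := abs_nonneg (A 0 0)
  have h2 := abs_nonneg (A 0 1)
  have h3 := abs_nonneg (A 1 0)
  have h4 := abs_nonneg (A 1 1)
  ext i j
  fin_cases i <;> fin_cases j <;> simp <;> rw [← abs_eq_zero] <;> linarith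

theorem nrm_pos {A : Matrix (Fin 2) (Fin 2) ℝ} (h : A ≠ 0) : 0 < nrm A :=
  lt_of_le_of_ne (nrm_nonneg A) fun h' => h (nrm_eq_zero.1 h'.symm)

theorem continuous_nrm : Continuous nrm := by
  unfold nrm
  fun_prop

/-- the traceless part of a matrix -/
def tl (A : Matrix (Fin 2) (Fin 2) ℝ) : Matrix (Fin 2) (Fin 2) ℝ := A - (A.trace / 2) • 1

theorem tl_conj (k : SL2) (A : Matrix (Fin 2) (Fin 2) ℝ) :
    tl ((k⁻¹ : SL2) * A * k) = (k⁻¹ : SL2) * tl A * (k : Matrix (Fin 2) (Fin 2) ℝ) := by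
  have h : ((k⁻¹ : SL2) : Matrix (Fin 2) (Fin 2) ℝ) * k = 1 := by
    rw [← Matrix.SpecialLinearGroup.coe_mul]; simp
  have h' : (k : Matrix (Fin 2) (Fin 2) ℝ) * (k⁻¹ : SL2) = 1 := by
    rw [← Matrix.SpecialLinearGroup.coe_mul]; simp
  have ht : (((k⁻¹ : SL2) : Matrix (Fin 2) (Fin 2) ℝ) * A * k).trace = A.trace := by
    rw [Matrix.trace_mul_comm, ← mul_assoc, h', one_mul]
  simp only [tl, ht, mul_sub, sub_mul, Matrix.mul_smul, Matrix.smul_mul, mul_one, h]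

theorem tl_trace (A : Matrix (Fin 2) (Fin 2) ℝ) : (tl A) 1 1 = -(tl A) 0 0 := by
  simp [tl, Matrix.trace, Fin.sum_univ_two]; ring

theorem tl_one : tl 1 = 0 := by
  simp [tl, Matrix.trace]

theorem tl_add (A B : Matrix (Fin 2) (Fin 2) ℝ) : tl (A + B) = tl A + tl B := by
  ext i j
  fin_cases i <;> fin_cases j <;> simp [tl, Matrix.trace, Fin.sum_univ_two] <;> ring

theorem nrm_tl_le (A : Matrix (Fin 2) (Fin 2) ℝ) : nrm (tl A) ≤ 2 * nrm A := by
  have h1 : (tl A) 0 0 = (A 0 0 - A 1 1) / 2 := by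
    simp [tl, Matrix.trace, Fin.sum_univ_two]; ring
  have h2 : (tl A) 0 1 = A 0 1 := by simp [tl]
  have h3 : (tl A) 1 0 = A 1 0 := by simp [tl]
  unfold nrm
  rw [tl_trace, abs_neg, h1, h2, h3]
  have : |(A 0 0 - A 1 1) / 2| ≤ (|A 0 0| + |A 1 1|) / 2 := by
    rw [abs_div, abs_two]
    linarith [abs_sub (A 0 0) (A 1 1)]
  linarith [abs_nonneg (A 0 0), abs_nonneg (A 0 1), abs_nonneg (A 1 0), abs_nonneg (A 1 1)]

theorem nrm_tl_eq (A : Matrix (Fin 2) (Fin 2) ℝ) :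
    nrm (tl A) = 2 * |tl A 0 0| + |tl A 0 1| + |tl A 1 0| := by
  unfold nrm
  rw [tl_trace, abs_neg]; ring

theorem nrm_conj_ge (k : SL2) (Y : Matrix (Fin 2) (Fin 2) ℝ) :
    nrm Y ≤ nrm k * nrm (k⁻¹ : SL2) * nrm ((k⁻¹ : SL2) * Y * (k : Matrix (Fin 2) (Fin 2) ℝ)) := by
  have h' : (k : Matrix (Fin 2) (Fin 2) ℝ) * (k⁻¹ : SL2) = 1 := by
    rw [← Matrix.SpecialLinearGroup.coe_mul]; simp
  have : Y = k * ((k⁻¹ : SL2) * Y * (k : Matrix (Fin 2) (Fin 2) ℝ)) * (k⁻¹ : SL2) := by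
    rw [mul_assoc, mul_assoc, h', mul_one, ← mul_assoc, h', one_mul]
  calc nrm Y = nrm (k * ((k⁻¹ : SL2) * Y * (k : Matrix (Fin 2) (Fin 2) ℝ)) * (k⁻¹ : SL2)) := by
        rw [← this]
    _ ≤ (nrm k * nrm ((k⁻¹ : SL2) * Y * (k : Matrix (Fin 2) (Fin 2) ℝ))) * nrm (k⁻¹ : SL2) :=
        (nrm_mul_le _ _).trans
          (mul_le_mul_of_nonneg_right (nrm_mul_le _ _) (nrm_nonneg _))
    _ = _ := by ring

theorem nrm_inv (g : SL2) : nrm (g⁻¹ : SL2) = nrm g := by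
  rw [Matrix.SpecialLinearGroup.coe_inv, Matrix.adjugate_fin_two]
  simp [nrm]; ring

instance (Γ : Subgroup SL2) [DiscreteTopology Γ] : Countable Γ :=
  TopologicalSpace.separableSpace_iff_countable.1 inferInstance

section Action

variable {Γ : Subgroup SL2}

theorem qmk_eq_qmk_iff {a b : SL2} : qmk Γ a = qmk Γ b ↔ b * a⁻¹ ∈ Γ := by
  exact (Quotient.eq (r := QuotientGroup.rightRel Γ)).trans (QuotientGroup.rightRel_apply)

theorem qmk_surjective (x : XQuot Γ) : ∃ g, qmk Γ g = x := Quotient.exists_rep x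

theorem rmul_qmk (a g : SL2) : rmul Γ (qmk Γ a) g = qmk Γ (a * g) := rfl

theorem rmul_mul (x : XQuot Γ) (g h : SL2) : rmul Γ x (g * h) = rmul Γ (rmul Γ x g) h := by
  obtain ⟨a, rfl⟩ := qmk_surjective x
  simp only [rmul_qmk, mul_assoc]

theorem rmul_one (x : XQuot Γ) : rmul Γ x 1 = x := by
  obtain ⟨a, rfl⟩ := qmk_surjective x
  simp only [rmul_qmk, mul_one]

theorem rmul_rmul_inv (x : XQuot Γ) (g : SL2) : rmul Γ (rmul Γ x g) g⁻¹ = x := by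
  rw [← rmul_mul, mul_inv_cancel, rmul_one]

theorem exists_rmul_eq (x y : XQuot Γ) : ∃ g, rmul Γ x g = y := by
  obtain ⟨a, rfl⟩ := qmk_surjective x
  obtain ⟨b, rfl⟩ := qmk_surjective y
  exact ⟨a⁻¹ * b, by rw [rmul_qmk, mul_inv_cancel_left]⟩

theorem continuous_qmk : Continuous (qmk Γ) := continuous_quot_mk

theorem isOpenMap_qmk : IsOpenMap (qmk Γ) := by
  intro U hU
  have : qmk Γ ⁻¹' (qmk Γ '' U) = ⋃ γ : Γ, (fun g => (γ : SL2) * g) '' U := by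
    ext b
    simp only [Set.mem_preimage, Set.mem_image, Set.mem_iUnion]
    constructor
    · rintro ⟨a, ha, hab⟩
      exact ⟨⟨_, qmk_eq_qmk_iff.1 hab⟩, a, ha, by simp⟩
    · rintro ⟨γ, a, ha, rfl⟩
      exact ⟨a, ha, qmk_eq_qmk_iff.2 (by simp)⟩
  change IsOpen (qmk Γ ⁻¹' (qmk Γ '' U))
  rw [this]
  exact isOpen_iUnion fun γ => isOpenMap_mul_left _ _ hU

theorem isOpenQuotientMap_qmk : IsOpenQuotientMap (qmk Γ) :=
  ⟨qmk_surjective, continuous_qmk, isOpenMap_qmk⟩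

instance (Γ : Subgroup SL2) : SecondCountableTopology (XQuot Γ) :=
  isOpenQuotientMap_qmk.isQuotientMap.secondCountableTopology isOpenMap_qmk

theorem continuous_rmul : Continuous fun p : XQuot Γ × SL2 => rmul Γ p.1 p.2 := by
  have h := (isOpenQuotientMap_qmk (Γ := Γ)).prodMap (IsOpenQuotientMap.id (X := SL2))
  rw [h.isQuotientMap.continuous_iff]
  exact continuous_qmk.comp continuous_mul

theorem continuous_rmul_left (g : SL2) : Continuous fun x : XQuot Γ => rmul Γ x g :=
  continuous_rmul.comp (continuous_id.prodMk continuous_const)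

theorem continuous_rmul_right (x : XQuot Γ) : Continuous fun g : SL2 => rmul Γ x g :=
  continuous_rmul.comp (continuous_const.prodMk continuous_id)

theorem map_rmul_nhds_one (x : XQuot Γ) : map (fun g => rmul Γ x g) (𝓝 1) = 𝓝 x := by
  obtain ⟨a, rfl⟩ := qmk_surjective x
  have h : IsOpenMap fun g => rmul Γ (qmk Γ a) g := isOpenMap_qmk.comp (isOpenMap_mul_left a)
  have := h.map_nhds_eq (continuous_rmul_right _).continuousAt (x := 1)
  rwa [rmul_one] at this

theorem tendsto_comp_rmul_iff {α : Type*} {f : XQuot Γ → α} {l : Filter α} (x : XQuot Γ) :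
    Tendsto f (𝓝 x) l ↔ Tendsto (fun g => f (rmul Γ x g)) (𝓝 1) l := by
  rw [← map_rmul_nhds_one, tendsto_map'_iff]; rfl

/-- If a function is invariant under `lmat`, `amat` and `umat`, it is constant. -/
theorem eq_of_rmul_invariant {α : Type*} {f : XQuot Γ → α}
    (hL : ∀ x y, f (rmul Γ x (lmat y)) = f x) (hA : ∀ x s, f (rmul Γ x (amat s)) = f x)
    (hU : ∀ x z, f (rmul Γ x (umat z)) = f x) (x y : XQuot Γ) : f x = f y := by
  have h1 : ∀ x (g : SL2), 0 < g 0 0 → f (rmul Γ x g) = f x := fun x g hg => by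
    rw [eq_lmat_mul_amat_mul_umat g hg, rmul_mul, rmul_mul, hU, hA, hL]
  set w : SL2 := umat 1 * lmat (-1) * umat 1 with hw
  have hw1 : ∀ x, f (rmul Γ x w) = f x := fun x => by
    rw [hw, rmul_mul, rmul_mul, hU, hL, hU]
  have hwc : (w : Matrix (Fin 2) (Fin 2) ℝ) = !![0, 1; -1, 0] := by
    rw [hw, Matrix.SpecialLinearGroup.coe_mul, Matrix.SpecialLinearGroup.coe_mul, coe_umat,
      coe_lmat, Matrix.mul_fin_two, Matrix.mul_fin_two]
    simp
  have hgw : ∀ g : SL2, (g * w) 0 0 = - g 0 1 ∧ (g * w) 0 1 = g 0 0 := fun g => by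
    rw [Matrix.SpecialLinearGroup.coe_mul, hwc]
    simp [Matrix.mul_apply, Fin.sum_univ_two]
  obtain ⟨g, rfl⟩ := exists_rmul_eq x y
  have hd := det_SL2 g
  have e1 := hgw g
  have e2 := hgw (g * w)
  have e3 := hgw (g * w * w)
  have k1 := h1 x g
  have k2 := h1 x (g * w)
  have k3 := h1 x (g * w * w)
  have k4 := h1 x (g * w * w * w)
  rw [e1.1] at k2
  rw [e2.1, e1.2] at k3
  rw [e3.1, e2.2, e1.1] at k4
  simp only [rmul_mul _ _ w, hw1] at k2 k3 k4
  rcases lt_trichotomy (g 0 0) 0 with h | h | h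
  · exact (k3 (by linarith)).symm
  · rcases lt_trichotomy (g 0 1) 0 with h' | h' | h'
    · exact (k2 (by linarith)).symm
    · rw [h, h'] at hd; simp at hd
    · exact (k4 (by linarith)).symm
  · exact (k1 h).symm

variable {μ : Measure (XQuot Γ)}

theorem measurePreserving_rmul (hinv : ∀ g : SL2, Measure.map (fun x => rmul Γ x g) μ = μ)
    (g : SL2) : MeasurePreserving (fun x => rmul Γ x g) μ μ :=
  ⟨(continuous_rmul_left g).measurable, hinv g⟩

theorem isOpenPosMeasure_of_invariant [IsProbabilityMeasure μ]
    (hinv : ∀ g : SL2, Measure.map (fun x => rmul Γ x g) μ = μ) : μ.IsOpenPosMeasure := by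
  refine ⟨fun U hU ⟨x, hx⟩ h0 => ?_⟩
  have hop : ∀ g : SL2, IsOpen ((fun y => rmul Γ y g) ⁻¹' U) :=
    fun g => hU.preimage (continuous_rmul_left g)
  obtain ⟨T, hTc, hT⟩ := TopologicalSpace.isOpen_iUnion_countable _ hop
  have hcov : ⋃ g : SL2, (fun y => rmul Γ y g) ⁻¹' U = Set.univ := by
    refine Set.eq_univ_of_forall fun y => Set.mem_iUnion.2 ?_
    obtain ⟨g, hg⟩ := exists_rmul_eq y x
    exact ⟨g, by simpa [hg] using hx⟩
  have h1 : μ Set.univ = 0 := by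
    rw [← hcov, ← hT, measure_biUnion_null_iff hTc]
    intro g _
    rw [(measurePreserving_rmul hinv g).measure_preimage hU.measurableSet.nullMeasurableSet, h0]
  simp at h1

end Action

/-! ### Discreteness and commuting elements -/

theorem exists_nrm_sub_one_lt_of_mem_nhds {U : Set SL2} (hU : U ∈ 𝓝 (1 : SL2)) :
    ∃ δ > 0, ∀ g : SL2, nrm (g - 1) < δ → g ∈ U := by
  rw [isClosedEmbedding_coe_SL2.isInducing.nhds_eq_comap, Filter.mem_comap] at hU
  obtain ⟨V, hV, hVU⟩ := hU
  have hV' : (V : Set (Fin 2 → Fin 2 → ℝ)) ∈ 𝓝 (fun i j => (1 : Matrix (Fin 2) (Fin 2) ℝ) i j) := hV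
  obtain ⟨δ, hδ, hb⟩ := Metric.mem_nhds_iff.1 hV'
  refine ⟨δ, hδ, fun g hg => hVU (hb ?_)⟩
  change dist (fun i j => (g : Matrix (Fin 2) (Fin 2) ℝ) i j)
    (fun i j => (1 : Matrix (Fin 2) (Fin 2) ℝ) i j) < δ
  rw [dist_pi_lt_iff hδ]
  intro i
  rw [dist_pi_lt_iff hδ]
  intro j
  rw [Real.dist_eq]
  have h1 := abs_nonneg ((g - 1 : Matrix (Fin 2) (Fin 2) ℝ) 0 0)
  have h2 := abs_nonneg ((g - 1 : Matrix (Fin 2) (Fin 2) ℝ) 0 1)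
  have h3 := abs_nonneg ((g - 1 : Matrix (Fin 2) (Fin 2) ℝ) 1 0)
  have h4 := abs_nonneg ((g - 1 : Matrix (Fin 2) (Fin 2) ℝ) 1 1)
  refine lt_of_le_of_lt ?_ hg
  change |(g - 1 : Matrix (Fin 2) (Fin 2) ℝ) i j| ≤ _
  unfold nrm
  fin_cases i <;> fin_cases j <;> simp only [Fin.zero_eta, Fin.mk_one, Fin.isValue] <;> linarith

theorem tl_zero_zero (A : Matrix (Fin 2) (Fin 2) ℝ) : tl A 0 0 = (A 0 0 - A 1 1) / 2 := by
  simp [tl, Matrix.trace, Fin.sum_univ_two]; ring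

theorem tl_zero_one (A : Matrix (Fin 2) (Fin 2) ℝ) : tl A 0 1 = A 0 1 := by simp [tl]

theorem tl_one_zero (A : Matrix (Fin 2) (Fin 2) ℝ) : tl A 1 0 = A 1 0 := by simp [tl]

theorem tl_eq_zero_iff (g : SL2) : tl g = 0 ↔ g = 1 ∨ g = -1 := by
  constructor
  · intro h
    have h1 := tl_zero_zero g
    have h2 := tl_zero_one g
    have h3 := tl_one_zero g
    have hd := det_SL2 g
    simp only [h, Matrix.zero_apply] at h1 h2 h3
    have e : g 1 1 = g 0 0 := by linarith
    rw [e, ← h2, ← h3] at hd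
    have : (g 0 0 - 1) * (g 0 0 + 1) = 0 := by linarith
    rcases mul_eq_zero.1 this with h | h
    · left
      ext i j; fin_cases i <;> fin_cases j <;> simp <;> linarith
    · right
      ext i j; fin_cases i <;> fin_cases j <;> simp <;> linarith
  · rintro (rfl | rfl)
    · rw [Matrix.SpecialLinearGroup.coe_one, tl_one]
    · simp [tl, Matrix.trace]

theorem half_trace_sq (g : SL2) :
    ((g 0 0 + g 1 1) / 2) ^ 2 = 1 + (tl g 0 0) ^ 2 + tl g 0 1 * tl g 1 0 := by
  rw [tl_zero_zero, tl_zero_one, tl_one_zero]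
  linarith [det_SL2 g]

theorem abs_half_trace_le (g : SL2) : |(g 0 0 + g 1 1) / 2| ≤ 1 + nrm (tl g) := by
  refine abs_le_of_sq_le_sq ?_ (by linarith [nrm_nonneg (tl g)])
  rw [half_trace_sq, nrm_tl_eq]
  have h1 := abs_nonneg (tl g 0 0)
  have h2 := abs_nonneg (tl g 0 1)
  have h3 := abs_nonneg (tl g 1 0)
  have h4 : (tl g 0 1) * (tl g 1 0) ≤ |tl g 0 1| * |tl g 1 0| := by
    rw [← abs_mul]; exact le_abs_self _
  nlinarith [sq_abs (tl g 0 0), mul_nonneg h1 h2, mul_nonneg h1 h3, mul_nonneg h2 h3]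

theorem nrm_SL2_le (g : SL2) : nrm g ≤ 2 + 3 * nrm (tl g) := by
  have h : (g : Matrix (Fin 2) (Fin 2) ℝ) = tl g + ((g 0 0 + g 1 1) / 2) • 1 := by
    simp [tl, Matrix.trace, Fin.sum_univ_two]
  calc nrm g = nrm (tl g + ((g 0 0 + g 1 1) / 2) • (1 : Matrix (Fin 2) (Fin 2) ℝ)) := by rw [← h]
    _ ≤ nrm (tl g) + |(g 0 0 + g 1 1) / 2| * 2 := by
      rw [← nrm_one, ← nrm_smul]; exact nrm_add_le _ _
    _ ≤ _ := by linarith [abs_half_trace_le g]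

theorem sq_sub_one_eq (g : SL2) : ((g * g : SL2) : Matrix (Fin 2) (Fin 2) ℝ) - 1 =
    (2 * ((tl g 0 0) ^ 2 + tl g 0 1 * tl g 1 0)) • (1 : Matrix (Fin 2) (Fin 2) ℝ) +
      (g 0 0 + g 1 1) • tl g := by
  have hd := det_SL2 g
  rw [Matrix.SpecialLinearGroup.coe_mul]
  ext i j
  have h1 := tl_zero_zero g
  have h2 := tl_zero_one g
  have h3 := tl_one_zero g
  have h4 := tl_trace g
  fin_cases i <;> fin_cases j <;>
    simp only [Matrix.mul_apply, Fin.sum_univ_two, Matrix.sub_apply, Matrix.add_apply,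
      Matrix.smul_apply, smul_eq_mul, h1, h2, h3, h4, Fin.zero_eta, Fin.mk_one, Fin.isValue,
      Matrix.one_apply_eq, ne_eq, zero_ne_one, one_ne_zero, not_false_eq_true,
      Matrix.one_apply_ne] <;>
    first | linear_combination hd | ring

theorem exists_lower_bound_tl (Γ : Subgroup SL2) [DiscreteTopology Γ] :
    ∃ r > 0, ∀ γ ∈ Γ, tl (γ : Matrix (Fin 2) (Fin 2) ℝ) ≠ 0 → r ≤ nrm (tl γ) := by
  obtain ⟨U, hU, hUΓ⟩ : ∃ U ∈ 𝓝 (1 : SL2), ∀ γ ∈ Γ, γ ∈ U → γ = 1 := by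
    have h : ({1} : Set Γ) ∈ 𝓝 (1 : Γ) := (isOpen_discrete _).mem_nhds rfl
    rw [nhds_subtype_eq_comap, Filter.mem_comap] at h
    obtain ⟨U, hU, h⟩ := h
    refine ⟨U, hU, fun γ hγ hγU => ?_⟩
    have := h (show (⟨γ, hγ⟩ : Γ) ∈ _ from hγU)
    exact congrArg Subtype.val this
  obtain ⟨δ, hδ, hδU⟩ := exists_nrm_sub_one_lt_of_mem_nhds hU
  refine ⟨min (1 / 2) (δ / 8), by positivity, fun γ hγ hne => ?_⟩
  by_contra! hlt
  have hn1 : nrm (tl (γ : Matrix (Fin 2) (Fin 2) ℝ)) < 1 / 2 := lt_of_lt_of_le hlt (min_le_left _ _)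
  have hn2 : nrm (tl (γ : Matrix (Fin 2) (Fin 2) ℝ)) < δ / 8 := lt_of_lt_of_le hlt (min_le_right _ _)
  have hn0 := nrm_nonneg (tl (γ : Matrix (Fin 2) (Fin 2) ℝ))
  set D := (tl γ 0 0) ^ 2 + tl γ 0 1 * tl γ 1 0 with hD
  have hDle : |D| ≤ nrm (tl (γ : Matrix (Fin 2) (Fin 2) ℝ)) ^ 2 := by
    have h1 := abs_nonneg (tl γ 0 0)
    have h2 := abs_nonneg (tl γ 0 1)
    have h3 := abs_nonneg (tl γ 1 0)
    have : |D| ≤ |tl γ 0 0| ^ 2 + |tl γ 0 1| * |tl γ 1 0| := by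
      rw [← abs_mul, ← abs_pow]; exact abs_add_le _ _
    rw [nrm_tl_eq]
    nlinarith [mul_nonneg h1 h2, mul_nonneg h1 h3, mul_nonneg h2 h3]
  have htr : |γ 0 0 + γ 1 1| ≤ 2 * (1 + nrm (tl (γ : Matrix (Fin 2) (Fin 2) ℝ))) := by
    have := abs_half_trace_le γ
    rw [abs_div, abs_two] at this
    linarith
  have hsmall : nrm ((γ * γ : SL2) - 1 : Matrix (Fin 2) (Fin 2) ℝ) < δ := by
    rw [sq_sub_one_eq]
    refine (nrm_add_le _ _).trans_lt ?_
    rw [nrm_smul, nrm_smul, nrm_one, abs_mul, abs_two, ← hD]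
    nlinarith
  have hγ1 : γ * γ = 1 := hUΓ _ (mul_mem hγ hγ) (hδU _ hsmall)
  have h0 := sq_sub_one_eq γ
  rw [hγ1, Matrix.SpecialLinearGroup.coe_one, sub_self, ← hD] at h0
  have htr0 : γ 0 0 + γ 1 1 ≠ 0 := fun h => by
    have := half_trace_sq γ
    rw [h] at this
    have h5 : |D| = 1 := by
      rw [show D = -1 by rw [hD]; linarith]; simp
    nlinarith
  apply hne
  have h6 : D = 0 := by
    have a1 := congrFun (congrFun h0 0) 0
    have a2 := congrFun (congrFun h0 1) 1
    have a3 := tl_trace γ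
    simp only [Matrix.zero_apply, Matrix.add_apply, Matrix.smul_apply, smul_eq_mul,
      Matrix.one_apply_eq, a3] at a1 a2
    linarith
  rw [h6] at h0
  simp only [mul_zero, zero_smul, zero_add] at h0
  exact (smul_eq_zero.1 h0.symm).resolve_left htr0

theorem exists_smul_of_commute {A B : Matrix (Fin 2) (Fin 2) ℝ} (hA : A 1 1 = -A 0 0)
    (hB : B 1 1 = -B 0 0) (hA0 : A ≠ 0) (h : A * B = B * A) : ∃ c : ℝ, B = c • A := by
  have h00 := congrFun (congrFun h 0) 0
  have h01 := congrFun (congrFun h 0) 1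
  have h10 := congrFun (congrFun h 1) 0
  simp only [Matrix.mul_apply, Fin.sum_univ_two, hA, hB] at h00 h01 h10
  by_cases a0 : A 0 0 = 0
  · by_cases a1 : A 0 1 = 0
    · by_cases a2 : A 1 0 = 0
      · exact absurd (by ext i j; fin_cases i <;> fin_cases j <;> simp [*]) hA0
      · refine ⟨B 1 0 / A 1 0, ?_⟩
        ext i j; fin_cases i <;> fin_cases j <;> simp [hA, hB] <;> field_simp <;> linarith
    · refine ⟨B 0 1 / A 0 1, ?_⟩
      ext i j; fin_cases i <;> fin_cases j <;> simp [hA, hB] <;> field_simp <;> linarith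
  · refine ⟨B 0 0 / A 0 0, ?_⟩
    ext i j; fin_cases i <;> fin_cases j <;> simp [hA, hB] <;> field_simp <;> linarith

theorem exists_smul_of_commutator_small {a b : SL2} (ha : nrm (tl a) ≤ 1 / 3)
    (hb : nrm (tl b) < 1 / 72) (ha0 : tl (a : Matrix (Fin 2) (Fin 2) ℝ) ≠ 0)
    (hmin : tl ((a * b * a⁻¹ * b⁻¹ : SL2) : Matrix (Fin 2) (Fin 2) ℝ) ≠ 0 →
      nrm (tl a) ≤ 2 * nrm (tl (a * b * a⁻¹ * b⁻¹ : SL2))) :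
    ∃ c : ℝ, tl (b : Matrix (Fin 2) (Fin 2) ℝ) = c • tl a := by
  have hA : (a : Matrix (Fin 2) (Fin 2) ℝ) = tl a + ((a 0 0 + a 1 1) / 2) • 1 := by
    simp [tl, Matrix.trace, Fin.sum_univ_two]
  have hB : (b : Matrix (Fin 2) (Fin 2) ℝ) = tl b + ((b 0 0 + b 1 1) / 2) • 1 := by
    simp [tl, Matrix.trace, Fin.sum_univ_two]
  have hcomm : (a * b - b * a : Matrix (Fin 2) (Fin 2) ℝ) = tl a * tl b + -(tl b * tl a) := by
    conv_lhs => rw [hA, hB]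
    simp only [mul_add, add_mul, Matrix.mul_smul, Matrix.smul_mul, mul_one, one_mul,
      smul_smul]
    rw [mul_comm ((a 0 0 + a 1 1) / 2)]
    abel
  set C : SL2 := a * b * a⁻¹ * b⁻¹ with hC
  have hC1 : (C : Matrix (Fin 2) (Fin 2) ℝ) - 1 =
      (a * b - b * a : Matrix (Fin 2) (Fin 2) ℝ) * ((a⁻¹ * b⁻¹ : SL2)) := by
    have e : ((b * a : SL2) * (a⁻¹ * b⁻¹ : SL2) : SL2) = 1 := by group
    rw [← Matrix.SpecialLinearGroup.coe_mul, ← Matrix.SpecialLinearGroup.coe_mul, sub_mul,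
      ← Matrix.SpecialLinearGroup.coe_mul, ← Matrix.SpecialLinearGroup.coe_mul, e, hC]
    simp [mul_assoc]
  have na := nrm_SL2_le a
  have nb := nrm_SL2_le b
  have n0 := nrm_nonneg (tl (a : Matrix (Fin 2) (Fin 2) ℝ))
  have n1 := nrm_nonneg (tl (b : Matrix (Fin 2) (Fin 2) ℝ))
  have hbound : nrm ((C : Matrix (Fin 2) (Fin 2) ℝ) - 1) ≤
      18 * (nrm (tl (a : Matrix (Fin 2) (Fin 2) ℝ)) * nrm (tl (b : Matrix (Fin 2) (Fin 2) ℝ))) := by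
    rw [hC1]
    refine (nrm_mul_le _ _).trans ?_
    have h1 : nrm (a * b - b * a : Matrix (Fin 2) (Fin 2) ℝ) ≤
        2 * (nrm (tl (a : Matrix (Fin 2) (Fin 2) ℝ)) * nrm (tl (b : Matrix (Fin 2) (Fin 2) ℝ))) := by
      rw [hcomm]
      refine (nrm_add_le _ _).trans ?_
      rw [nrm_neg]
      linarith [nrm_mul_le (tl (a : Matrix (Fin 2) (Fin 2) ℝ)) (tl b),
        nrm_mul_le (tl (b : Matrix (Fin 2) (Fin 2) ℝ)) (tl a)]
    have h2 : nrm ((a⁻¹ * b⁻¹ : SL2) : Matrix (Fin 2) (Fin 2) ℝ) ≤ 3 * 3 := by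
      rw [Matrix.SpecialLinearGroup.coe_mul]
      refine (nrm_mul_le _ _).trans ?_
      rw [nrm_inv, nrm_inv]
      exact mul_le_mul (by linarith) (by linarith) (nrm_nonneg _) (by norm_num)
    calc _ ≤ (2 * (nrm (tl (a : Matrix (Fin 2) (Fin 2) ℝ)) *
          nrm (tl (b : Matrix (Fin 2) (Fin 2) ℝ)))) * (3 * 3) :=
          mul_le_mul h1 h2 (nrm_nonneg _) (by positivity)
      _ = _ := by ring
  have htlC : tl (C : Matrix (Fin 2) (Fin 2) ℝ) = 0 := by
    by_contra hne
    have h1 := hmin hne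
    have h2 : nrm (tl (C : Matrix (Fin 2) (Fin 2) ℝ)) ≤ 2 * nrm ((C : Matrix (Fin 2) (Fin 2) ℝ) - 1) := by
      have : tl (C : Matrix (Fin 2) (Fin 2) ℝ) = tl ((C : Matrix (Fin 2) (Fin 2) ℝ) - 1) := by
        conv_lhs => rw [show (C : Matrix (Fin 2) (Fin 2) ℝ) =
          ((C : Matrix (Fin 2) (Fin 2) ℝ) - 1) + 1 by abel]
        rw [tl_add, tl_one, add_zero]
      rw [this]; exact nrm_tl_le _
    have h3 := nrm_pos ha0
    nlinarith
  have hC' : C = 1 := by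
    rcases (tl_eq_zero_iff C).1 htlC with h | h
    · exact h
    · rw [h] at hbound
      have : nrm (((-1 : SL2) : Matrix (Fin 2) (Fin 2) ℝ) - 1) = 4 := by
        norm_num [nrm]
      nlinarith
  refine exists_smul_of_commute (tl_trace _) (tl_trace _) ha0 ?_
  rw [hC', Matrix.SpecialLinearGroup.coe_one, sub_self] at hC1
  have : (a * b - b * a : Matrix (Fin 2) (Fin 2) ℝ) = 0 := by
    have h := congrArg (· * ((b * a : SL2) : Matrix (Fin 2) (Fin 2) ℝ)) hC1
    simp only [zero_mul, mul_assoc, ← Matrix.SpecialLinearGroup.coe_mul] at h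
    rw [show a⁻¹ * (b⁻¹ * (b * a)) = 1 by group, Matrix.SpecialLinearGroup.coe_one, mul_one] at h
    simpa using h.symm
  rw [hcomm] at this
  rw [← sub_eq_add_neg] at this
  exact sub_eq_zero.1 this

/-! ### The height function -/

section Height

/-- the traceless part of the conjugate `g⁻¹γg` -/
def conjTl (g γ : SL2) : Matrix (Fin 2) (Fin 2) ℝ := tl (g⁻¹ * γ * g : SL2)

/-- the weight `‖Y‖^(-1/4)` of a traceless matrix -/
def weight (Y : Matrix (Fin 2) (Fin 2) ℝ) : ℝ := nrm Y ^ (-(1 / 4) : ℝ)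

theorem conjTl_mul (g k γ : SL2) :
    conjTl (g * k) γ = (k⁻¹ : SL2) * conjTl g γ * (k : Matrix (Fin 2) (Fin 2) ℝ) := by
  unfold conjTl
  rw [← tl_conj, ← Matrix.SpecialLinearGroup.coe_mul, ← Matrix.SpecialLinearGroup.coe_mul,
    show (g * k)⁻¹ * γ * (g * k) = k⁻¹ * (g⁻¹ * γ * g) * k by group]

theorem conjTl_mul_left (δ g γ : SL2) : conjTl (δ * g) γ = conjTl g (δ⁻¹ * γ * δ) := by
  unfold conjTl
  rw [show (δ * g)⁻¹ * γ * (δ * g) = g⁻¹ * (δ⁻¹ * γ * δ) * g by group]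

theorem conjTl_trace (g γ : SL2) : conjTl g γ 1 1 = -conjTl g γ 0 0 := tl_trace _

theorem conj_eq_zero_iff (k : SL2) (Y : Matrix (Fin 2) (Fin 2) ℝ) :
    (k⁻¹ : SL2) * Y * (k : Matrix (Fin 2) (Fin 2) ℝ) = 0 ↔ Y = 0 := by
  refine ⟨fun h => ?_, fun h => by simp [h]⟩
  have := nrm_conj_ge k Y
  rw [h] at this
  have h0 : nrm (0 : Matrix (Fin 2) (Fin 2) ℝ) = 0 := nrm_eq_zero.2 rfl
  rw [h0, mul_zero] at this
  exact nrm_eq_zero.1 (le_antisymm this (nrm_nonneg _))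

theorem weight_zero : weight 0 = 0 := by
  rw [weight, nrm_eq_zero.2 rfl, Real.zero_rpow (by norm_num)]

theorem weight_nonneg (Y : Matrix (Fin 2) (Fin 2) ℝ) : 0 ≤ weight Y :=
  Real.rpow_nonneg (nrm_nonneg _) _

theorem weight_le_of_le {Y : Matrix (Fin 2) (Fin 2) ℝ} {r : ℝ} (hr : 0 < r) (h : r ≤ nrm Y) :
    weight Y ≤ r ^ (-(1 / 4) : ℝ) :=
  Real.rpow_le_rpow_of_nonpos hr h (by norm_num)

/-- If `Y' ≠ 0` is not much smaller than `Y`, its weight is not much larger. -/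
theorem weight_le_of_nrm_le {Y Y' : Matrix (Fin 2) (Fin 2) ℝ} {c : ℝ} (hc : 0 < c)
    (hY : Y ≠ 0) (h : nrm Y ≤ c * nrm Y') : weight Y' ≤ c ^ (1 / 4 : ℝ) * weight Y := by
  have h0 := nrm_pos hY
  have h1 : nrm Y / c ≤ nrm Y' := by rw [div_le_iff₀ hc]; linarith
  refine (weight_le_of_le (by positivity) h1).trans (le_of_eq ?_)
  rw [Real.div_rpow h0.le hc.le, Real.rpow_neg hc.le, weight, div_inv_eq_mul, mul_comm]

theorem two_le_nrm_mul_nrm_inv (k : SL2) : 2 ≤ nrm k * nrm (k⁻¹ : SL2) := by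
  have := nrm_mul_le k (k⁻¹ : SL2)
  rwa [← Matrix.SpecialLinearGroup.coe_mul, mul_inv_cancel, Matrix.SpecialLinearGroup.coe_one,
    nrm_one] at this

/-- the distortion of the height function under `k` -/
def distort (k : SL2) : ℝ := (nrm k * nrm (k⁻¹ : SL2)) ^ (1 / 4 : ℝ)

theorem one_le_distort (k : SL2) : 1 ≤ distort k :=
  Real.one_le_rpow (by linarith [two_le_nrm_mul_nrm_inv k]) (by norm_num)

theorem distort_inv (k : SL2) : distort k⁻¹ = distort k := by
  rw [distort, distort, inv_inv, mul_comm]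

theorem weight_conj_le (k : SL2) (Y : Matrix (Fin 2) (Fin 2) ℝ) :
    weight ((k⁻¹ : SL2) * Y * (k : Matrix (Fin 2) (Fin 2) ℝ)) ≤ distort k * weight Y := by
  by_cases hY : Y = 0
  · rw [(conj_eq_zero_iff k Y).2 hY, hY, weight_zero, mul_zero]
  · exact weight_le_of_nrm_le (by linarith [two_le_nrm_mul_nrm_inv k]) hY (nrm_conj_ge k Y)

variable (Γ : Subgroup SL2)

/-- the height function, lifted to the group -/
def heightG (g : SL2) : ℝ := 1 + ⨆ γ : Γ, weight (conjTl g γ)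

/-- the height function -/
def height (x : XQuot Γ) : ℝ := heightG Γ (qmk_surjective x).choose

theorem heightG_mul_left {δ : SL2} (hδ : δ ∈ Γ) (g : SL2) : heightG Γ (δ * g) = heightG Γ g := by
  unfold heightG
  let e : Γ ≃ Γ := (MulAut.conj (⟨δ, hδ⟩ : Γ)⁻¹).toEquiv
  rw [← Equiv.iSup_comp (g := fun γ : Γ => weight (conjTl g γ)) e]
  refine congrArg (1 + ·) (iSup_congr fun γ => ?_)
  have he : ((e γ : Γ) : SL2) = δ⁻¹ * γ * δ := by
    change δ⁻¹ * (γ : SL2) * (δ⁻¹)⁻¹ = _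
    rw [inv_inv]
  rw [conjTl_mul_left, he]

theorem height_qmk (g : SL2) : height Γ (qmk Γ g) = heightG Γ g := by
  have h := (qmk_surjective (qmk Γ g)).choose_spec
  rw [qmk_eq_qmk_iff] at h
  rw [height, ← heightG_mul_left Γ h, inv_mul_cancel_right]

variable [DiscreteTopology Γ]

theorem exists_lower_bound_conjTl (g : SL2) :
    ∃ r > 0, ∀ γ ∈ Γ, conjTl g γ ≠ 0 → r ≤ nrm (conjTl g γ) := by
  obtain ⟨r, hr, h⟩ := exists_lower_bound_tl Γ
  have h2 := two_le_nrm_mul_nrm_inv g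
  refine ⟨r / (nrm g * nrm (g⁻¹ : SL2)), by positivity, fun γ hγ hne => ?_⟩
  have e : conjTl g γ = (g⁻¹ : SL2) * tl γ * (g : Matrix (Fin 2) (Fin 2) ℝ) := by
    rw [← tl_conj, conjTl, Matrix.SpecialLinearGroup.coe_mul, Matrix.SpecialLinearGroup.coe_mul]
  have h3 : tl (γ : Matrix (Fin 2) (Fin 2) ℝ) ≠ 0 := fun h => hne (by rw [e, h]; simp)
  rw [div_le_iff₀ (by linarith), e]
  linarith [h γ hγ h3, nrm_conj_ge g (tl γ)]

theorem bddAbove_weight (g : SL2) : BddAbove (Set.range fun γ : Γ => weight (conjTl g γ)) := by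
  obtain ⟨r, hr, h⟩ := exists_lower_bound_conjTl Γ g
  refine ⟨r ^ (-(1 / 4) : ℝ), ?_⟩
  rintro _ ⟨γ, rfl⟩
  by_cases hY : conjTl g γ = 0
  · simp only [hY, weight_zero]; positivity
  · exact weight_le_of_le hr (h γ γ.2 hY)

theorem weight_le_heightG (g : SL2) {γ : SL2} (hγ : γ ∈ Γ) :
    weight (conjTl g γ) ≤ heightG Γ g - 1 := by
  have := le_ciSup (bddAbove_weight Γ g) ⟨γ, hγ⟩
  simp only [heightG]; linarith

theorem heightG_le {g : SL2} {C : ℝ} (h : ∀ γ ∈ Γ, weight (conjTl g γ) ≤ C) :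
    heightG Γ g ≤ 1 + C := by
  unfold heightG
  have := ciSup_le fun γ : Γ => h γ γ.2
  linarith

theorem one_le_heightG (g : SL2) : 1 ≤ heightG Γ g := by
  have := weight_le_heightG Γ g (one_mem Γ)
  linarith [weight_nonneg (conjTl g 1)]

theorem one_le_height (x : XQuot Γ) : 1 ≤ height Γ x := one_le_heightG Γ _

theorem height_pos (x : XQuot Γ) : 0 < height Γ x := by linarith [one_le_height Γ x]

theorem height_rmul_le (x : XQuot Γ) (k : SL2) : height Γ (rmul Γ x k) ≤ distort k * height Γ x := by
  obtain ⟨g, rfl⟩ := qmk_surjective x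
  rw [rmul_qmk, height_qmk, height_qmk]
  have h1 := one_le_distort k
  have h2 := one_le_heightG Γ g
  refine (heightG_le Γ (C := distort k * (heightG Γ g - 1)) fun γ hγ => ?_).trans (by nlinarith)
  rw [conjTl_mul]
  refine (weight_conj_le _ _).trans ?_
  have := weight_le_heightG Γ g hγ
  gcongr

theorem height_le_rmul (x : XQuot Γ) (k : SL2) : height Γ x ≤ distort k * height Γ (rmul Γ x k) := by
  have := height_rmul_le Γ (rmul Γ x k) k⁻¹
  rwa [rmul_rmul_inv, distort_inv] at this

theorem continuous_conjTl (γ : SL2) : Continuous fun g => conjTl g γ := by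
  have h : Continuous fun g : SL2 => ((g⁻¹ * γ * g : SL2) : Matrix (Fin 2) (Fin 2) ℝ) :=
    isClosedEmbedding_coe_SL2.continuous.comp (by fun_prop)
  unfold conjTl tl
  exact h.sub ((h.matrix_trace.div_const 2).smul continuous_const)

theorem continuous_weight_conjTl (γ : SL2) : Continuous fun g => weight (conjTl g γ) := by
  by_cases h : tl (γ : Matrix (Fin 2) (Fin 2) ℝ) = 0
  · have : (fun g => weight (conjTl g γ)) = fun _ => 0 := by
      funext g
      have e : conjTl g γ = (g⁻¹ : SL2) * tl γ * (g : Matrix (Fin 2) (Fin 2) ℝ) := by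
        rw [← tl_conj, conjTl, Matrix.SpecialLinearGroup.coe_mul,
          Matrix.SpecialLinearGroup.coe_mul]
      rw [e, h]; simp [weight_zero]
    rw [this]; exact continuous_const
  · refine (continuous_nrm.comp (continuous_conjTl γ)).rpow_const fun g => Or.inl ?_
    have e : conjTl g γ = (g⁻¹ : SL2) * tl γ * (g : Matrix (Fin 2) (Fin 2) ℝ) := by
      rw [← tl_conj, conjTl, Matrix.SpecialLinearGroup.coe_mul, Matrix.SpecialLinearGroup.coe_mul]
    change nrm (conjTl g γ) ≠ 0
    rw [Ne, nrm_eq_zero, e, conj_eq_zero_iff]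
    exact h

theorem lowerSemicontinuous_heightG : LowerSemicontinuous (heightG Γ) :=
  continuous_const.lowerSemicontinuous.add
    (lowerSemicontinuous_ciSup (bddAbove_weight Γ) fun γ =>
      (continuous_weight_conjTl (γ : SL2)).lowerSemicontinuous)

theorem measurable_height : Measurable (height Γ) := by
  refine measurable_of_Ioi fun r => IsOpen.measurableSet ?_
  rw [← isOpenQuotientMap_qmk.isQuotientMap.isOpen_preimage, ← Set.preimage_comp]
  have : height Γ ∘ qmk Γ = heightG Γ := funext (height_qmk Γ)
  rw [this]
  exact (lowerSemicontinuous_heightG Γ).isOpen_preimage r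

theorem exists_nearMin (g : SL2) (h : ∃ γ ∈ Γ, conjTl g γ ≠ 0) :
    ∃ A ∈ Γ, conjTl g A ≠ 0 ∧ ∀ B ∈ Γ, conjTl g B ≠ 0 →
      nrm (conjTl g A) ≤ 2 * nrm (conjTl g B) := by
  obtain ⟨r, hr, hlow⟩ := exists_lower_bound_conjTl Γ g
  set S : Set ℝ := {t | ∃ B ∈ Γ, conjTl g B ≠ 0 ∧ nrm (conjTl g B) = t} with hS
  obtain ⟨γ, hγ, hne⟩ := h
  have hSne : S.Nonempty := ⟨_, γ, hγ, hne, rfl⟩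
  have hbdd : BddBelow S := ⟨r, by rintro _ ⟨B, hB, hB0, rfl⟩; exact hlow B hB hB0⟩
  have hpos : r ≤ sInf S := le_csInf hSne (by rintro _ ⟨B, hB, hB0, rfl⟩; exact hlow B hB hB0)
  obtain ⟨_, ⟨A, hA, hA0, rfl⟩, hlt⟩ :=
    exists_lt_of_csInf_lt hSne (show sInf S < 2 * sInf S by linarith)
  refine ⟨A, hA, hA0, fun B hB hB0 => ?_⟩
  have := csInf_le hbdd (show nrm (conjTl g B) ∈ S from ⟨B, hB, hB0, rfl⟩)
  linarith

theorem exists_smul_of_nearMin {g A B : SL2} (hA : A ∈ Γ) (hB : B ∈ Γ) (hA0 : conjTl g A ≠ 0)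
    (hmin : ∀ B ∈ Γ, conjTl g B ≠ 0 → nrm (conjTl g A) ≤ 2 * nrm (conjTl g B))
    (hA3 : nrm (conjTl g A) ≤ 1 / 3) (hB3 : nrm (conjTl g B) < 1 / 72) :
    ∃ c : ℝ, conjTl g B = c • conjTl g A := by
  refine exists_smul_of_commutator_small hA3 hB3 hA0 fun hne => ?_
  have e : g⁻¹ * A * g * (g⁻¹ * B * g) * (g⁻¹ * A * g)⁻¹ * (g⁻¹ * B * g)⁻¹ =
      g⁻¹ * (A * B * A⁻¹ * B⁻¹) * g := by group
  rw [e] at hne ⊢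
  exact hmin _ (mul_mem (mul_mem (mul_mem hA hB) (inv_mem hA)) (inv_mem hB)) hne

/-- Near any point the height is dominated by a single traceless matrix. -/
theorem exists_dominating (g : SL2) : ∃ Y : Matrix (Fin 2) (Fin 2) ℝ, Y 1 1 = -Y 0 0 ∧
    weight Y ≤ heightG Γ g ∧ ∀ (k : SL2) (c : ℝ), nrm k * nrm (k⁻¹ : SL2) ≤ c →
      heightG Γ (g * k) ≤ 1 + (72 * c) ^ (1 / 4 : ℝ) +
        2 * weight ((k⁻¹ : SL2) * Y * (k : Matrix (Fin 2) (Fin 2) ℝ)) := by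
  by_cases h : ∃ γ ∈ Γ, conjTl g γ ≠ 0
  · obtain ⟨A, hA, hA0, hmin⟩ := exists_nearMin Γ g h
    refine ⟨conjTl g A, conjTl_trace _ _, by linarith [weight_le_heightG Γ g hA],
      fun k c hc => ?_⟩
    have hc0 : 0 < c := by linarith [two_le_nrm_mul_nrm_inv k]
    have hw := weight_nonneg ((k⁻¹ : SL2) * conjTl g A * (k : Matrix (Fin 2) (Fin 2) ℝ))
    rw [add_assoc]
    refine heightG_le Γ fun B hB => ?_
    rw [conjTl_mul]
    by_cases hB0 : conjTl g B = 0
    · rw [hB0]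
      simp only [mul_zero, zero_mul, weight_zero]
      positivity
    rcases le_or_gt (1 / 72) (nrm (conjTl g B)) with hB3 | hB3
    · have h1 : 1 / (72 * c) ≤ nrm ((k⁻¹ : SL2) * conjTl g B * (k : Matrix (Fin 2) (Fin 2) ℝ)) := by
        have h2 := nrm_conj_ge k (conjTl g B)
        have h3 := nrm_nonneg ((k⁻¹ : SL2) * conjTl g B * (k : Matrix (Fin 2) (Fin 2) ℝ))
        rw [div_le_iff₀ (by positivity)]
        nlinarith [mul_le_mul_of_nonneg_right hc h3]
      have h2 := weight_le_of_le (by positivity) h1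
      rw [one_div, Real.inv_rpow (by positivity), Real.rpow_neg (by positivity), inv_inv] at h2
      linarith
    · have hAB := hmin B hB hB0
      obtain ⟨d, hd⟩ := exists_smul_of_nearMin Γ hA hB hA0 hmin (by linarith) hB3
      have h5 : nrm ((k⁻¹ : SL2) * conjTl g A * (k : Matrix (Fin 2) (Fin 2) ℝ)) ≤
          2 * nrm ((k⁻¹ : SL2) * conjTl g B * (k : Matrix (Fin 2) (Fin 2) ℝ)) := by
        rw [hd, nrm_smul] at hAB
        rw [hd, Matrix.mul_smul, Matrix.smul_mul, nrm_smul]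
        have hn := nrm_pos hA0
        have h6 : 1 / 2 ≤ |d| := by
          by_contra! h7
          nlinarith
        nlinarith [nrm_nonneg ((k⁻¹ : SL2) * conjTl g A * (k : Matrix (Fin 2) (Fin 2) ℝ))]
      have h6 := weight_le_of_nrm_le two_pos (by rwa [Ne, conj_eq_zero_iff]) h5
      have h7 : (2 : ℝ) ^ (1 / 4 : ℝ) ≤ 2 := by
        conv_rhs => rw [← Real.rpow_one 2]
        exact Real.rpow_le_rpow_of_exponent_le one_le_two (by norm_num)
      have h8 : 0 ≤ (72 * c) ^ (1 / 4 : ℝ) := by positivity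
      nlinarith
  · push Not at h
    refine ⟨0, by simp, ?_, fun k c hc => ?_⟩
    · rw [weight_zero]; linarith [one_le_heightG Γ g]
    · have hc0 : 0 < c := by linarith [two_le_nrm_mul_nrm_inv k]
      rw [add_assoc]
      refine heightG_le Γ fun B hB => ?_
      rw [conjTl_mul, h B hB]
      simp only [mul_zero, zero_mul, weight_zero]
      positivity

end Height

/-! ### The averaging operator and the drift inequality -/

theorem not_three_points_of_sublevel {p q r h a b c : ℝ} (hh : 0 < h) (hh1 : h ≤ 1) (ha : 0 ≤ a)
    (hab : a + h ≤ b) (hbc : b + h ≤ c) (hc : c ≤ 1) (hN : 0 < 2 * |p| + |q| + |r|)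
    (fa : |r - 2 * p * a - q * a ^ 2| ≤ h ^ 2 / 18 * (2 * |p| + |q| + |r|))
    (fb : |r - 2 * p * b - q * b ^ 2| ≤ h ^ 2 / 18 * (2 * |p| + |q| + |r|))
    (fc : |r - 2 * p * c - q * c ^ 2| ≤ h ^ 2 / 18 * (2 * |p| + |q| + |r|)) : False := by
  set N := 2 * |p| + |q| + |r| with hNd
  have h1 : h * |2 * p + q * (a + b)| ≤ h * (h / 9 * N) := by
    have e : (b - a) * (2 * p + q * (a + b)) =
        (r - 2 * p * a - q * a ^ 2) - (r - 2 * p * b - q * b ^ 2) := by ring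
    have e2 := abs_sub (r - 2 * p * a - q * a ^ 2) (r - 2 * p * b - q * b ^ 2)
    rw [← e, abs_mul, abs_of_pos (by linarith : 0 < b - a)] at e2
    nlinarith [abs_nonneg (2 * p + q * (a + b))]
  have h2 : h * |2 * p + q * (b + c)| ≤ h * (h / 9 * N) := by
    have e : (c - b) * (2 * p + q * (b + c)) =
        (r - 2 * p * b - q * b ^ 2) - (r - 2 * p * c - q * c ^ 2) := by ring
    have e2 := abs_sub (r - 2 * p * b - q * b ^ 2) (r - 2 * p * c - q * c ^ 2)
    rw [← e, abs_mul, abs_of_pos (by linarith : 0 < c - b)] at e2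
    nlinarith [abs_nonneg (2 * p + q * (b + c))]
  have h1' := le_of_mul_le_mul_left h1 hh
  have h2' := le_of_mul_le_mul_left h2 hh
  have h3 : h * |q| ≤ h * (N / 9) := by
    have e : (c - a) * q = (2 * p + q * (b + c)) - (2 * p + q * (a + b)) := by ring
    have e2 := abs_sub (2 * p + q * (b + c)) (2 * p + q * (a + b))
    rw [← e, abs_mul, abs_of_pos (by linarith : 0 < c - a)] at e2
    nlinarith [abs_nonneg q]
  have h3' := le_of_mul_le_mul_left h3 hh
  have h4 : 2 * |p| ≤ N / 9 + 2 * |q| := by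
    have e : 2 * p = (2 * p + q * (a + b)) - q * (a + b) := by ring
    have e2 := abs_sub (2 * p + q * (a + b)) (q * (a + b))
    rw [← e, abs_mul, abs_mul, abs_two, abs_of_nonneg (by linarith : 0 ≤ a + b)] at e2
    nlinarith [abs_nonneg q]
  have h5 : |r| ≤ N / 18 + 2 * |p| + |q| := by
    have e : r = (r - 2 * p * a - q * a ^ 2) + (2 * p * a + q * a ^ 2) := by ring
    have e2 := abs_add_le (r - 2 * p * a - q * a ^ 2) (2 * p * a + q * a ^ 2)
    rw [← e] at e2
    have e3 := abs_add_le (2 * p * a) (q * a ^ 2)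
    rw [abs_mul, abs_mul, abs_mul, abs_two, abs_of_nonneg ha, abs_of_nonneg (sq_nonneg a)] at e3
    have a1 : a ≤ 1 := by linarith
    have a2 : a ^ 2 ≤ 1 := by nlinarith
    have a5 : h ^ 2 ≤ 1 := by nlinarith
    have a6 : h ^ 2 / 18 * N ≤ N / 18 := by nlinarith
    have a3 : 2 * |p| * a ≤ 2 * |p| := by nlinarith [abs_nonneg p]
    have a4 : |q| * a ^ 2 ≤ |q| := by nlinarith [abs_nonneg q]
    linarith
  linarith

theorem volume_sublevel_le {p q r h : ℝ} (hh : 0 < h) (hh1 : h ≤ 1)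
    (hN : 0 < 2 * |p| + |q| + |r|) :
    volume (Set.Icc (0 : ℝ) 1 ∩
      {y | |r - 2 * p * y - q * y ^ 2| ≤ h ^ 2 / 18 * (2 * |p| + |q| + |r|)}) ≤
        ENNReal.ofReal (2 * h) := by
  set F : Set ℝ := {y | |r - 2 * p * y - q * y ^ 2| ≤ h ^ 2 / 18 * (2 * |p| + |q| + |r|)} with hF
  have hFc : IsClosed F := isClosed_le (by fun_prop) continuous_const
  set E := Set.Icc (0 : ℝ) 1 ∩ F with hE
  have hEc : IsCompact E := isCompact_Icc.inter_right hFc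
  rcases E.eq_empty_or_nonempty with h0 | hne
  · rw [h0]; simp
  obtain ⟨a, haE, ha⟩ := hEc.exists_isLeast hne
  have hE2 : IsCompact (E ∩ Set.Ici (a + h)) := hEc.inter_right isClosed_Ici
  have hv : ∀ u : ℝ, volume (Set.Icc u (u + h)) = ENNReal.ofReal h := fun u => by
    rw [Real.volume_Icc]; ring_nf
  have key : ∃ b, E ⊆ Set.Icc a (a + h) ∪ Set.Icc b (b + h) := by
    rcases (E ∩ Set.Ici (a + h)).eq_empty_or_nonempty with h0 | hne2
    · refine ⟨0, fun y hy => Or.inl ⟨ha hy, ?_⟩⟩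
      by_contra! hlt
      exact (Set.eq_empty_iff_forall_notMem.1 h0) y ⟨hy, hlt.le⟩
    · obtain ⟨b, hbE, hb⟩ := hE2.exists_isLeast hne2
      refine ⟨b, fun y hy => ?_⟩
      rcases le_or_gt y (a + h) with hy1 | hy1
      · exact Or.inl ⟨ha hy, hy1⟩
      · refine Or.inr ⟨hb ⟨hy, hy1.le⟩, ?_⟩
        by_contra! hlt
        exact not_three_points_of_sublevel hh hh1 haE.1.1 hbE.2 hlt.le hy.1.2 hN haE.2 hbE.1.2 hy.2
  obtain ⟨b, hb⟩ := key
  calc volume E ≤ volume (Set.Icc a (a + h)) + volume (Set.Icc b (b + h)) :=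
        (measure_mono hb).trans (measure_union_le _ _)
    _ = ENNReal.ofReal (2 * h) := by
        rw [hv, hv, ← ENNReal.ofReal_add hh.le hh.le]; ring_nf

/-- the unit square -/
def unitSq : Set (ℝ × ℝ) := Set.Icc 0 1 ×ˢ Set.Icc 0 1

/-- the uniform probability measure on the unit square -/
def sqMeas : Measure (ℝ × ℝ) := volume.restrict unitSq

theorem isCompact_unitSq : IsCompact unitSq := isCompact_Icc.prod isCompact_Icc

theorem measurableSet_unitSq : MeasurableSet unitSq := isCompact_unitSq.measurableSet

theorem sqMeas_eq : sqMeas = (volume.restrict (Set.Icc (0 : ℝ) 1)).prod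
    (volume.restrict (Set.Icc (0 : ℝ) 1)) := by
  rw [Measure.prod_restrict, ← Measure.volume_eq_prod]; rfl

instance isProbabilityMeasure_restrict_Icc :
    IsProbabilityMeasure (volume.restrict (Set.Icc (0 : ℝ) 1)) :=
  ⟨by simp⟩

instance : IsProbabilityMeasure sqMeas := by
  rw [sqMeas_eq]; infer_instance

theorem ae_mem_unitSq : ∀ᵐ p ∂sqMeas, p ∈ unitSq := ae_restrict_mem measurableSet_unitSq

/-- the steps of the random walk -/
def step (τ : ℝ) (p : ℝ × ℝ) : SL2 := lmat p.1 * amat (τ + p.2)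

theorem continuous_step (τ : ℝ) : Continuous (step τ) :=
  (continuous_lmat.comp continuous_fst).mul
    (continuous_amat.comp (continuous_const.add continuous_snd))

theorem nrm_lmat (y : ℝ) : nrm (lmat y) = 2 + |y| := by
  rw [coe_lmat]; norm_num [nrm]; ring

theorem nrm_umat (y : ℝ) : nrm (umat y) = 2 + |y| := by
  rw [coe_umat]; norm_num [nrm]; ring

theorem nrm_amat_le {t T : ℝ} (h : |t| ≤ T) : nrm (amat t) ≤ 2 * Real.exp (T / 2) := by
  rw [coe_amat]
  have h1 : Real.exp (t / 2) ≤ Real.exp (T / 2) :=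
    Real.exp_le_exp.2 (by linarith [le_abs_self t])
  have h2 : Real.exp (-(t / 2)) ≤ Real.exp (T / 2) :=
    Real.exp_le_exp.2 (by linarith [neg_abs_le t])
  simp [nrm]
  linarith

theorem nrm_step_le {τ : ℝ} (hτ : 0 ≤ τ) {p : ℝ × ℝ} (hp : p ∈ unitSq) :
    nrm (step τ p) * nrm ((step τ p)⁻¹ : SL2) ≤ 36 * Real.exp (τ + 1) := by
  obtain ⟨⟨h1, h2⟩, h3, h4⟩ := hp
  have : nrm (step τ p) ≤ 3 * (2 * Real.exp ((τ + 1) / 2)) := by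
    rw [step, Matrix.SpecialLinearGroup.coe_mul]
    refine (nrm_mul_le _ _).trans (mul_le_mul ?_ (nrm_amat_le ?_) (nrm_nonneg _) (by norm_num))
    · rw [nrm_lmat, abs_of_nonneg h1]; linarith
    · rw [abs_of_nonneg (by linarith)]; linarith
  rw [nrm_inv]
  have e : Real.exp (τ + 1) = Real.exp ((τ + 1) / 2) * Real.exp ((τ + 1) / 2) := by
    rw [← Real.exp_add]; ring_nf
  rw [e]
  nlinarith [nrm_nonneg (step τ p : Matrix (Fin 2) (Fin 2) ℝ), Real.exp_pos ((τ + 1) / 2)]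

theorem distort_step_le {τ : ℝ} (hτ : 0 ≤ τ) {p : ℝ × ℝ} (hp : p ∈ unitSq) :
    distort (step τ p) ≤ (36 * Real.exp (τ + 1)) ^ (1 / 4 : ℝ) :=
  Real.rpow_le_rpow (by linarith [two_le_nrm_mul_nrm_inv (step τ p)]) (nrm_step_le hτ hp)
    (by norm_num)

theorem le_nrm_conj_step (τ : ℝ) {p : ℝ × ℝ} {Y : Matrix (Fin 2) (Fin 2) ℝ}
    (hY : Y 1 1 = -Y 0 0) :
    Real.exp (τ + p.2) * |Y 1 0 - 2 * Y 0 0 * p.1 - Y 0 1 * p.1 ^ 2| ≤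
      nrm (((step τ p)⁻¹ : SL2) * Y * (step τ p : Matrix (Fin 2) (Fin 2) ℝ)) := by
  have e : (((step τ p)⁻¹ : SL2) * Y * (step τ p : Matrix (Fin 2) (Fin 2) ℝ)) 1 0 =
      Real.exp (τ + p.2) * (Y 1 0 - 2 * Y 0 0 * p.1 - Y 0 1 * p.1 ^ 2) := by
    have e2 : Real.exp (τ + p.2) = Real.exp ((τ + p.2) / 2) * Real.exp ((τ + p.2) / 2) := by
      rw [← Real.exp_add]; ring_nf
    rw [step, _root_.mul_inv_rev, lmat_inv, amat_inv, Matrix.SpecialLinearGroup.coe_mul,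
      Matrix.SpecialLinearGroup.coe_mul, coe_amat, coe_amat, coe_lmat, coe_lmat, e2]
    simp only [Matrix.mul_apply, Fin.sum_univ_two, Matrix.of_apply, Matrix.cons_val',
      Matrix.cons_val_zero, Matrix.cons_val_one, Matrix.cons_val_fin_one, hY]
    rw [show -((-(τ + p.2)) / 2) = (τ + p.2) / 2 by ring]
    ring
  rw [← abs_of_pos (Real.exp_pos (τ + p.2)), ← abs_mul, ← e]
  unfold nrm
  linarith [abs_nonneg ((((step τ p)⁻¹ : SL2) * Y * (step τ p : Matrix (Fin 2) (Fin 2) ℝ)) 0 0),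
    abs_nonneg ((((step τ p)⁻¹ : SL2) * Y * (step τ p : Matrix (Fin 2) (Fin 2) ℝ)) 0 1),
    abs_nonneg ((((step τ p)⁻¹ : SL2) * Y * (step τ p : Matrix (Fin 2) (Fin 2) ℝ)) 1 1)]

section Drift

variable {Γ : Subgroup SL2}

/-- the averaging operator of the random walk -/
def avg (τ : ℝ) (φ : XQuot Γ → ℝ) (x : XQuot Γ) : ℝ := ∫ p, φ (rmul Γ x (step τ p)) ∂sqMeas

variable [DiscreteTopology Γ]

theorem height_step_le {τ : ℝ} (hτ : 0 ≤ τ) {p : ℝ × ℝ} (hp : p ∈ unitSq) (x : XQuot Γ) :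
    height Γ (rmul Γ x (step τ p)) ≤ (36 * Real.exp (τ + 1)) ^ (1 / 4 : ℝ) * height Γ x :=
  (height_rmul_le Γ x _).trans
    (mul_le_mul_of_nonneg_right (distort_step_le hτ hp) (height_pos Γ x).le)

theorem integrable_height_step {τ : ℝ} (hτ : 0 ≤ τ) (x : XQuot Γ) :
    Integrable (fun p => height Γ (rmul Γ x (step τ p))) sqMeas := by
  refine Integrable.of_bound (C := (36 * Real.exp (τ + 1)) ^ (1 / 4 : ℝ) * height Γ x) ?_ ?_
  · exact ((measurable_height Γ).comp
      ((continuous_rmul_right x).comp (continuous_step τ)).measurable).aestronglyMeasurable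
  · filter_upwards [ae_mem_unitSq] with p hp
    rw [Real.norm_of_nonneg (height_pos Γ _).le]
    exact height_step_le hτ hp x

theorem avg_height_le_aux {τ h : ℝ} (hτ : 0 ≤ τ) (hh : 0 < h) (hh1 : h ≤ 1) (x : XQuot Γ) :
    avg τ (height Γ) x ≤ 2 * (2 * h * (36 * Real.exp (τ + 1)) ^ (1 / 4 : ℝ) +
      (Real.exp τ * (h ^ 2 / 18)) ^ (-(1 / 4) : ℝ)) * height Γ x +
        (1 + (72 * (36 * Real.exp (τ + 1))) ^ (1 / 4 : ℝ)) := by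
  obtain ⟨g, rfl⟩ := qmk_surjective x
  obtain ⟨Y, hY, hYw, hdom⟩ := exists_dominating Γ g
  set A := (36 * Real.exp (τ + 1)) ^ (1 / 4 : ℝ) with hA
  set B := (Real.exp τ * (h ^ 2 / 18)) ^ (-(1 / 4) : ℝ) with hB
  set b := 1 + (72 * (36 * Real.exp (τ + 1))) ^ (1 / 4 : ℝ) with hb
  set E : Set ℝ := {y | |Y 1 0 - 2 * Y 0 0 * y - Y 0 1 * y ^ 2| ≤
    h ^ 2 / 18 * (2 * |Y 0 0| + |Y 0 1| + |Y 1 0|)} with hE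
  have hEm : MeasurableSet E := (isClosed_le (by fun_prop) continuous_const).measurableSet
  have hA0 : 0 ≤ A := by positivity
  have hB0 : 0 ≤ B := by positivity
  have hw0 := weight_nonneg Y
  have hnY : nrm Y = 2 * |Y 0 0| + |Y 0 1| + |Y 1 0| := by
    unfold nrm; rw [hY, abs_neg]; ring
  set f : ℝ × ℝ → ℝ := fun p => b + 2 * weight Y * (A * E.indicator 1 p.1 + B) with hf
  have hpt : ∀ p ∈ unitSq, height Γ (rmul Γ (qmk Γ g) (step τ p)) ≤ f p := by
    intro p hp
    rw [rmul_qmk, height_qmk]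
    refine (hdom _ _ (nrm_step_le hτ hp)).trans ?_
    have : weight (((step τ p)⁻¹ : SL2) * Y * (step τ p : Matrix (Fin 2) (Fin 2) ℝ)) ≤
        weight Y * (A * E.indicator 1 p.1 + B) := by
      by_cases hpE : p.1 ∈ E
      · rw [Set.indicator_of_mem hpE, Pi.one_apply, mul_one]
        refine (weight_conj_le _ _).trans ?_
        have := distort_step_le hτ hp
        nlinarith
      · rw [Set.indicator_of_notMem hpE, mul_zero, zero_add]
        have h1 : h ^ 2 / 18 * nrm Y < |Y 1 0 - 2 * Y 0 0 * p.1 - Y 0 1 * p.1 ^ 2| := by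
          rw [hnY]; exact not_le.1 hpE
        have h2 := le_nrm_conj_step τ (p := p) hY
        have h3 : Real.exp τ ≤ Real.exp (τ + p.2) := Real.exp_le_exp.2 (by linarith [hp.2.1])
        have hc : 0 < Real.exp τ * (h ^ 2 / 18) := by positivity
        by_cases hY0 : Y = 0
        · rw [hY0]; simp [weight_zero]
        have hn := nrm_pos hY0
        have h4 : Real.exp τ * (h ^ 2 / 18) * nrm Y ≤
            nrm (((step τ p)⁻¹ : SL2) * Y * (step τ p : Matrix (Fin 2) (Fin 2) ℝ)) := by
          have h5 : 0 ≤ h ^ 2 / 18 * nrm Y := by positivity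
          calc Real.exp τ * (h ^ 2 / 18) * nrm Y = Real.exp τ * (h ^ 2 / 18 * nrm Y) := by ring
            _ ≤ Real.exp (τ + p.2) * |Y 1 0 - 2 * Y 0 0 * p.1 - Y 0 1 * p.1 ^ 2| :=
              mul_le_mul h3 h1.le h5 (Real.exp_pos _).le
            _ ≤ _ := h2
        refine (weight_le_of_le (by positivity) h4).trans (le_of_eq ?_)
        rw [Real.mul_rpow hc.le hn.le, mul_comm]; rfl
    simp only [hf]
    nlinarith
  have hind : Integrable (fun y => E.indicator (1 : ℝ → ℝ) y) (volume.restrict (Set.Icc (0 : ℝ) 1)) :=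
    (integrable_const (1 : ℝ)).indicator hEm
  have hind2 : Integrable (fun p : ℝ × ℝ => E.indicator (1 : ℝ → ℝ) p.1) sqMeas := by
    rw [sqMeas_eq]; exact hind.comp_fst _
  have hi1 : Integrable (fun p : ℝ × ℝ => A * E.indicator (1 : ℝ → ℝ) p.1 + B) sqMeas :=
    (hind2.const_mul A).add (integrable_const B)
  have hi2 : Integrable (fun p : ℝ × ℝ => 2 * weight Y * (A * E.indicator (1 : ℝ → ℝ) p.1 + B))
    sqMeas := hi1.const_mul _
  have hfi : Integrable f sqMeas := (integrable_const b).add hi2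
  have hval : ∫ p, E.indicator (1 : ℝ → ℝ) p.1 ∂sqMeas =
      (volume (Set.Icc (0 : ℝ) 1 ∩ E)).toReal := by
    rw [sqMeas_eq, integral_fun_fst (f := fun y => E.indicator (1 : ℝ → ℝ) y),
      integral_indicator_one hEm]
    simp [measureReal_def, Measure.restrict_apply hEm, Set.inter_comm]
  have hmono : avg τ (height Γ) (qmk Γ g) ≤ ∫ p, f p ∂sqMeas := by
    refine integral_mono_ae (integrable_height_step hτ _) hfi ?_
    filter_upwards [ae_mem_unitSq] with p hp using hpt p hp
  have hint : ∫ p, f p ∂sqMeas =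
      b + 2 * weight Y * (A * (volume (Set.Icc (0 : ℝ) 1 ∩ E)).toReal + B) := by
    simp only [hf]
    rw [integral_add (integrable_const b) hi2, integral_const_mul,
      integral_add (hind2.const_mul A) (integrable_const B), integral_const_mul, hval]
    simp
  rw [hint] at hmono
  refine hmono.trans ?_
  rw [height_qmk]
  by_cases hY0 : Y = 0
  · rw [hY0, weight_zero]
    have := one_le_heightG Γ g
    have : 0 ≤ 2 * (2 * h * A + B) * heightG Γ g := by positivity
    linarith
  have hvol : (volume (Set.Icc (0 : ℝ) 1 ∩ E)).toReal ≤ 2 * h :=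
    ENNReal.toReal_le_of_le_ofReal (by positivity)
      (volume_sublevel_le hh hh1 (by rw [← hnY]; exact nrm_pos hY0))
  have h6 : A * (volume (Set.Icc (0 : ℝ) 1 ∩ E)).toReal + B ≤ 2 * h * A + B := by nlinarith
  have h7 : 0 ≤ 2 * h * A + B := by positivity
  nlinarith [mul_le_mul hYw h6 (by positivity) (hw0.trans hYw)]

theorem eventually_avg_height_le : ∀ᶠ τ in atTop, ∃ b : ℝ, 0 ≤ b ∧
    ∀ (Γ : Subgroup SL2) [DiscreteTopology Γ] (x : XQuot Γ),
      avg τ (height Γ) x ≤ 1 / 8 * height Γ x + b := by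
  have hlim : Tendsto (fun τ : ℝ => 2 * (2 * (36 * Real.exp 1) ^ (1 / 4 : ℝ) +
      (18 : ℝ) ^ (1 / 4 : ℝ)) * Real.exp (-(τ / 12))) atTop (𝓝 (2 * (2 * (36 * Real.exp 1) ^ (1 / 4 : ℝ) +
      (18 : ℝ) ^ (1 / 4 : ℝ)) * 0)) := by
    refine Tendsto.const_mul _ ?_
    refine Real.tendsto_exp_atBot.comp ?_
    exact tendsto_neg_atTop_atBot.comp (tendsto_id.atTop_div_const (by norm_num))
  rw [mul_zero] at hlim
  filter_upwards [hlim.eventually (eventually_le_nhds (by norm_num : (0 : ℝ) < 1 / 8)),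
    eventually_ge_atTop 0] with τ hτ hτ0
  refine ⟨1 + (72 * (36 * Real.exp (τ + 1))) ^ (1 / 4 : ℝ), by positivity, fun Γ _ x => ?_⟩
  refine (avg_height_le_aux hτ0 (Real.exp_pos (-(τ / 3))) (Real.exp_le_one_iff.2 (by linarith))
    x).trans ?_
  have e1 : (36 * Real.exp (τ + 1)) ^ (1 / 4 : ℝ) =
      (36 * Real.exp 1) ^ (1 / 4 : ℝ) * Real.exp (τ / 4) := by
    rw [Real.exp_add, mul_comm (Real.exp τ), ← mul_assoc, Real.mul_rpow (by positivity)
      (by positivity), ← Real.exp_mul]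
    ring_nf
  have e2 : (Real.exp τ * (Real.exp (-(τ / 3)) ^ 2 / 18)) ^ (-(1 / 4) : ℝ) =
      (18 : ℝ) ^ (1 / 4 : ℝ) * Real.exp (-(τ / 12)) := by
    rw [show Real.exp τ * (Real.exp (-(τ / 3)) ^ 2 / 18) = 18⁻¹ * Real.exp (τ / 3) by
      rw [← Real.exp_nat_mul, div_eq_mul_inv, ← mul_assoc, ← Real.exp_add, mul_comm]
      push_cast; ring_nf]
    rw [Real.mul_rpow (by positivity) (by positivity), ← Real.exp_mul,
      Real.inv_rpow (by positivity), Real.rpow_neg (by positivity), inv_inv]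
    ring_nf
  have e3 : 2 * Real.exp (-(τ / 3)) * ((36 * Real.exp 1) ^ (1 / 4 : ℝ) * Real.exp (τ / 4)) =
      2 * (36 * Real.exp 1) ^ (1 / 4 : ℝ) * Real.exp (-(τ / 12)) := by
    have : Real.exp (-(τ / 12)) = Real.exp (-(τ / 3)) * Real.exp (τ / 4) := by
      rw [← Real.exp_add]; ring_nf
    rw [this]; ring
  rw [e1, e2, e3, ← add_mul, ← mul_assoc]
  have := mul_le_mul_of_nonneg_right hτ (height_pos Γ x).le
  gcongr

end Drift

/-! ### Properness and integrability of the height -/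

section Proper

variable {Γ : Subgroup SL2}

theorem weight_rpow {Y : Matrix (Fin 2) (Fin 2) ℝ} : weight Y ^ (-4 : ℝ) = nrm Y := by
  rw [weight, ← Real.rpow_mul (nrm_nonneg _)]; norm_num

theorem le_nrm_conjTl_of_height_le [DiscreteTopology Γ] {g : SL2} {R : ℝ}
    (hg : heightG Γ g ≤ R) {γ : SL2} (hγ : γ ∈ Γ) (hne : conjTl g γ ≠ 0) :
    R ^ (-4 : ℝ) ≤ nrm (conjTl g γ) := by
  have h1 := weight_le_heightG Γ g hγ
  have h2 : 0 < weight (conjTl g γ) := Real.rpow_pos_of_pos (nrm_pos hne) _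
  rw [← weight_rpow]
  exact Real.rpow_le_rpow_of_nonpos h2 (by linarith) (by norm_num)

/-- The sublevel sets of the height are relatively compact. -/
theorem exists_isCompact_of_height_le (hlat : IsLatticeSL2 Γ) (R : ℝ) :
    ∃ C : Set (XQuot Γ), IsCompact C ∧ ∀ x, height Γ x ≤ R → x ∈ C := by
  obtain ⟨hd, m, hm, F, hF, hFfin⟩ := hlat
  rcases lt_or_ge R 1 with hR | hR
  · exact ⟨∅, isCompact_empty, fun x hx => by linarith [one_le_height Γ x]⟩
  set ε := R ^ (-4 : ℝ) with hε
  have hε0 : 0 < ε := by positivity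
  obtain ⟨K₀, hK₀, hK₀1⟩ := exists_compact_mem_nhds (1 : SL2)
  have hW1 : ∀ᶠ h : SL2 in 𝓝 (1 : SL2), nrm (tl (h : Matrix (Fin 2) (Fin 2) ℝ)) < ε := by
    have hc : Continuous fun h : SL2 => nrm (tl (h : Matrix (Fin 2) (Fin 2) ℝ)) := by
      have h0 := isClosedEmbedding_coe_SL2.continuous
      unfold tl
      exact continuous_nrm.comp (h0.sub ((h0.matrix_trace.div_const 2).smul continuous_const))
    refine hc.continuousAt.eventually_lt continuousAt_const ?_
    rw [Matrix.SpecialLinearGroup.coe_one, tl_one, nrm_eq_zero.2 rfl]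
    exact hε0
  have hW2 : ∀ᶠ h : SL2 in 𝓝 (1 : SL2), h ≠ -1 := by
    refine isOpen_ne.mem_nhds fun h => ?_
    have := congrArg (fun g : SL2 => g 0 0) h
    norm_num at this
  have hW : {h : SL2 | nrm (tl (h : Matrix (Fin 2) (Fin 2) ℝ)) < ε ∧ h ≠ -1 ∧ h ∈ K₀} ∈
      𝓝 (1 : SL2) := hW1.and (hW2.and hK₀1)
  obtain ⟨B', hB', hB'W⟩ := exists_nhds_split_inv hW
  obtain ⟨B, hBB', hBo, hB1⟩ := mem_nhds_iff.1 hB'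
  have hBW : ∀ v ∈ B, ∀ w ∈ B, v * w⁻¹ ∈
      {h : SL2 | nrm (tl (h : Matrix (Fin 2) (Fin 2) ℝ)) < ε ∧ h ≠ -1 ∧ h ∈ K₀} :=
    fun v hv w hw => by rw [← div_eq_mul_inv]; exact hB'W v (hBB' hv) w (hBB' hw)
  have hBpos : 0 < m B := hBo.measure_pos m ⟨1, hB1⟩
  -- translates at thick points inject
  have hinj : ∀ g : SL2, heightG Γ g ≤ R → ∀ γ ∈ Γ, ∀ v ∈ B, ∀ w ∈ B, γ * (g * v) = g * w →
      γ = 1 := by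
    intro g hg γ hγ v hv w hw h
    have e : g⁻¹ * γ * g = w * v⁻¹ := by
      rw [eq_mul_inv_iff_mul_eq, mul_assoc, mul_assoc, h, inv_mul_cancel_left]
    obtain ⟨h1, h2, -⟩ := hBW w hw v hv
    rw [← e] at h1 h2
    have h3 : tl ((g⁻¹ * γ * g : SL2) : Matrix (Fin 2) (Fin 2) ℝ) = 0 := by
      by_contra hne
      exact absurd (le_nrm_conjTl_of_height_le hg hγ hne) (not_le.2 h1)
    have h4 := ((tl_eq_zero_iff _).1 h3).resolve_right h2
    have h5 : γ * g = g := by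
      rw [mul_assoc, inv_mul_eq_one] at h4; exact h4.symm
    simpa using h5
  set P : Finset SL2 → Prop := fun s => (∀ g ∈ s, heightG Γ g ≤ R) ∧
    ∀ g ∈ s, ∀ g' ∈ s, ∀ v ∈ B, ∀ w ∈ B, qmk Γ (g * v) = qmk Γ (g' * w) → g = g' with hP
  have hcard : ∀ s, P s → (s.card : ENNReal) * m B ≤ m F := by
    rintro s ⟨hs1, hs2⟩
    set t : Set SL2 := ⋃ g ∈ s, (fun h => g * h) '' B with ht
    have hopen : ∀ g : SL2, IsOpen ((fun h => g * h) '' B) := fun g => isOpenMap_mul_left g _ hBo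
    have htm : m t = s.card * m B := by
      rw [ht, measure_biUnion_finset]
      · rw [Finset.sum_congr rfl (fun g _ => ?_), Finset.sum_const, nsmul_eq_mul]
        rw [Set.image_mul_left, measure_preimage_mul]
      · intro g hg g' hg' hne
        refine Set.disjoint_left.2 ?_
        rintro _ ⟨v, hv, rfl⟩ ⟨w, hw, h⟩
        exact hne (hs2 g hg g' hg' v hv w hw (congrArg _ h.symm))
      · exact fun g _ => (hopen g).measurableSet
    rw [← htm]
    refine hF.measure_le_of_pairwise_disjoint
      (isOpen_biUnion fun g _ => hopen g).measurableSet.nullMeasurableSet ?_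
    intro γ γ' hne
    refine Disjoint.aedisjoint (Set.disjoint_left.2 ?_)
    rintro z ⟨hz, -⟩ ⟨hz', -⟩
    rw [Set.mem_smul_set] at hz hz'
    obtain ⟨y, hy, rfl⟩ := hz
    obtain ⟨y', hy', h⟩ := hz'
    simp only [ht, Set.mem_iUnion, Set.mem_image, exists_prop] at hy hy'
    obtain ⟨g, hg, v, hv, rfl⟩ := hy
    obtain ⟨g', hg', w, hw, rfl⟩ := hy'
    have h' : (γ' : SL2) * (g' * w) = γ * (g * v) := h
    have e1 : ((γ' : SL2)⁻¹ * γ) * (g * v) = g' * w := by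
      rw [mul_assoc, ← h', inv_mul_cancel_left]
    have hmem : ((γ' : SL2)⁻¹ * γ) ∈ Γ := mul_mem (inv_mem γ'.2) γ.2
    have e2 : g = g' := by
      refine hs2 g hg g' hg' v hv w hw (qmk_eq_qmk_iff.2 ?_)
      rw [← e1, mul_inv_cancel_right]; exact hmem
    rw [← e2] at e1
    have e3 := hinj g (hs1 g hg) _ hmem v hv w hw e1
    rw [inv_mul_eq_one] at e3
    exact hne (Subtype.ext e3.symm)
  obtain ⟨N, hN⟩ : ∃ N : ℕ, ∀ s, P s → s.card ≤ N := by
    obtain ⟨N, hN⟩ := ENNReal.exists_nat_mul_gt hBpos.ne' hFfin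
    refine ⟨N, fun s hs => ?_⟩
    by_contra! hlt
    have h1 : (N : ENNReal) * m B ≤ s.card * m B := by gcongr
    exact absurd (h1.trans (hcard s hs)) (not_le.2 hN)
  classical
  obtain ⟨s, hs, hmax⟩ : ∃ s, P s ∧ ∀ s', P s' → s'.card ≤ s.card := by
    obtain ⟨s, hs, h⟩ := Nat.findGreatest_spec (P := fun n => ∃ s, P s ∧ s.card = n) (n := N)
      (Nat.zero_le N) ⟨∅, by simp [hP], rfl⟩
    refine ⟨s, hs, fun s' hs' => ?_⟩
    rw [h]
    exact Nat.le_findGreatest (hN s' hs') ⟨s', hs', rfl⟩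
  refine ⟨⋃ g ∈ s, (fun h => qmk Γ (g * h)) '' K₀, s.isCompact_biUnion fun g _ =>
    hK₀.image (continuous_qmk.comp (continuous_const.mul continuous_id)), fun x hx => ?_⟩
  obtain ⟨g, rfl⟩ := qmk_surjective x
  rw [height_qmk] at hx
  suffices ∃ g' ∈ s, ∃ v ∈ B, ∃ w ∈ B, qmk Γ (g * v) = qmk Γ (g' * w) by
    obtain ⟨g', hg', v, hv, w, hw, h⟩ := this
    simp only [Set.mem_iUnion, Set.mem_image, exists_prop]
    refine ⟨g', hg', w * v⁻¹, (hBW w hw v hv).2.2, ?_⟩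
    rw [← mul_assoc, ← rmul_qmk, ← h, rmul_qmk, mul_inv_cancel_right]
  by_contra! hcon
  have hgs : g ∉ s := fun hgs => hcon g hgs 1 hB1 1 hB1 rfl
  have hP' : P (insert g s) := by
    refine ⟨fun h hh => ?_, fun a ha b hb v hv w hw hab => ?_⟩
    · rcases Finset.mem_insert.1 hh with rfl | hh
      exacts [hx, hs.1 _ hh]
    · rcases Finset.mem_insert.1 ha with ha | ha <;> rcases Finset.mem_insert.1 hb with hb | hb
      · rw [ha, hb]
      · rw [ha] at hab; exact absurd hab (hcon b hb v hv w hw)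
      · rw [hb] at hab; exact absurd hab.symm (hcon a ha w hw v hv)
      · exact hs.2 a ha b hb v hv w hw hab
  have := hmax _ hP'
  rw [Finset.card_insert_of_notMem hgs] at this
  omega

end Proper

section Integrability

variable {Γ : Subgroup SL2}

theorem continuous_distort : Continuous distort := by
  unfold distort
  have h := continuous_nrm.comp isClosedEmbedding_coe_SL2.continuous
  exact (h.mul (h.comp continuous_inv)).rpow_const fun _ => Or.inr (by norm_num)

theorem exists_height_le_of_isCompact [DiscreteTopology Γ] {C : Set (XQuot Γ)} (hC : IsCompact C) :
    ∃ M, ∀ x ∈ C, height Γ x ≤ M := by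
  refine hC.induction_on (p := fun s => ∃ M, ∀ x ∈ s, height Γ x ≤ M) ⟨0, by simp⟩ ?_ ?_ ?_
  · rintro s t hst ⟨M, hM⟩
    exact ⟨M, fun x hx => hM x (hst hx)⟩
  · rintro s t ⟨M, hM⟩ ⟨M', hM'⟩
    refine ⟨max M M', fun x hx => ?_⟩
    rcases hx with hx | hx
    exacts [(hM x hx).trans (le_max_left _ _), (hM' x hx).trans (le_max_right _ _)]
  · intro x _
    have h1 : ∀ᶠ k : SL2 in 𝓝 1, distort k < distort 1 + 1 :=
      continuous_distort.continuousAt.eventually_lt continuousAt_const (by simp)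
    have h2 : ∀ᶠ k : SL2 in 𝓝 1, height Γ (rmul Γ x k) ≤ (distort 1 + 1) * height Γ x :=
      h1.mono fun k hk => (height_rmul_le Γ x k).trans
        (mul_le_mul_of_nonneg_right hk.le (height_pos Γ x).le)
    have h3 : ∀ᶠ y in 𝓝 x, height Γ y ≤ (distort 1 + 1) * height Γ x := by
      rw [← map_rmul_nhds_one]; exact h2
    exact ⟨_, mem_nhdsWithin_of_mem_nhds h3, _, fun y hy => hy⟩

variable {μ : Measure (XQuot Γ)} [IsProbabilityMeasure μ]

theorem continuous_rmul_step (τ : ℝ) :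
    Continuous fun q : XQuot Γ × (ℝ × ℝ) => rmul Γ q.1 (step τ q.2) :=
  continuous_rmul.comp (continuous_fst.prodMk ((continuous_step τ).comp continuous_snd))

theorem integrable_prod_step (hinv : ∀ g : SL2, Measure.map (fun x => rmul Γ x g) μ = μ) (τ : ℝ)
    {φ : XQuot Γ → ℝ} (hm : Measurable φ) (hi : Integrable φ μ) :
    Integrable (fun q : XQuot Γ × (ℝ × ℝ) => φ (rmul Γ q.1 (step τ q.2))) (μ.prod sqMeas) := by
  have hm' : Measurable fun q : XQuot Γ × (ℝ × ℝ) => φ (rmul Γ q.1 (step τ q.2)) :=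
    hm.comp (continuous_rmul_step τ).measurable
  rw [integrable_prod_iff' hm'.aestronglyMeasurable]
  have h (p : ℝ × ℝ) : ∫ x, ‖φ (rmul Γ x (step τ p))‖ ∂μ = ∫ x, ‖φ x‖ ∂μ := by
    have := integral_map (μ := μ) (continuous_rmul_left (Γ := Γ) (step τ p)).measurable.aemeasurable
      (f := fun x => ‖φ x‖) hm.norm.aestronglyMeasurable
    rw [hinv] at this
    exact this.symm
  constructor
  · refine ae_of_all _ fun p => ?_
    exact (measurePreserving_rmul hinv (step τ p)).integrable_comp_of_integrable hi
  · simp only [h]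
    exact integrable_const (∫ x, ‖φ x‖ ∂μ)

theorem integrable_avg (hinv : ∀ g : SL2, Measure.map (fun x => rmul Γ x g) μ = μ) (τ : ℝ)
    {φ : XQuot Γ → ℝ} (hm : Measurable φ) (hi : Integrable φ μ) : Integrable (avg τ φ) μ :=
  (integrable_prod_step hinv τ hm hi).integral_prod_left

theorem integral_avg (hinv : ∀ g : SL2, Measure.map (fun x => rmul Γ x g) μ = μ) (τ : ℝ)
    {φ : XQuot Γ → ℝ} (hm : Measurable φ) (hi : Integrable φ μ) :
    ∫ x, avg τ φ x ∂μ = ∫ x, φ x ∂μ := by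
  unfold avg
  rw [integral_integral_swap (integrable_prod_step hinv τ hm hi)]
  have h (p : ℝ × ℝ) : ∫ x, φ (rmul Γ x (step τ p)) ∂μ = ∫ x, φ x ∂μ := by
    have := integral_map (μ := μ) (continuous_rmul_left (Γ := Γ) (step τ p)).measurable.aemeasurable
      (f := φ) hm.aestronglyMeasurable
    rw [hinv] at this
    exact this.symm
  simp [h]

theorem integrable_height [DiscreteTopology Γ]
    (hinv : ∀ g : SL2, Measure.map (fun x => rmul Γ x g) μ = μ) : Integrable (height Γ) μ := by
  obtain ⟨τ, ⟨b, hb, hdrift⟩, hτ⟩ := (eventually_avg_height_le.and (eventually_ge_atTop 0)).exists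
  replace hdrift := hdrift Γ
  have hVm := measurable_height Γ
  set S : ℕ → Set (XQuot Γ) := fun K => {x | height Γ x ≤ K} with hS
  have hSm : ∀ K, MeasurableSet (S K) := fun K => measurableSet_le hVm measurable_const
  have hcov : AECover μ atTop S := by
    refine ⟨ae_of_all _ fun x => ?_, hSm⟩
    obtain ⟨K, hK⟩ := exists_nat_ge (height Γ x)
    filter_upwards [eventually_ge_atTop K] with n hn
    exact hK.trans (by exact_mod_cast hn)
  have hint : ∀ K, IntegrableOn (height Γ) (S K) μ := fun K => by
    refine Integrable.of_bound (C := K) hVm.aestronglyMeasurable ?_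
    filter_upwards [ae_restrict_mem (hSm K)] with x hx
    rw [Real.norm_of_nonneg (height_pos Γ _).le]
    exact hx
  refine hcov.integrable_of_integral_bounded_of_nonneg_ae (8 * b) hint
    (ae_of_all _ fun x => (height_pos Γ x).le) (Eventually.of_forall fun K => ?_)
  have hWm : Measurable fun x => min (height Γ x) K := hVm.min measurable_const
  have hWb : ∀ x, ‖min (height Γ x) (K : ℝ)‖ ≤ K := fun x => by
    rw [Real.norm_of_nonneg (le_min (height_pos Γ x).le K.cast_nonneg)]; exact min_le_right _ _
  have hWi : Integrable (fun x => min (height Γ x) (K : ℝ)) μ :=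
    Integrable.of_bound hWm.aestronglyMeasurable _ (ae_of_all _ hWb)
  have hWs : ∀ x, Integrable (fun p => min (height Γ (rmul Γ x (step τ p))) (K : ℝ)) sqMeas :=
    fun x => Integrable.of_bound (hWm.comp ((continuous_rmul_right x).comp
      (continuous_step τ)).measurable).aestronglyMeasurable _ (ae_of_all _ fun p => hWb _)
  have h1 := integral_avg hinv τ hWm hWi
  have h2 : ∀ x, avg τ (fun x => min (height Γ x) (K : ℝ)) x - min (height Γ x) K ≤
      (S K).indicator (fun x => b - 7 / 8 * height Γ x) x := by
    intro x
    have h3 : avg τ (fun x => min (height Γ x) (K : ℝ)) x ≤ avg τ (height Γ) x :=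
      integral_mono (hWs x) (integrable_height_step hτ x) fun p => min_le_left _ _
    have h4 : avg τ (fun x => min (height Γ x) (K : ℝ)) x ≤ K := by
      refine (integral_mono (hWs x) (integrable_const (K : ℝ)) fun p => min_le_right _ _).trans ?_
      simp
    by_cases hx : x ∈ S K
    · rw [Set.indicator_of_mem hx, min_eq_left hx]
      linarith [hdrift x]
    · rw [Set.indicator_of_notMem hx, min_eq_right (not_le.1 hx).le]
      linarith
  have h5 : IntegrableOn (fun x => b - 7 / 8 * height Γ x) (S K) μ :=
    (integrable_const b).sub ((hint K).const_mul _)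
  have h6 := integral_mono ((integrable_avg hinv τ hWm hWi).sub hWi)
    ((integrable_indicator_iff (hSm K)).2 h5) h2
  rw [integral_indicator (hSm K)] at h6
  have h7 : ∫ x, (avg τ (fun x => min (height Γ x) (K : ℝ)) - fun x => min (height Γ x) (K : ℝ)) x ∂μ = 0 := by
    rw [integral_sub' (integrable_avg hinv τ hWm hWi) hWi, h1, sub_self]
  rw [h7, integral_sub (integrable_const b) ((hint K).const_mul _), integral_const_mul] at h6
  have h8 : ∫ x in S K, b ∂μ ≤ b := by
    rw [setIntegral_const, smul_eq_mul]
    have : μ.real (S K) ≤ 1 := measureReal_le_one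
    nlinarith
  have h9 : 0 ≤ ∫ x in S K, height Γ x ∂μ := integral_nonneg fun x => (height_pos Γ x).le
  linarith

end Integrability

section Regularity

variable {Γ : Subgroup SL2}

/-- Functions of controlled oscillation relative to the height, with prescribed local Lipschitz
constants along `lmat`, `amat` and `umat`. -/
structure Reg (τ k mL mA mU : ℝ) (φ : XQuot Γ → ℝ) : Prop where
  osc : ∀ x y, |φ x - φ y| ≤ k * (height Γ x + height Γ y)
  lmat : ∀ x y, |y| ≤ 1 → |φ (rmul Γ x (lmat y)) - φ x| ≤ mL * |y| * height Γ x
  amat : ∀ x s, |s| ≤ Real.exp (-(τ + 2)) / 4 →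
    |φ (rmul Γ x (amat s)) - φ x| ≤ mA * |s| * height Γ x
  umat : ∀ x z, |z| ≤ Real.exp (-(τ + 2)) / 32 →
    |φ (rmul Γ x (umat z)) - φ x| ≤ mU * |z| * height Γ x

variable [DiscreteTopology Γ]

theorem eventually_abs_sub_le (τ k : ℝ) {mL mA mU : ℝ} (hA : 0 ≤ mA) (hU : 0 ≤ mU)
    {ε : ℝ} (hε : 0 < ε) : ∀ᶠ g : SL2 in 𝓝 1, ∀ φ : XQuot Γ → ℝ, Reg τ k mL mA mU φ →
      ∀ x, |φ (rmul Γ x g) - φ x| ≤ ε * height Γ x := by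
  have hc : ∀ i j, Continuous fun g : SL2 => g i j := fun i j => continuous_SL2_apply i j
  have h00 : ContinuousAt (fun g : SL2 => g 0 0) 1 := (hc 0 0).continuousAt
  have hone : ((1 : SL2) 0 0) ≠ 0 := by simp
  have c1 : ContinuousAt (fun g : SL2 => g 1 0 / g 0 0) 1 := (hc 1 0).continuousAt.div h00 hone
  have c2 : ContinuousAt (fun g : SL2 => 2 * Real.log (g 0 0)) 1 := (h00.log hone).const_mul 2
  have c3 : ContinuousAt (fun g : SL2 => g 0 1 / g 0 0) 1 := (hc 0 1).continuousAt.div h00 hone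
  have d1 : ContinuousAt (fun g : SL2 => lmat (g 1 0 / g 0 0)) 1 :=
    continuous_lmat.continuousAt.comp c1
  have d2 : ContinuousAt (fun g : SL2 => amat (2 * Real.log (g 0 0))) 1 :=
    continuous_amat.continuousAt.comp c2
  have e1 : ContinuousAt (fun g : SL2 => distort (lmat (g 1 0 / g 0 0))) 1 :=
    continuous_distort.continuousAt.comp d1
  have e2 : ContinuousAt (fun g : SL2 => distort (lmat (g 1 0 / g 0 0) * amat (2 * Real.log (g 0 0)))) 1 :=
    continuous_distort.continuousAt.comp (d1.mul d2)
  have hω : ContinuousAt (fun g : SL2 => mL * |g 1 0 / g 0 0| +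
      mA * |2 * Real.log (g 0 0)| * distort (lmat (g 1 0 / g 0 0)) +
      mU * |g 0 1 / g 0 0| * distort (lmat (g 1 0 / g 0 0) * amat (2 * Real.log (g 0 0)))) 1 :=
    ((c1.abs.const_mul _).add ((c2.abs.const_mul _).mul e1)).add ((c3.abs.const_mul _).mul e2)
  filter_upwards [hω.eventually_lt continuousAt_const (show _ < ε by simpa using hε),
    c1.abs.eventually_lt continuousAt_const (show _ < (1 : ℝ) by simp),
    c2.abs.eventually_lt continuousAt_const (show _ < Real.exp (-(τ + 2)) / 4 by simp [Real.exp_pos]),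
    c3.abs.eventually_lt continuousAt_const (show _ < Real.exp (-(τ + 2)) / 32 by simp [Real.exp_pos]),
    h00.eventually_const_lt (show (0 : ℝ) < (1 : SL2) 0 0 by simp)] with g h1 h2 h3 h4 h5 φ hφ x
  have hg := eq_lmat_mul_amat_mul_umat g h5
  set p := g 1 0 / g 0 0
  set q := 2 * Real.log (g 0 0)
  set r := g 0 1 / g 0 0
  have a1 := hφ.lmat x p h2.le
  have a2 := hφ.amat (rmul Γ x (lmat p)) q h3.le
  have a3 := hφ.umat (rmul Γ (rmul Γ x (lmat p)) (amat q)) r h4.le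
  have b2 := height_rmul_le Γ x (lmat p)
  have b3 := height_rmul_le Γ x (lmat p * amat q)
  have b2' := mul_le_mul_of_nonneg_left b2 (show 0 ≤ mA * |q| by positivity)
  have b3' := mul_le_mul_of_nonneg_left b3 (show 0 ≤ mU * |r| by positivity)
  rw [rmul_mul] at b3'
  have hV := height_pos Γ x
  rw [hg, rmul_mul, rmul_mul]
  have h1' := mul_le_mul_of_nonneg_right h1.le hV.le
  rw [abs_le] at *
  constructor <;> linarith

theorem Reg.continuous {τ k mL mA mU : ℝ} (hA : 0 ≤ mA) (hU : 0 ≤ mU)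
    {φ : XQuot Γ → ℝ} (h : Reg τ k mL mA mU φ) : Continuous φ := by
  refine continuous_iff_continuousAt.2 fun x => ?_
  rw [ContinuousAt, tendsto_comp_rmul_iff, Metric.tendsto_nhds]
  intro ε hε
  have hV := height_pos Γ x
  filter_upwards [eventually_abs_sub_le (Γ := Γ) τ k hA hU
    (show 0 < ε / (2 * height Γ x) by positivity)] with g hg
  rw [Real.dist_eq]
  refine (hg φ h x).trans_lt ?_
  rw [div_mul_eq_mul_div, div_lt_iff₀ (by positivity)]
  nlinarith

end Regularity

section SquareIntegrals

theorem integrable_sqMeas {h : ℝ × ℝ → ℝ} (hh : Continuous h) : Integrable h sqMeas :=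
  hh.continuousOn.integrableOn_compact isCompact_unitSq

theorem abs_integral_sqMeas_le {h : ℝ × ℝ → ℝ} {M : ℝ} (hM : ∀ p ∈ unitSq, |h p| ≤ M) :
    |∫ p, h p ∂sqMeas| ≤ M := by
  have := norm_integral_le_of_norm_le_const (μ := sqMeas) (f := h) (C := M)
    (by filter_upwards [ae_mem_unitSq] with p hp using hM p hp)
  simpa using this

theorem integral_sqMeas_eq {h : ℝ × ℝ → ℝ} (hh : Continuous h) :
    ∫ p, h p ∂sqMeas = ∫ v in (0 : ℝ)..1, ∫ σ in (0 : ℝ)..1, h (v, σ) := by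
  have hi := integrable_sqMeas hh
  rw [sqMeas_eq] at hi ⊢
  rw [integral_prod _ hi]
  simp only [intervalIntegral.integral_of_le zero_le_one, integral_Icc_eq_integral_Ioc]

theorem integral_sqMeas_eq_symm {h : ℝ × ℝ → ℝ} (hh : Continuous h) :
    ∫ p, h p ∂sqMeas = ∫ σ in (0 : ℝ)..1, ∫ v in (0 : ℝ)..1, h (v, σ) := by
  have hi := integrable_sqMeas hh
  rw [sqMeas_eq] at hi ⊢
  rw [integral_prod_symm _ hi]
  simp only [intervalIntegral.integral_of_le zero_le_one, integral_Icc_eq_integral_Ioc]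

theorem abs_integral_shift_sub_le {f : ℝ → ℝ} (hf : Continuous f) {y M : ℝ}
    (h : ∀ v, |v| ≤ |y| → |f (1 + v) - f v| ≤ M) :
    |(∫ v in (0 : ℝ)..1, f (v + y)) - ∫ v in (0 : ℝ)..1, f v| ≤ M * |y| := by
  have hi : ∀ a b, IntervalIntegrable f volume a b := fun a b => hf.intervalIntegrable a b
  have e : (∫ v in (0 : ℝ)..1, f (v + y)) - ∫ v in (0 : ℝ)..1, f v =
      ∫ v in (0 : ℝ)..y, (f (1 + v) - f v) := by
    rw [intervalIntegral.integral_sub ((by fun_prop : Continuous fun v => f (1 + v)).intervalIntegrable _ _)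
      (hi _ _), intervalIntegral.integral_comp_add_right, intervalIntegral.integral_comp_add_left,
      zero_add, add_zero]
    have h1 := intervalIntegral.integral_add_adjacent_intervals (hi 0 1) (hi 1 (1 + y))
    have h2 := intervalIntegral.integral_add_adjacent_intervals (hi 0 y) (hi y (1 + y))
    linarith
  rw [e]
  have := intervalIntegral.norm_integral_le_of_norm_le_const (a := 0) (b := y)
    (f := fun v => f (1 + v) - f v) (C := M) fun v hv => h v (by
      rcases Set.mem_uIoc.1 hv with hv | hv
      · rw [abs_of_pos hv.1, abs_of_pos (by linarith)]; exact hv.2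
      · rw [abs_of_nonpos hv.2, abs_of_nonpos (by linarith)]; linarith)
  simpa using this

theorem abs_integral_fst_shift_sub_le {h : ℝ × ℝ → ℝ} (hh : Continuous h) {y M : ℝ}
    (hM : ∀ v σ, |v| ≤ |y| → σ ∈ Set.Icc (0 : ℝ) 1 → |h (1 + v, σ) - h (v, σ)| ≤ M) :
    |(∫ p, h (p.1 + y, p.2) ∂sqMeas) - ∫ p, h p ∂sqMeas| ≤ M * |y| := by
  have h1 : Continuous fun p : ℝ × ℝ => h (p.1 + y, p.2) := by fun_prop
  rw [integral_sqMeas_eq_symm h1, integral_sqMeas_eq_symm hh, ← intervalIntegral.integral_sub]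
  · have := intervalIntegral.norm_integral_le_of_norm_le_const (a := 0) (b := 1)
      (f := fun σ => (∫ v in (0 : ℝ)..1, h (v + y, σ)) - ∫ v in (0 : ℝ)..1, h (v, σ))
      (C := M * |y|) fun σ hσ => by
        rw [Set.uIoc_of_le zero_le_one] at hσ
        exact abs_integral_shift_sub_le (f := fun v => h (v, σ)) (by fun_prop)
          fun v hv => hM v σ hv ⟨hσ.1.le, hσ.2⟩
    simpa using this
  · refine Continuous.intervalIntegrable ?_ _ _
    exact intervalIntegral.continuous_parametric_intervalIntegral_of_continuous'
      (f := fun σ v => h (v + y, σ)) (by fun_prop) 0 1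
  · refine Continuous.intervalIntegrable ?_ _ _
    exact intervalIntegral.continuous_parametric_intervalIntegral_of_continuous'
      (f := fun σ v => h (v, σ)) (by fun_prop) 0 1

theorem abs_integral_snd_shift_sub_le {h : ℝ × ℝ → ℝ} (hh : Continuous h) {y M : ℝ}
    (hM : ∀ v σ, |σ| ≤ |y| → v ∈ Set.Icc (0 : ℝ) 1 → |h (v, 1 + σ) - h (v, σ)| ≤ M) :
    |(∫ p, h (p.1, p.2 + y) ∂sqMeas) - ∫ p, h p ∂sqMeas| ≤ M * |y| := by
  have h1 : Continuous fun p : ℝ × ℝ => h (p.1, p.2 + y) := by fun_prop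
  have h2 : Continuous fun p : ℝ × ℝ => h (p.2, p.1) := by fun_prop
  have h3 : Continuous fun p : ℝ × ℝ => h (p.2, p.1 + y) := by fun_prop
  have := abs_integral_fst_shift_sub_le h2 (y := y) (M := M) fun v σ hv hσ => hM σ v hv hσ
  rw [integral_sqMeas_eq h2, integral_sqMeas_eq h3] at this
  rwa [integral_sqMeas_eq_symm hh, integral_sqMeas_eq_symm h1]

end SquareIntegrals

/-- the distortion of the height under the group elements moving a point by one step -/
def stepDistort (τ : ℝ) : ℝ := (64 * Real.exp (τ + 2)) ^ (1 / 4 : ℝ)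

theorem stepDistort_pos (τ : ℝ) : 0 < stepDistort τ := by unfold stepDistort; positivity

theorem distort_lmat_mul_amat_le {τ v t : ℝ} (hv : |v| ≤ 2) (ht : |t| ≤ τ + 2) :
    distort (lmat v * amat t) ≤ stepDistort τ := by
  have h1 := nrm_amat_le ht
  have h3 : nrm (lmat v * amat t : SL2) ≤ 4 * (2 * Real.exp ((τ + 2) / 2)) := by
    rw [Matrix.SpecialLinearGroup.coe_mul]
    refine (nrm_mul_le _ _).trans ?_
    have : nrm (lmat v) ≤ 4 := by rw [nrm_lmat]; linarith
    exact mul_le_mul this h1 (nrm_nonneg _) (by norm_num)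
  unfold distort stepDistort
  refine Real.rpow_le_rpow (mul_nonneg (nrm_nonneg _) (nrm_nonneg _)) ?_ (by norm_num)
  rw [nrm_inv]
  calc _ ≤ 4 * (2 * Real.exp ((τ + 2) / 2)) * (4 * (2 * Real.exp ((τ + 2) / 2))) :=
        mul_le_mul h3 h3 (nrm_nonneg _) (by positivity)
    _ = 64 * (Real.exp ((τ + 2) / 2) * Real.exp ((τ + 2) / 2)) := by ring
    _ = 64 * Real.exp (τ + 2) := by rw [← Real.exp_add]; ring_nf

section Step

variable {Γ : Subgroup SL2}

variable {φ : XQuot Γ → ℝ} {τ : ℝ}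

theorem continuous_comp_step (hφ : Continuous φ) (τ : ℝ) (x : XQuot Γ) :
    Continuous fun p : ℝ × ℝ => φ (rmul Γ x (step τ p)) :=
  hφ.comp ((continuous_rmul_right x).comp (continuous_step τ))

theorem integrable_comp_step (hφ : Continuous φ) (τ : ℝ) (x : XQuot Γ) :
    Integrable (fun p : ℝ × ℝ => φ (rmul Γ x (step τ p))) sqMeas :=
  integrable_sqMeas (continuous_comp_step hφ τ x)

variable [DiscreteTopology Γ]

theorem height_lmat_mul_amat_le {τ v t : ℝ} (hv : |v| ≤ 2) (ht : |t| ≤ τ + 2) (x : XQuot Γ) :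
    height Γ (rmul Γ x (lmat v * amat t)) ≤ stepDistort τ * height Γ x :=
  (height_rmul_le Γ x _).trans
    (mul_le_mul_of_nonneg_right (distort_lmat_mul_amat_le hv ht) (height_pos Γ x).le)

theorem avg_lmat_le (hτ : 0 ≤ τ) {k : ℝ} (hk : 0 ≤ k) (hφ : Continuous φ)
    (hosc : ∀ x y, |φ x - φ y| ≤ k * (height Γ x + height Γ y)) (x : XQuot Γ) {y : ℝ}
    (hy : |y| ≤ 1) :
    |avg τ φ (rmul Γ x (lmat y)) - avg τ φ x| ≤ 2 * k * stepDistort τ * |y| * height Γ x := by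
  have h := abs_integral_fst_shift_sub_le (continuous_comp_step hφ τ x) (y := y)
    (M := 2 * k * stepDistort τ * height Γ x) fun v σ hv hσ => by
      have hσ' : |τ + σ| ≤ τ + 2 := by rw [abs_of_nonneg (by linarith [hσ.1])]; linarith [hσ.2]
      have hv' := abs_le.1 (hv.trans hy)
      have h1 := height_lmat_mul_amat_le (v := 1 + v) (t := τ + σ)
        (abs_le.2 ⟨by linarith, by linarith⟩) hσ' x
      have h2 := height_lmat_mul_amat_le (v := v) (t := τ + σ)
        (abs_le.2 ⟨by linarith, by linarith⟩) hσ' x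
      refine (hosc _ _).trans ?_
      unfold step
      nlinarith
  have e : ∀ p : ℝ × ℝ, rmul Γ (rmul Γ x (lmat y)) (step τ p) = rmul Γ x (step τ (p.1 + y, p.2)) := by
    intro p
    rw [← rmul_mul, step, step, ← mul_assoc, ← lmat_add, add_comm y]
  unfold avg
  simp only [e]
  refine h.trans (le_of_eq (by ring))

theorem avg_amat_le (hτ : 0 ≤ τ) {k mL mA mU : ℝ} (hk : 0 ≤ k) (hL : 0 ≤ mL) (hφ : Continuous φ)
    (h : Reg τ k mL mA mU φ) (x : XQuot Γ) {s : ℝ} (hs : |s| ≤ Real.exp (-(τ + 2)) / 4) :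
    |avg τ φ (rmul Γ x (amat s)) - avg τ φ x| ≤
      (2 * Real.exp (τ + 2) * mL + 2 * k) * stepDistort τ * |s| * height Γ x := by
  have hs1 : |s| ≤ 1 / 4 := hs.trans (by
    have : Real.exp (-(τ + 2)) ≤ 1 := Real.exp_le_one_iff.2 (by linarith)
    linarith)
  have hs2 := abs_le.1 hs1
  have hE : Real.exp (τ + 2) * |s| ≤ 1 / 4 := by
    have h1 := mul_le_mul_of_nonneg_left hs (Real.exp_pos (τ + 2)).le
    rwa [← mul_div_assoc, ← Real.exp_add, add_neg_cancel, Real.exp_zero] at h1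
  have hexp : |Real.exp (-s) - 1| ≤ 2 * |s| := by
    have := Real.abs_exp_sub_one_le (x := -s) (by rw [abs_neg]; linarith)
    rwa [abs_neg] at this
  have hV := height_pos Γ x
  have hD := stepDistort_pos τ
  have h1 := abs_integral_snd_shift_sub_le (continuous_comp_step hφ τ x) (y := s)
    (M := 2 * k * stepDistort τ * height Γ x) fun v σ hσ hv => by
      have hσ' := abs_le.1 (hσ.trans hs1)
      have hv' : |v| ≤ 2 := by rw [abs_of_nonneg hv.1]; linarith [hv.2]
      have h1 := height_lmat_mul_amat_le (v := v) (t := τ + (1 + σ)) (τ := τ) hv'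
        (abs_le.2 ⟨by linarith, by linarith⟩) x
      have h2 := height_lmat_mul_amat_le (v := v) (t := τ + σ) (τ := τ) hv'
        (abs_le.2 ⟨by linarith, by linarith⟩) x
      refine (h.osc _ _).trans ?_
      unfold step
      nlinarith
  have hc1 : Continuous fun p : ℝ × ℝ => φ (rmul Γ (rmul Γ x (amat s)) (step τ p)) :=
    continuous_comp_step hφ τ _
  have hc2 : Continuous fun p : ℝ × ℝ => φ (rmul Γ x (step τ (p.1, p.2 + s))) :=
    (continuous_comp_step hφ τ x).comp (by fun_prop)
  have h2 : |∫ p, (φ (rmul Γ (rmul Γ x (amat s)) (step τ p)) -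
      φ (rmul Γ x (step τ (p.1, p.2 + s)))) ∂sqMeas| ≤
      2 * Real.exp (τ + 2) * mL * stepDistort τ * |s| * height Γ x := by
    refine abs_integral_sqMeas_le ?_
    rintro ⟨v, σ⟩ ⟨hv, hσ⟩
    simp only at hv hσ
    have e : amat s * step τ (v, σ) = step τ (v, σ + s) *
        lmat (Real.exp (τ + (σ + s)) * ((Real.exp (-s) - 1) * v)) := by
      simp only [step]
      rw [mul_assoc (lmat v), ← lmat_mul_amat, ← mul_assoc (lmat v), ← lmat_add, ← mul_assoc,
        amat_mul_lmat, mul_assoc, ← amat_add]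
      congr 2 <;> ring
    rw [← rmul_mul, e, rmul_mul]
    set η := Real.exp (τ + (σ + s)) * ((Real.exp (-s) - 1) * v) with hη
    have hη1 : |η| ≤ 2 * Real.exp (τ + 2) * |s| := by
      rw [hη, abs_mul, abs_mul, abs_of_pos (Real.exp_pos _), abs_of_nonneg hv.1]
      have h3 : Real.exp (τ + (σ + s)) ≤ Real.exp (τ + 2) := Real.exp_le_exp.2 (by linarith [hσ.2])
      have h4 : |Real.exp (-s) - 1| * v ≤ 2 * |s| := by
        nlinarith [hv.2, hv.1, abs_nonneg (Real.exp (-s) - 1)]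
      calc _ ≤ Real.exp (τ + 2) * (2 * |s|) :=
            mul_le_mul h3 h4 (mul_nonneg (abs_nonneg _) hv.1) (Real.exp_pos _).le
        _ = _ := by ring
    have h5 := h.lmat (rmul Γ x (step τ (v, σ + s))) η (by linarith)
    have h6 : height Γ (rmul Γ x (step τ (v, σ + s))) ≤ stepDistort τ * height Γ x :=
      height_lmat_mul_amat_le (by rw [abs_of_nonneg hv.1]; linarith [hv.2])
        (abs_le.2 ⟨by linarith [hσ.1], by linarith [hσ.2]⟩) x
    refine h5.trans ?_
    calc _ ≤ mL * (2 * Real.exp (τ + 2) * |s|) * (stepDistort τ * height Γ x) :=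
          mul_le_mul (mul_le_mul_of_nonneg_left hη1 hL) h6 (height_pos Γ _).le (by positivity)
      _ = _ := by ring
  rw [integral_sub (integrable_sqMeas hc1) (integrable_sqMeas hc2)] at h2
  unfold avg
  rw [abs_le] at *
  constructor <;> linarith

theorem avg_umat_le (hτ : 0 ≤ τ) (hτ' : 8 * stepDistort τ ≤ Real.exp τ) {k mL mA mU : ℝ}
    (hL : 0 ≤ mL) (hA : 0 ≤ mA) (hU : 0 ≤ mU) (hφ : Continuous φ)
    (h : Reg τ k mL mA mU φ) (x : XQuot Γ) {z : ℝ} (hz : |z| ≤ Real.exp (-(τ + 2)) / 32) :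
    |avg τ φ (rmul Γ x (umat z)) - avg τ φ x| ≤
      ((2 * Real.exp (τ + 2) * mL + 4 * mA) * stepDistort τ + mU / 4) * |z| * height Γ x := by
  have hz1 : |z| ≤ 1 / 32 := hz.trans (by
    have : Real.exp (-(τ + 2)) ≤ 1 := Real.exp_le_one_iff.2 (by linarith)
    linarith)
  have hz2 := abs_le.1 hz1
  have hE : Real.exp (τ + 2) * |z| ≤ 1 / 32 := by
    have h1 := mul_le_mul_of_nonneg_left hz (Real.exp_pos (τ + 2)).le
    rwa [← mul_div_assoc, ← Real.exp_add, add_neg_cancel, Real.exp_zero] at h1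
  have hV := height_pos Γ x
  have hD := stepDistort_pos τ
  unfold avg
  rw [← integral_sub (integrable_comp_step hφ τ _) (integrable_comp_step hφ τ _)]
  refine abs_integral_sqMeas_le ?_
  rintro ⟨v, σ⟩ ⟨hv, hσ⟩
  simp only at hv hσ
  have hvz : |v * z| ≤ |z| := by
    rw [abs_mul, abs_of_nonneg hv.1]; nlinarith [hv.2, abs_nonneg z]
  have hvz' := abs_le.1 (hvz.trans hz1)
  set d := 1 + v * z with hd
  have hd0 : 1 / 2 ≤ d := by linarith
  have hdp : 0 < d := by linarith
  set η := Real.exp (τ + σ) * (v / d - v) with hη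
  set θ := 2 * Real.log d with hθ
  set ζ := Real.exp (-(τ + σ)) * (z / d) with hζ
  have e : umat z * step τ (v, σ) = step τ (v, σ) * lmat η * amat θ *
      umat ζ := by
    simp only [step, hζ]
    rw [mul_assoc (lmat v), ← lmat_mul_amat, ← mul_assoc (lmat v), ← lmat_add, ← mul_assoc,
      umat_mul_lmat _ _ hdp, mul_assoc _ (umat _), umat_mul_amat, mul_assoc _ (amat (τ + σ)) (amat θ),
      ← amat_add, add_comm (τ + σ) θ, amat_add θ (τ + σ)]
    rw [show v + (v / d - v) = v / d by ring]
    simp only [mul_assoc]; rfl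
  have hη1 : |η| ≤ 2 * Real.exp (τ + 2) * |z| := by
    have h3 : Real.exp (τ + σ) ≤ Real.exp (τ + 2) := Real.exp_le_exp.2 (by linarith [hσ.2])
    have h4 : |v / d - v| ≤ 2 * |z| := by
      have : v / d - v = -(v * (v * z)) / d := by rw [hd] at hdp ⊢; field_simp; ring
      rw [this, abs_div, abs_neg, abs_mul, abs_of_pos hdp, abs_of_nonneg hv.1,
        div_le_iff₀ hdp]
      nlinarith [hv.2, hv.1, abs_nonneg (v * z), abs_nonneg z]
    rw [hη, abs_mul, abs_of_pos (Real.exp_pos _)]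
    calc _ ≤ Real.exp (τ + 2) * (2 * |z|) := mul_le_mul h3 h4 (abs_nonneg _) (Real.exp_pos _).le
      _ = _ := by ring
  have hθ1 : |θ| ≤ 4 * |z| := by
    have h1 := Real.log_le_sub_one_of_pos hdp
    have h2 := Real.one_sub_inv_le_log_of_pos hdp
    have h3 : 1 - d⁻¹ ≥ -(2 * |v * z|) := by
      have : 1 - d⁻¹ = (v * z) / d := by rw [hd] at hdp ⊢; field_simp; ring
      rw [this, ge_iff_le, le_div_iff₀ hdp]
      nlinarith [neg_abs_le (v * z), abs_nonneg (v * z)]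
    have h4 := le_abs_self (v * z)
    rw [hθ, abs_le]
    constructor <;> linarith
  have hζ1 : |ζ| ≤ 2 * Real.exp (-τ) * |z| := by
    rw [hζ, abs_mul, abs_of_pos (Real.exp_pos _), abs_div, abs_of_pos hdp]
    have h3 : Real.exp (-(τ + σ)) ≤ Real.exp (-τ) := Real.exp_le_exp.2 (by linarith [hσ.1])
    have h4 : |z| / d ≤ 2 * |z| := by
      rw [div_le_iff₀ hdp]; nlinarith [abs_nonneg z]
    calc _ ≤ Real.exp (-τ) * (2 * |z|) := mul_le_mul h3 h4 (by positivity) (Real.exp_pos _).le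
      _ = _ := by ring
  have hexp := Real.exp_pos (-(τ + 2))
  have hx1 : rmul Γ (rmul Γ x (step τ (v, σ))) (lmat η) = rmul Γ x (lmat (v / d) * amat (τ + σ)) := by
    rw [← rmul_mul, step, mul_assoc, ← lmat_mul_amat, ← mul_assoc, ← lmat_add,
      show v + (v / d - v) = v / d by ring]
  have hx2 : rmul Γ (rmul Γ (rmul Γ x (step τ (v, σ))) (lmat η)) (amat θ) =
      rmul Γ x (lmat (v / d) * amat (τ + σ + θ)) := by
    rw [hx1, ← rmul_mul, mul_assoc, ← amat_add]
  have hvd : |v / d| ≤ 2 := by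
    rw [abs_div, abs_of_pos hdp, abs_of_nonneg hv.1, div_le_iff₀ hdp]; linarith [hv.2]
  have hθ2 := abs_le.1 (hθ1.trans (show 4 * |z| ≤ 1 / 8 by linarith))
  have b1 : height Γ (rmul Γ x (step τ (v, σ))) ≤ stepDistort τ * height Γ x :=
    height_lmat_mul_amat_le (by rw [abs_of_nonneg hv.1]; linarith [hv.2])
      (abs_le.2 ⟨by linarith [hσ.1], by linarith [hσ.2]⟩) x
  have b2 : height Γ (rmul Γ (rmul Γ x (step τ (v, σ))) (lmat η)) ≤ stepDistort τ * height Γ x := by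
    rw [hx1]
    exact height_lmat_mul_amat_le hvd (abs_le.2 ⟨by linarith [hσ.1], by linarith [hσ.2]⟩) x
  have b3 : height Γ (rmul Γ (rmul Γ (rmul Γ x (step τ (v, σ))) (lmat η)) (amat θ)) ≤
      stepDistort τ * height Γ x := by
    rw [hx2]
    exact height_lmat_mul_amat_le hvd (abs_le.2 ⟨by linarith [hσ.1], by linarith [hσ.2]⟩) x
  have hDV : 0 ≤ stepDistort τ * height Γ x := by positivity
  have c1 := (h.lmat (rmul Γ x (step τ (v, σ))) η (by linarith)).trans
    (mul_le_mul (mul_le_mul_of_nonneg_left hη1 hL) b1 (height_pos Γ _).le (by positivity))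
  have c2 := (h.amat (rmul Γ (rmul Γ x (step τ (v, σ))) (lmat η)) θ (by linarith)).trans
    (mul_le_mul (mul_le_mul_of_nonneg_left hθ1 hA) b2 (height_pos Γ _).le (by positivity))
  have hζ2 : 2 * Real.exp (-τ) * |z| ≤ |z| := by
    have h1 : 8 * Real.exp (-τ) ≤ 1 := by
      have h2 : 1 ≤ stepDistort τ :=
        (one_le_distort _).trans (distort_lmat_mul_amat_le (τ := τ) (v := 0) (t := 0) (by simp)
          (by rw [abs_zero]; linarith))
      rw [Real.exp_neg, ← div_eq_mul_inv, div_le_one (Real.exp_pos _)]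
      linarith
    nlinarith [abs_nonneg z]
  have c3 := (h.umat (rmul Γ (rmul Γ (rmul Γ x (step τ (v, σ))) (lmat η)) (amat θ)) ζ
    (by linarith)).trans
    (mul_le_mul (mul_le_mul_of_nonneg_left hζ1 hU) b3 (height_pos Γ _).le (by positivity))
  have c4 : mU * (2 * Real.exp (-τ) * |z|) * (stepDistort τ * height Γ x) ≤
      mU / 4 * |z| * height Γ x := by
    have h1 : Real.exp (-τ) * (8 * stepDistort τ) ≤ 1 := by
      have := mul_le_mul_of_nonneg_left hτ' (Real.exp_pos (-τ)).le
      rwa [← Real.exp_add, neg_add_cancel, Real.exp_zero] at this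
    have h2 : 0 ≤ mU * |z| * height Γ x := by positivity
    nlinarith [mul_le_mul_of_nonneg_left h1 h2]
  rw [← rmul_mul, e, rmul_mul, rmul_mul, rmul_mul]
  rw [abs_le] at c1 c2 c3 ⊢
  constructor <;> linarith

end Step

section Iterates

variable {Γ : Subgroup SL2}

theorem abs_mean_sub_mean_le {n : ℕ} (hn : 0 < n) {a b : ℕ → ℝ} {M : ℝ}
    (h : ∀ j, |a j - b j| ≤ M) :
    |(n : ℝ)⁻¹ * ∑ j ∈ Finset.range n, a j - (n : ℝ)⁻¹ * ∑ j ∈ Finset.range n, b j| ≤ M := by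
  rw [← mul_sub, ← Finset.sum_sub_distrib, abs_mul, abs_of_pos (by positivity),
    inv_mul_le_iff₀ (by positivity)]
  refine (Finset.abs_sum_le_sum_abs _ _).trans ((Finset.sum_le_sum fun j _ => h j).trans ?_)
  simp

theorem Reg.mono {τ k k' mL mL' mA mA' mU mU' : ℝ} {φ : XQuot Γ → ℝ} [DiscreteTopology Γ]
    (h : Reg τ k mL mA mU φ) (hk : k ≤ k') (hL : mL ≤ mL') (hA : mA ≤ mA') (hU : mU ≤ mU') :
    Reg τ k' mL' mA' mU' φ := by
  refine ⟨fun x y => (h.osc x y).trans ?_, fun x y hy => (h.lmat x y hy).trans ?_,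
    fun x y hy => (h.amat x y hy).trans ?_, fun x y hy => (h.umat x y hy).trans ?_⟩
  · have := height_pos Γ x
    have := height_pos Γ y
    gcongr
  all_goals
    have := height_pos Γ x
    gcongr

theorem Reg.mean {τ k mL mA mU : ℝ} {F : ℕ → XQuot Γ → ℝ} (h : ∀ j, Reg τ k mL mA mU (F j)) {n : ℕ}
    (hn : 0 < n) :
    Reg τ k mL mA mU fun x => (n : ℝ)⁻¹ * ∑ j ∈ Finset.range n, F j x :=
  ⟨fun x y => abs_mean_sub_mean_le hn fun j => (h j).osc x y,
    fun x y hy => abs_mean_sub_mean_le hn fun j => (h j).lmat x y hy,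
    fun x y hy => abs_mean_sub_mean_le hn fun j => (h j).amat x y hy,
    fun x y hy => abs_mean_sub_mean_le hn fun j => (h j).umat x y hy⟩

theorem Reg.div {τ k mL mA mU c : ℝ} {φ : XQuot Γ → ℝ} (hc : 0 < c)
    (h : Reg τ (c * k) (c * mL) (c * mA) (c * mU) φ) : Reg τ k mL mA mU fun x => φ x / c := by
  have key : ∀ {a b m : ℝ}, |a - b| ≤ c * m → |a / c - b / c| ≤ m := fun h => by
    rwa [← sub_div, abs_div, abs_of_pos hc, div_le_iff₀' hc]
  refine ⟨fun x y => key ?_, fun x y hy => key ?_, fun x y hy => key ?_, fun x y hy => key ?_⟩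
  · rw [← mul_assoc]; exact h.osc x y
  · rw [← mul_assoc, ← mul_assoc]; exact h.lmat x y hy
  · rw [← mul_assoc, ← mul_assoc]; exact h.amat x y hy
  · rw [← mul_assoc, ← mul_assoc]; exact h.umat x y hy

/-- The random walk with parameter `τ` contracts the height up to the additive constant `b`. -/
structure Drift (Γ : Subgroup SL2) (τ b : ℝ) : Prop where
  nonneg : 0 ≤ τ
  large : 8 * stepDistort τ ≤ Real.exp τ
  nonneg' : 0 ≤ b
  le : ∀ x, avg τ (height Γ) x ≤ 1 / 8 * height Γ x + b

theorem exists_drift (Γ : Subgroup SL2) [DiscreteTopology Γ] : ∃ τ b, Drift Γ τ b := by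
  have h : ∀ᶠ τ : ℝ in atTop, 8 * stepDistort τ ≤ Real.exp τ := by
    filter_upwards [eventually_ge_atTop 8] with τ hτ
    have h1 : (64 : ℝ) ≤ Real.exp 6 := by
      have := Real.exp_one_gt_d9
      have h2 : Real.exp 6 = Real.exp 1 ^ 6 := by rw [← Real.exp_nat_mul]; norm_num
      rw [h2]
      have : (2 : ℝ) ^ 6 ≤ Real.exp 1 ^ 6 := pow_le_pow_left₀ (by norm_num) (by linarith) 6
      linarith
    have h3 : stepDistort τ ≤ Real.exp (τ / 4 + 2) := by
      unfold stepDistort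
      calc (64 * Real.exp (τ + 2)) ^ (1 / 4 : ℝ) ≤ (Real.exp 6 * Real.exp (τ + 2)) ^ (1 / 4 : ℝ) :=
            Real.rpow_le_rpow (by positivity) (by gcongr) (by norm_num)
        _ = Real.exp (τ / 4 + 2) := by rw [← Real.exp_add, ← Real.exp_mul]; ring_nf
    have h4 : (8 : ℝ) ≤ Real.exp 3 := by
      have := Real.exp_one_gt_d9
      have h2 : Real.exp 3 = Real.exp 1 ^ 3 := by rw [← Real.exp_nat_mul]; norm_num
      rw [h2]
      have : (2 : ℝ) ^ 3 ≤ Real.exp 1 ^ 3 := pow_le_pow_left₀ (by norm_num) (by linarith) 3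
      linarith
    calc 8 * stepDistort τ ≤ Real.exp 3 * Real.exp (τ / 4 + 2) :=
          mul_le_mul h4 h3 (stepDistort_pos τ).le (Real.exp_pos _).le
      _ = Real.exp (3 + (τ / 4 + 2)) := (Real.exp_add _ _).symm
      _ ≤ Real.exp τ := Real.exp_le_exp.2 (by linarith)
  obtain ⟨τ, ⟨⟨b, hb, hd⟩, hl⟩, h0⟩ :=
    ((eventually_avg_height_le.and h).and (eventually_ge_atTop 0)).exists
  exact ⟨τ, b, h0, hl, hb, hd Γ⟩

variable {τ b : ℝ}

theorem avg_sub_const_le [DiscreteTopology Γ] (hD : Drift Γ τ b) {φ : XQuot Γ → ℝ}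
    (hφ : Continuous φ) {A B a : ℝ} (hA : 0 ≤ A) (h : ∀ z, |φ z - a| ≤ A * height Γ z + B)
    (x : XQuot Γ) : |avg τ φ x - a| ≤ A * (1 / 8 * height Γ x + b) + B := by
  have e : avg τ φ x - a = ∫ p, (φ (rmul Γ x (step τ p)) - a) ∂sqMeas := by
    rw [integral_sub (integrable_comp_step hφ τ x) (integrable_const a)]
    simp [avg]
  have hi := (integrable_height_step hD.nonneg x).const_mul A
  rw [e]
  refine (abs_integral_le_integral_abs).trans ?_
  calc _ ≤ ∫ p, (A * height Γ (rmul Γ x (step τ p)) + B) ∂sqMeas :=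
        integral_mono (((integrable_comp_step hφ τ x).sub (integrable_const a)).abs)
          (hi.add (integrable_const B)) fun p => h _
    _ = A * avg τ (height Γ) x + B := by
        rw [integral_add hi (integrable_const B), integral_const_mul]; simp [avg]
    _ ≤ _ := by
        have := mul_le_mul_of_nonneg_left (hD.le x) hA
        linarith

theorem avg_osc_le [DiscreteTopology Γ] (hD : Drift Γ τ b) {φ : XQuot Γ → ℝ}
    (hφ : Continuous φ) {A B : ℝ} (hA : 0 ≤ A)
    (h : ∀ x y, |φ x - φ y| ≤ A * (height Γ x + height Γ y) + B) (x y : XQuot Γ) :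
    |avg τ φ x - avg τ φ y| ≤ A * (1 / 8 * (height Γ x + height Γ y) + 2 * b) + B := by
  have h1 : ∀ z, |φ z - avg τ φ y| ≤ A * height Γ z + (A * (1 / 8 * height Γ y + b) + B) := by
    intro z
    have := avg_sub_const_le hD hφ (a := φ z) (B := A * height Γ z + B) hA
      (fun w => (h w z).trans (by linarith)) y
    rw [abs_sub_comm]; linarith
  linarith [avg_sub_const_le hD hφ hA h1 x]

/-- the Lipschitz constant along `lmat` of the invariant class -/
def cL (τ b : ℝ) : ℝ := 4 * (1 + 2 * b) * stepDistort τ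

/-- the Lipschitz constant along `amat` of the invariant class -/
def cA (τ b : ℝ) : ℝ := 2 * (2 * Real.exp (τ + 2) * cL τ b + 2 * (1 + 2 * b)) * stepDistort τ

/-- the Lipschitz constant along `umat` of the invariant class -/
def cU (τ b : ℝ) : ℝ := 4 * (2 * Real.exp (τ + 2) * cL τ b + 4 * cA τ b) * stepDistort τ

theorem cL_nonneg (hb : 0 ≤ b) : 0 ≤ cL τ b := by
  have := stepDistort_pos τ; unfold cL; positivity

theorem cA_nonneg (hb : 0 ≤ b) : 0 ≤ cA τ b := by
  have := stepDistort_pos τ; have := cL_nonneg (τ := τ) hb; unfold cA; positivity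

theorem cU_nonneg (hb : 0 ≤ b) : 0 ≤ cU τ b := by
  have := stepDistort_pos τ; have := cL_nonneg (τ := τ) hb; have := cA_nonneg (τ := τ) hb
  unfold cU; positivity

/-- the classes of functions contracted by the averages of the random walk -/
def Cls (τ b k c : ℝ) (φ : XQuot Γ → ℝ) : Prop :=
  Reg τ (c * k) (c * cL τ b) (c * cA τ b) (c * cU τ b) φ

variable [DiscreteTopology Γ] {φ : XQuot Γ → ℝ} {c : ℝ}

theorem Cls.continuous (hD : Drift Γ τ b) {k : ℝ} (hc : 0 ≤ c) (h : Cls τ b k c φ) : Continuous φ :=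
  Reg.continuous (mul_nonneg hc (cA_nonneg hD.nonneg')) (mul_nonneg hc (cU_nonneg hD.nonneg')) h

theorem Cls.avg (hD : Drift Γ τ b) (hc : 0 ≤ c) (h : Cls τ b (1 + 2 * b) c φ) {k : ℝ}
    (hosc : ∀ x y, |avg τ φ x - avg τ φ y| ≤ c / 2 * k * (height Γ x + height Γ y)) :
    Cls τ b k (c / 2) (avg τ φ) := by
  have hb := hD.nonneg'
  have h1 := mul_nonneg hc (cL_nonneg (τ := τ) hb)
  have h2 := mul_nonneg hc (cA_nonneg (τ := τ) hb)
  have h3 := mul_nonneg hc (cU_nonneg (τ := τ) hb)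
  have hk : 0 ≤ c * (1 + 2 * b) := by positivity
  have hcont := h.continuous hD hc
  refine ⟨hosc, fun x y hy => ?_, fun x s hs => ?_, fun x z hz => ?_⟩
  · refine (avg_lmat_le hD.nonneg hk hcont h.osc x hy).trans (le_of_eq ?_)
    unfold cL; ring
  · refine (avg_amat_le hD.nonneg hk h1 hcont h x hs).trans (le_of_eq ?_)
    rw [show cA τ b = 2 * (2 * Real.exp (τ + 2) * cL τ b + 2 * (1 + 2 * b)) * stepDistort τ from rfl]
    ring
  · refine (avg_umat_le hD.nonneg hD.large h1 h2 h3 hcont h x hz).trans (le_of_eq ?_)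
    have e : (2 * Real.exp (τ + 2) * cL τ b + 4 * cA τ b) * stepDistort τ = cU τ b / 4 := by
      unfold cU; ring
    rw [show 2 * Real.exp (τ + 2) * (c * cL τ b) + 4 * (c * cA τ b) =
      c * (2 * Real.exp (τ + 2) * cL τ b + 4 * cA τ b) by ring, mul_assoc c, e]
    ring

theorem Cls.iterate (hD : Drift Γ τ b) (hc : 0 ≤ c) (h : Cls τ b 1 c φ) (j : ℕ) :
    (∀ x y, |(_root_.avg τ)^[j] φ x - (_root_.avg τ)^[j] φ y| ≤
      c * ((1 / 8) ^ j * (height Γ x + height Γ y) + 4 * b * (1 - (1 / 8) ^ j))) ∧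
    Cls τ b (1 + 2 * b) c ((_root_.avg τ)^[j] φ) := by
  have hb := hD.nonneg'
  have hosc : ∀ (j : ℕ) (x y : XQuot Γ), c * ((1 / 8) ^ j * (height Γ x + height Γ y) +
      4 * b * (1 - (1 / 8) ^ j)) ≤ c * (1 + 2 * b) * (height Γ x + height Γ y) := by
    intro j x y
    have h1 := one_le_height Γ x
    have h2 := one_le_height Γ y
    have h3 : (1 / 8 : ℝ) ^ j ≤ 1 := pow_le_one₀ (by norm_num) (by norm_num)
    have h4 : 0 ≤ (1 / 8 : ℝ) ^ j := by positivity
    have h6 : (1 / 8 : ℝ) ^ j * (height Γ x + height Γ y) + 4 * b * (1 - (1 / 8) ^ j) ≤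
        (1 + 2 * b) * (height Γ x + height Γ y) := by
      have a1 : (1 / 8 : ℝ) ^ j * (height Γ x + height Γ y) ≤ 1 * (height Γ x + height Γ y) :=
        mul_le_mul_of_nonneg_right h3 (by linarith)
      have a2 : b * (1 - (1 / 8) ^ j) ≤ b * 1 := mul_le_mul_of_nonneg_left (by linarith) hb
      have a3 : b * 2 ≤ b * (height Γ x + height Γ y) := mul_le_mul_of_nonneg_left (by linarith) hb
      linarith
    rw [mul_assoc c]
    exact mul_le_mul_of_nonneg_left h6 hc
  induction j with
  | zero =>
    refine ⟨fun x y => ?_, ?_⟩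
    · simpa using h.osc x y
    · exact h.mono (mul_le_mul_of_nonneg_left (by linarith) hc) le_rfl le_rfl le_rfl
  | succ j ih =>
    obtain ⟨ih1, ih2⟩ := ih
    have hcont := ih2.continuous hD hc
    have hosc' : ∀ x y, |(_root_.avg τ)^[j + 1] φ x - (_root_.avg τ)^[j + 1] φ y| ≤
      c * ((1 / 8) ^ (j + 1) * (height Γ x + height Γ y) + 4 * b * (1 - (1 / 8) ^ (j + 1))) := by
      intro x y
      rw [Function.iterate_succ_apply']
      have := avg_osc_le hD hcont (A := c * (1 / 8) ^ j) (B := c * (4 * b * (1 - (1 / 8) ^ j)))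
        (by positivity) (fun x y => (ih1 x y).trans (by linarith)) x y
      refine this.trans ?_
      have h4 : 0 ≤ c * ((1 / 8 : ℝ) ^ j * b) := by positivity
      rw [pow_succ]
      linarith
    refine ⟨hosc', ?_⟩
    have := ih2.avg hD hc (k := 2 * (1 + 2 * b)) fun x y => by
      have := (hosc' x y).trans (hosc (j + 1) x y)
      rw [Function.iterate_succ_apply'] at this
      linarith
    rw [Function.iterate_succ_apply']
    have h1 := mul_nonneg hc (cL_nonneg (τ := τ) hb)
    have h2 := mul_nonneg hc (cA_nonneg (τ := τ) hb)
    have h3 := mul_nonneg hc (cU_nonneg (τ := τ) hb)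
    exact this.mono (by linarith) (by linarith) (by linarith) (by linarith)

/-- averages of the iterates of the random walk -/
def cesaro (τ : ℝ) (n : ℕ) (φ : XQuot Γ → ℝ) (x : XQuot Γ) : ℝ :=
  (n : ℝ)⁻¹ * ∑ j ∈ Finset.range n, (_root_.avg τ)^[j + 1] φ x

theorem Cls.cesaro_of_osc (hD : Drift Γ τ b) (hc : 0 ≤ c) (h : Cls τ b 1 c φ) {n : ℕ} (hn : 0 < n)
    {k : ℝ} (hk : ∀ x y, |cesaro τ n φ x - cesaro τ n φ y| ≤ c / 2 * k * (height Γ x + height Γ y)) :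
    Cls τ b k (c / 2) (cesaro τ n φ) := by
  have : Cls τ b (2 * (1 + 2 * b)) (c / 2) (cesaro τ n φ) := by
    refine Reg.mean (fun j => ?_) hn
    rw [Function.iterate_succ_apply']
    refine (h.iterate hD hc j).2.avg hD hc fun x y => ?_
    have := (h.iterate hD hc (j + 1)).2.osc x y
    rw [Function.iterate_succ_apply'] at this
    linarith
  exact ⟨hk, this.lmat, this.amat, this.umat⟩

theorem Cls.cesaro_osc (hD : Drift Γ τ b) (hc : 0 ≤ c) (h : Cls τ b 1 c φ) {n : ℕ} (hn : 0 < n)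
    (x y : XQuot Γ) :
    |cesaro τ n φ x - cesaro τ n φ y| ≤ c * (1 / 8 * (height Γ x + height Γ y) + 4 * b) := by
  refine abs_mean_sub_mean_le hn fun j => ((h.iterate hD hc (j + 1)).1 x y).trans ?_
  have hb := hD.nonneg'
  have h3 : (1 / 8 : ℝ) ^ (j + 1) ≤ 1 / 8 := by
    rw [pow_succ]
    have : (1 / 8 : ℝ) ^ j ≤ 1 := pow_le_one₀ (by norm_num) (by norm_num)
    linarith
  have h4 : 0 ≤ (1 / 8 : ℝ) ^ (j + 1) := by positivity
  have h5 := height_pos Γ x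
  have h6 := height_pos Γ y
  refine mul_le_mul_of_nonneg_left ?_ hc
  have h7 := mul_le_mul_of_nonneg_right h3 (show 0 ≤ height Γ x + height Γ y by linarith)
  have h8 := mul_nonneg hb h4
  linarith

end Iterates

section Liouville

variable {Γ : Subgroup SL2}

theorem forall_of_Icc {P : ℝ → Prop} (hadd : ∀ s t, P s → P t → P (s + t)) (hneg : ∀ s, P s → P (-s))
    (h : ∀ s ∈ Set.Icc (0 : ℝ) 1, P s) (s : ℝ) : P s := by
  set S : AddSubgroup ℝ :=
    { carrier := {s | P s}
      add_mem' := fun {a b} ha hb => hadd a b ha hb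
      zero_mem' := h 0 (by simp)
      neg_mem' := fun {a} ha => hneg a ha }
  have h1 : (1 : ℝ) ∈ S := h 1 (by simp)
  have h2 : ⌊s⌋ • (1 : ℝ) ∈ S := S.zsmul_mem h1 _
  have h3 : Int.fract s ∈ S := h _ ⟨Int.fract_nonneg s, (Int.fract_lt_one s).le⟩
  have := S.add_mem h2 h3
  rwa [zsmul_one, Int.floor_add_fract] at this

theorem one_add_mul_le_sqrt_mul_sqrt (a b : ℝ) :
    1 + a * b ≤ Real.sqrt (1 + a ^ 2) * Real.sqrt (1 + b ^ 2) := by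
  rw [← Real.sqrt_mul (by positivity)]
  exact Real.le_sqrt_of_sq_le (by nlinarith [sq_nonneg (a - b)])

theorem eq_of_sqrt_mul_sqrt_eq {a b : ℝ}
    (h : Real.sqrt (1 + a ^ 2) * Real.sqrt (1 + b ^ 2) = 1 + a * b) : a = b := by
  rw [← Real.sqrt_mul (by positivity)] at h
  have h1 := Real.sq_sqrt (show 0 ≤ (1 + a ^ 2) * (1 + b ^ 2) by positivity)
  rw [h] at h1
  have : (a - b) ^ 2 = 0 := by linarith
  exact sub_eq_zero.1 (pow_eq_zero_iff (two_ne_zero)|>.1 this)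

theorem comp_step_eq_of_avg_eq {μ : Measure (XQuot Γ)} [IsProbabilityMeasure μ]
    (hinv : ∀ g : SL2, Measure.map (fun x => rmul Γ x g) μ = μ) {τ : ℝ} {f : XQuot Γ → ℝ}
    (hf : Continuous f) (hi : Integrable f μ) (havg : ∀ x, avg τ f x = f x) {p : ℝ × ℝ}
    (hp : p ∈ unitSq) (x : XQuot Γ) : f (rmul Γ x (step τ p)) = f x := by
  have := isOpenPosMeasure_of_invariant hinv
  set F : XQuot Γ → ℝ := fun x => Real.sqrt (1 + f x ^ 2) with hF
  have hFc : Continuous F := by fun_prop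
  have hFpos : ∀ x, 0 < F x := fun x => Real.sqrt_pos.2 (by positivity)
  have hFsq : ∀ x, F x * F x = 1 + f x ^ 2 := fun x => Real.mul_self_sqrt (by positivity)
  have hFi : Integrable F μ := by
    refine ((integrable_const (1 : ℝ)).add hi.abs).mono' hFc.aestronglyMeasurable
      (ae_of_all _ fun x => ?_)
    rw [Real.norm_of_nonneg (hFpos x).le]
    simp only [Pi.add_apply]
    refine Real.sqrt_le_iff.2 ⟨by positivity, ?_⟩
    nlinarith [abs_nonneg (f x), sq_abs (f x)]
  have hc : ∀ {φ : XQuot Γ → ℝ}, Continuous φ → ∀ x, Integrable (fun p => φ (rmul Γ x (step τ p))) sqMeas :=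
    fun hφ x => integrable_comp_step hφ τ x
  have hh (x : XQuot Γ) : ∫ p, (F x * F (rmul Γ x (step τ p)) - (1 + f x * f (rmul Γ x (step τ p))))
      ∂sqMeas = F x * (avg τ F x - F x) := by
    have i1 : Integrable (fun p => F x * F (rmul Γ x (step τ p))) sqMeas := (hc hFc x).const_mul _
    have i2 : Integrable (fun p => f x * f (rmul Γ x (step τ p))) sqMeas := (hc hf x).const_mul _
    have i3 : Integrable (fun p => 1 + f x * f (rmul Γ x (step τ p))) sqMeas :=
      (integrable_const 1).add i2
    rw [integral_sub i1 i3, integral_add (integrable_const 1) i2,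
      integral_const_mul, integral_const_mul, mul_sub, hFsq]
    change F x * avg τ F x - (_ + f x * avg τ f x) = _
    rw [havg]
    simp; ring
  have hnn : ∀ x p, 0 ≤ F x * F (rmul Γ x (step τ p)) - (1 + f x * f (rmul Γ x (step τ p))) :=
    fun x p => sub_nonneg.2 (one_add_mul_le_sqrt_mul_sqrt _ _)
  have hg0 : ∀ x, 0 ≤ avg τ F x - F x := fun x => by
    have := integral_nonneg (μ := sqMeas) (f := fun p => F x * F (rmul Γ x (step τ p)) -
      (1 + f x * f (rmul Γ x (step τ p)))) fun p => hnn x p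
    rw [hh] at this
    exact nonneg_of_mul_nonneg_right this (hFpos x)
  have hgi := (integrable_avg hinv τ hFc.measurable hFi).sub hFi
  have hg1 : ∫ x, (avg τ F x - F x) ∂μ = 0 := by
    rw [integral_sub (integrable_avg hinv τ hFc.measurable hFi) hFi,
      integral_avg hinv τ hFc.measurable hFi, sub_self]
  have hg2 := (integral_eq_zero_iff_of_nonneg hg0 hgi).1 hg1
  have hae : (fun x => f (rmul Γ x (step τ p))) =ᵐ[μ] f := by
    filter_upwards [hg2] with x hx
    have h1 := hh x
    rw [show avg τ F x - F x = 0 from hx, mul_zero] at h1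
    have hcont : Continuous fun p =>
        F x * F (rmul Γ x (step τ p)) - (1 + f x * f (rmul Γ x (step τ p))) :=
      (continuous_const.mul (continuous_comp_step hFc τ x)).sub
        (continuous_const.add (continuous_const.mul (continuous_comp_step hf τ x)))
    have h2 := (integral_eq_zero_iff_of_nonneg (hnn x) (integrable_sqMeas hcont)).1 h1
    have h3 : Set.EqOn (fun p => F x * F (rmul Γ x (step τ p)) - (1 + f x * f (rmul Γ x (step τ p))))
        (fun _ => (0 : ℝ)) unitSq := by
      refine Measure.eqOn_of_ae_eq (μ := volume) h2 hcont.continuousOn continuousOn_const ?_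
      rw [unitSq, interior_prod_eq, closure_prod_eq, interior_Icc, closure_Ioo zero_ne_one]
    have h4 := sub_eq_zero.1 (h3 hp)
    exact (eq_of_sqrt_mul_sqrt_eq h4).symm
  exact congrFun ((Continuous.ae_eq_iff_eq μ (hf.comp (continuous_rmul_left _)) hf).1 hae) x

/-- A function of controlled regularity which is harmonic for the random walk is constant. -/
theorem eq_of_avg_eq [DiscreteTopology Γ] {μ : Measure (XQuot Γ)} [IsProbabilityMeasure μ]
    (hinv : ∀ g : SL2, Measure.map (fun x => rmul Γ x g) μ = μ) {τ k mL mA mU : ℝ}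
    (hA : 0 ≤ mA) (hU : 0 ≤ mU) {f : XQuot Γ → ℝ} (h : Reg τ k mL mA mU f)
    (havg : ∀ x, avg τ f x = f x) (x y : XQuot Γ) : f x = f y := by
  have hf := h.continuous hA hU
  have hi : Integrable f μ := by
    refine (((integrable_height hinv).add (integrable_const (height Γ x))).const_mul k |>.add
      (integrable_const |f x|)).mono' hf.aestronglyMeasurable (ae_of_all _ fun z => ?_)
    have := h.osc z x
    have h2 := abs_sub_abs_le_abs_sub (f z) (f x)
    simp only [Pi.add_apply, Real.norm_eq_abs]
    linarith
  have key : ∀ x v σ, v ∈ Set.Icc (0 : ℝ) 1 → σ ∈ Set.Icc (0 : ℝ) 1 →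
      f (rmul Γ x (lmat v * amat (τ + σ))) = f x := fun x v σ hv hσ =>
    comp_step_eq_of_avg_eq hinv hf hi havg (p := (v, σ)) ⟨hv, hσ⟩ x
  have h0 : (0 : ℝ) ∈ Set.Icc (0 : ℝ) 1 := by simp
  have k1 : ∀ x, f (rmul Γ x (amat τ)) = f x := fun x => by
    simpa [lmat_zero] using key x 0 0 h0 h0
  have hLi : ∀ v x, f (rmul Γ x (lmat v)) = f x := by
    refine forall_of_Icc (fun s t hs ht x => ?_) (fun s hs x => ?_) fun v hv x => ?_
    · rw [lmat_add, rmul_mul, ht, hs]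
    · rw [← hs (rmul Γ x (lmat (-s))), ← rmul_mul, ← lmat_add]; simp [lmat_zero, rmul_one]
    · have := key x v 0 hv h0
      rw [rmul_mul, add_zero, k1] at this
      exact this
  have hAi : ∀ s x, f (rmul Γ x (amat s)) = f x := by
    refine forall_of_Icc (fun s t hs ht x => ?_) (fun s hs x => ?_) fun v hv x => ?_
    · rw [amat_add, rmul_mul, ht, hs]
    · rw [← hs (rmul Γ x (amat (-s))), ← rmul_mul, ← amat_add]; simp [amat_zero, rmul_one]
    · have h1 := key (rmul Γ x (amat (-τ))) 0 v h0 hv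
      have h2 := k1 (rmul Γ x (amat (-τ)))
      rw [lmat_zero, one_mul, ← rmul_mul, ← amat_add, neg_add_cancel_left] at h1
      rw [← rmul_mul, ← amat_add, neg_add_cancel, amat_zero, rmul_one] at h2
      rw [h1, h2]
  refine eq_of_rmul_invariant (fun x s => hLi s x) (fun x s => hAi s x) (fun x z => ?_) x y
  have hb : ∀ᶠ t : ℝ in atTop, |f (rmul Γ x (umat z)) - f x| ≤
      mU * |z| * (4 ^ (1 / 4 : ℝ) * height Γ x) * Real.exp (-(3 / 4 * t)) := by
    have hlim : Tendsto (fun t : ℝ => Real.exp (-t) * |z|) atTop (𝓝 (0 * |z|)) :=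
      (Real.tendsto_exp_neg_atTop_nhds_zero).mul_const _
    rw [zero_mul] at hlim
    filter_upwards [hlim.eventually_lt_const (show (0 : ℝ) < Real.exp (-(τ + 2)) / 32 by positivity),
      eventually_ge_atTop 0] with t ht ht0
    have h1 : |Real.exp (-t) * z| = Real.exp (-t) * |z| := by
      rw [abs_mul, abs_of_pos (Real.exp_pos _)]
    have h2 := h.umat (rmul Γ x (amat t)) (Real.exp (-t) * z) (by rw [h1]; exact ht.le)
    rw [← rmul_mul, ← umat_mul_amat, rmul_mul, hAi, hAi, h1] at h2
    have h3 : height Γ (rmul Γ x (amat t)) ≤ 4 ^ (1 / 4 : ℝ) * Real.exp (t / 4) * height Γ x := by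
      refine (height_rmul_le Γ x _).trans (mul_le_mul_of_nonneg_right ?_ (height_pos Γ x).le)
      have h5 := nrm_amat_le (t := t) (T := t) (abs_of_nonneg ht0).le
      unfold distort
      rw [nrm_inv]
      calc _ ≤ ((2 * Real.exp (t / 2)) * (2 * Real.exp (t / 2))) ^ (1 / 4 : ℝ) :=
            Real.rpow_le_rpow (mul_nonneg (nrm_nonneg _) (nrm_nonneg _))
              (mul_le_mul h5 h5 (nrm_nonneg _) (by positivity)) (by norm_num)
        _ = (4 * Real.exp t) ^ (1 / 4 : ℝ) := by
            congr 1
            rw [show 2 * Real.exp (t / 2) * (2 * Real.exp (t / 2)) =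
              4 * (Real.exp (t / 2) * Real.exp (t / 2)) by ring, ← Real.exp_add, add_halves]
        _ = _ := by
            rw [Real.mul_rpow (by norm_num) (Real.exp_pos _).le, ← Real.exp_mul]; ring_nf
    refine (h2.trans (mul_le_mul_of_nonneg_left h3 (by positivity))).trans (le_of_eq ?_)
    rw [show -(3 / 4 * t) = -t + t / 4 by ring, Real.exp_add]
    ring
  have hlim : Tendsto (fun t : ℝ => mU * |z| * (4 ^ (1 / 4 : ℝ) * height Γ x) *
      Real.exp (-(3 / 4 * t))) atTop (𝓝 (mU * |z| * (4 ^ (1 / 4 : ℝ) * height Γ x) * 0)) :=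
    Tendsto.const_mul _ (Real.tendsto_exp_neg_atTop_nhds_zero.comp
      (tendsto_id.const_mul_atTop (by norm_num)))
  rw [mul_zero] at hlim
  have := ge_of_tendsto hlim hb
  exact sub_eq_zero.1 (abs_nonpos_iff.1 this)

end Liouville

section Contraction

variable {Γ : Subgroup SL2} {τ b : ℝ}

theorem tendsto_avg_of_tendstoUniformlyOn {ι : Type*} {l : Filter ι} {f : ι → XQuot Γ → ℝ}
    {F : XQuot Γ → ℝ} (hf : ∀ n, Continuous (f n)) (hF : Continuous F)
    (h : ∀ C : Set (XQuot Γ), IsCompact C → TendstoUniformlyOn f F l C) (x : XQuot Γ) :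
    Tendsto (fun n => avg τ (f n) x) l (𝓝 (avg τ F x)) := by
  have hC : IsCompact ((fun p => rmul Γ x (step τ p)) '' unitSq) :=
    isCompact_unitSq.image ((continuous_rmul_right x).comp (continuous_step τ))
  refine Metric.tendsto_nhds.2 fun ε hε => ?_
  filter_upwards [Metric.tendstoUniformlyOn_iff.1 (h _ hC) (ε / 2) (half_pos hε)] with n hn
  have : |avg τ (f n) x - avg τ F x| ≤ ε / 2 := by
    unfold avg
    rw [← integral_sub (integrable_comp_step (hf n) τ x) (integrable_comp_step hF τ x)]
    refine abs_integral_sqMeas_le fun p hp => ?_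
    have := hn _ ⟨p, hp, rfl⟩
    rw [dist_comm, Real.dist_eq] at this
    exact this.le
  rw [Real.dist_eq]
  linarith

variable [DiscreteTopology Γ]

theorem Reg.eventually_nhds {k mL mA mU : ℝ} (hA : 0 ≤ mA) (hU : 0 ≤ mU) (x : XQuot Γ) {ε : ℝ}
    (hε : 0 < ε) : ∀ᶠ y in 𝓝 x, ∀ φ : XQuot Γ → ℝ, Reg τ k mL mA mU φ → |φ y - φ x| ≤ ε := by
  have hV := height_pos Γ x
  rw [← map_rmul_nhds_one, eventually_map]
  filter_upwards [eventually_abs_sub_le (Γ := Γ) τ k (mL := mL) hA hU (div_pos hε hV)] with g hg φ hφ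
  have := hg φ hφ x
  rwa [div_mul_cancel₀ _ hV.ne'] at this

/-- Arzelà–Ascoli along an ultrafilter. -/
theorem exists_ultralimit {ι : Type*} (𝒰 : Ultrafilter ι) {k mL mA mU : ℝ} (hA : 0 ≤ mA) (hU : 0 ≤ mU)
    {f : ι → XQuot Γ → ℝ} (h : ∀ n, Reg τ k mL mA mU (f n)) {x₁ : XQuot Γ} (h0 : ∀ n, f n x₁ = 0) :
    ∃ F : XQuot Γ → ℝ, Reg τ k mL mA mU F ∧ (∀ x, Tendsto (fun n => f n x) 𝒰 (𝓝 (F x))) ∧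
      ∀ C : Set (XQuot Γ), IsCompact C → TendstoUniformlyOn f F 𝒰 C := by
  have hex (x : XQuot Γ) : ∃ a, Tendsto (fun n => f n x) 𝒰 (𝓝 a) := by
    have hb : ∀ n, f n x ∈ Set.Icc (-(k * (height Γ x + height Γ x₁))) (k * (height Γ x + height Γ x₁)) := by
      intro n
      have := (h n).osc x x₁
      rw [h0, sub_zero] at this
      exact abs_le.1 this
    obtain ⟨a, -, ha⟩ := isCompact_Icc.ultrafilter_le_nhds (𝒰.map fun n => f n x)
      (le_principal_iff.2 (Eventually.of_forall hb : ∀ᶠ n in (𝒰 : Filter ι), _))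
    exact ⟨a, ha⟩
  choose F hF using hex
  have hsub : ∀ x y, Tendsto (fun n => |f n x - f n y|) 𝒰 (𝓝 |F x - F y|) := fun x y =>
    ((hF x).sub (hF y)).abs
  have hR : Reg τ k mL mA mU F :=
    ⟨fun x y => le_of_tendsto (hsub _ _) (Eventually.of_forall fun n => (h n).osc x y),
      fun x y hy => le_of_tendsto (hsub _ _) (Eventually.of_forall fun n => (h n).lmat x y hy),
      fun x y hy => le_of_tendsto (hsub _ _) (Eventually.of_forall fun n => (h n).amat x y hy),
      fun x y hy => le_of_tendsto (hsub _ _) (Eventually.of_forall fun n => (h n).umat x y hy)⟩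
  refine ⟨F, hR, hF, fun C hC => ?_⟩
  refine (tendstoLocallyUniformlyOn_iff_tendstoUniformlyOn_of_compact hC).1 ?_
  refine Metric.tendstoLocallyUniformlyOn_iff.2 fun ε hε x _ => ?_
  refine ⟨_, mem_nhdsWithin_of_mem_nhds (Reg.eventually_nhds (τ := τ) (k := k) (mL := mL) hA hU x
    (show 0 < ε / 4 by positivity)), ?_⟩
  filter_upwards [(hF x).eventually (Metric.ball_mem_nhds _ (show 0 < ε / 4 by positivity))] with n hn y hy
  have h1 := hy _ hR
  have h2 := hy _ (h n)
  rw [Real.dist_eq] at hn ⊢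
  rw [abs_le] at h1 h2
  rw [abs_lt] at hn ⊢
  constructor <;> linarith

theorem Cls.abs_iterate_sub_le (hD : Drift Γ τ b) {φ : XQuot Γ → ℝ} (h : Cls τ b 1 1 φ) (j : ℕ)
    (x z : XQuot Γ) :
    |(_root_.avg τ)^[j] φ z - φ x| ≤
      (1 / 8) ^ j * height Γ z + (height Γ x + 2 * b * (1 - (1 / 8) ^ j)) := by
  have hb := hD.nonneg'
  induction j generalizing z with
  | zero => simpa using h.osc z x
  | succ j ih =>
    rw [Function.iterate_succ_apply']
    refine (avg_sub_const_le hD ((h.iterate hD zero_le_one j).2.continuous hD zero_le_one)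
      (by positivity) (fun z => ih z) z).trans ?_
    have : 0 ≤ (1 / 8 : ℝ) ^ j * b := by positivity
    rw [pow_succ]
    linarith

theorem avg_cesaro (hD : Drift Γ τ b) {φ : XQuot Γ → ℝ} (h : Cls τ b 1 1 φ) (n : ℕ) (x : XQuot Γ) :
    avg τ (cesaro τ n φ) x - cesaro τ n φ x =
      (n : ℝ)⁻¹ * ((avg τ)^[n + 1] φ x - (avg τ)^[1] φ x) := by
  have hc : ∀ j, Continuous ((avg τ)^[j] φ) := fun j =>
    (h.iterate hD zero_le_one j).2.continuous hD zero_le_one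
  have e : avg τ (cesaro τ n φ) x = (n : ℝ)⁻¹ * ∑ j ∈ Finset.range n, (avg τ)^[j + 1 + 1] φ x := by
    change ∫ p, (n : ℝ)⁻¹ * ∑ j ∈ Finset.range n, (avg τ)^[j + 1] φ (rmul Γ x (step τ p)) ∂sqMeas = _
    rw [integral_const_mul, integral_finsetSum _ fun j _ => integrable_comp_step (hc _) τ x]
    congr 1
    refine Finset.sum_congr rfl fun j _ => ?_
    rw [Function.iterate_succ_apply' _ (j + 1)]
    rfl
  rw [e, cesaro, ← mul_sub, ← Finset.sum_sub_distrib]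
  congr 1
  exact Finset.sum_range_sub (fun j => (avg τ)^[j + 1] φ x) n

theorem exists_cesaro_near {μ : Measure (XQuot Γ)} [IsProbabilityMeasure μ]
    (hlat : IsLatticeSL2 Γ)
    (hinv : ∀ g : SL2, Measure.map (fun x => rmul Γ x g) μ = μ) (hD : Drift Γ τ b) (R : ℝ) :
    ∃ n, 0 < n ∧ ∀ φ : XQuot Γ → ℝ, Cls τ b 1 1 φ → ∀ x y, height Γ x + height Γ y ≤ R →
      |cesaro τ n φ x - cesaro τ n φ y| ≤ 1 := by
  by_contra hcon
  push Not at hcon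
  choose φ hφ x y hxy hgt using fun n : ℕ => hcon (n + 1) n.succ_pos
  obtain ⟨C, hC, hmem⟩ := exists_isCompact_of_height_le hlat R
  have hb := hD.nonneg'
  set x₁ : XQuot Γ := qmk Γ 1
  set f : ℕ → XQuot Γ → ℝ := fun n z => cesaro τ (n + 1) (φ n) z - cesaro τ (n + 1) (φ n) x₁ with hf
  have hcl : ∀ n, Cls τ b (1 + 4 * b) 1 (cesaro τ (n + 1) (φ n)) := fun n => by
    have := (hφ n).cesaro_of_osc hD zero_le_one n.succ_pos (k := 2 * (1 + 4 * b)) fun x y => by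
      refine ((hφ n).cesaro_osc hD zero_le_one n.succ_pos x y).trans ?_
      have h1 := one_le_height Γ x
      have h2 := one_le_height Γ y
      have := mul_le_mul_of_nonneg_left (show 1 ≤ height Γ x + height Γ y by linarith) hb
      linarith
    have h1 := cL_nonneg (τ := τ) hb
    have h2 := cA_nonneg (τ := τ) hb
    have h3 := cU_nonneg (τ := τ) hb
    exact Reg.mono this (by linarith) (by linarith) (by linarith) (by linarith)
  have hreg : ∀ n, Reg τ (1 * (1 + 4 * b)) (1 * cL τ b) (1 * cA τ b) (1 * cU τ b) (f n) := fun n => by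
    have hs : ∀ u v, f n u - f n v = cesaro τ (n + 1) (φ n) u - cesaro τ (n + 1) (φ n) v := fun u v => by
      simp only [hf]; ring
    refine ⟨fun u v => ?_, fun u v hv => ?_, fun u v hv => ?_, fun u v hv => ?_⟩
    · rw [hs]; exact (hcl n).osc u v
    · rw [hs]; exact (hcl n).lmat u v hv
    · rw [hs]; exact (hcl n).amat u v hv
    · rw [hs]; exact (hcl n).umat u v hv
  have nA : 0 ≤ 1 * cA τ b := by rw [one_mul]; exact cA_nonneg hb
  have nU : 0 ≤ 1 * cU τ b := by rw [one_mul]; exact cU_nonneg hb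
  obtain ⟨F, hFreg, hFlim, hFunif⟩ := exists_ultralimit (hyperfilter ℕ) nA nU hreg (x₁ := x₁)
    fun n => sub_self _
  have hfc : ∀ n, Continuous (f n) := fun n => (hreg n).continuous nA nU
  have hlim := fun z => tendsto_avg_of_tendstoUniformlyOn (τ := τ) hfc (hFreg.continuous nA nU) hFunif z
  have hle : (hyperfilter ℕ : Filter ℕ) ≤ atTop := Nat.hyperfilter_le_atTop
  have hharm : ∀ z, avg τ F z = F z := fun z => by
    have hz : Tendsto (fun n => avg τ (f n) z - f n z) (hyperfilter ℕ) (𝓝 0) := by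
      have h1 : ∀ n, avg τ (f n) z - f n z =
          (((n + 1 : ℕ) : ℝ))⁻¹ * ((avg τ)^[n + 1 + 1] (φ n) z - (avg τ)^[1] (φ n) z) := fun n => by
        rw [← avg_cesaro hD (hφ n)]
        have : avg τ (f n) z = avg τ (cesaro τ (n + 1) (φ n)) z - cesaro τ (n + 1) (φ n) x₁ := by
          simp only [hf]
          conv_lhs => unfold avg
          rw [integral_sub (integrable_comp_step ((hcl n).continuous hD zero_le_one) τ z)
            (integrable_const _)]
          simp [avg]
        rw [this]
        simp only [hf]
        ring
      have h2 : ∀ n, |avg τ (f n) z - f n z| ≤ 4 * (height Γ z + b) * (1 / ((n : ℝ) + 1)) := fun n => by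
        rw [h1, abs_mul, abs_of_nonneg (by positivity), Nat.cast_succ, inv_eq_one_div, mul_comm]
        refine mul_le_mul_of_nonneg_right ?_ (by positivity)
        have key : ∀ j, |(avg τ)^[j] (φ n) z - φ n z| ≤ 2 * (height Γ z + b) := fun j => by
          refine ((hφ n).abs_iterate_sub_le hD j z z).trans ?_
          have h3 : (1 / 8 : ℝ) ^ j ≤ 1 := pow_le_one₀ (by norm_num) (by norm_num)
          have h4 : 0 ≤ (1 / 8 : ℝ) ^ j * b := by positivity
          have h5 := mul_le_mul_of_nonneg_right h3 (height_pos Γ z).le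
          linarith
        have k1 := key (n + 1 + 1)
        have k2 := key 1
        rw [abs_le] at k1 k2 ⊢
        constructor <;> linarith
      have h3 : Tendsto (fun n : ℕ => 4 * (height Γ z + b) * (1 / ((n : ℝ) + 1))) (hyperfilter ℕ)
          (𝓝 (4 * (height Γ z + b) * 0)) :=
        (tendsto_one_div_add_atTop_nhds_zero_nat.const_mul _).mono_left hle
      rw [mul_zero] at h3
      exact squeeze_zero_norm h2 h3
    exact sub_eq_zero.1 (tendsto_nhds_unique ((hlim z).sub (hFlim z)) hz)
  have hconst := eq_of_avg_eq hinv nA nU hFreg hharm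
  obtain ⟨n, hn⟩ := (Metric.tendstoUniformlyOn_iff.1 (hFunif C hC) (1 / 2) (by norm_num)).exists
  have hx := hn (x n) (hmem _ (by linarith [hxy n, height_pos Γ (y n)]))
  have hy := hn (y n) (hmem _ (by linarith [hxy n, height_pos Γ (x n)]))
  have h1 := hgt n
  rw [hconst (x n) (y n)] at hx
  rw [Real.dist_eq, abs_lt] at hx hy
  have : cesaro τ (n + 1) (φ n) (x n) - cesaro τ (n + 1) (φ n) (y n) = f n (x n) - f n (y n) := by
    simp only [hf]; ring
  rw [this] at h1
  refine absurd h1 (not_lt.2 (abs_le.2 ⟨by linarith, by linarith⟩))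

theorem exists_cesaro_contract {μ : Measure (XQuot Γ)} [IsProbabilityMeasure μ]
    (hlat : IsLatticeSL2 Γ)
    (hinv : ∀ g : SL2, Measure.map (fun x => rmul Γ x g) μ = μ) (hD : Drift Γ τ b) :
    ∃ n, 0 < n ∧ ∀ c, 0 < c → ∀ φ : XQuot Γ → ℝ, Cls τ b 1 c φ →
      Cls τ b 1 (c / 2) (cesaro τ n φ) := by
  obtain ⟨n, hn, hnear⟩ := exists_cesaro_near hlat hinv hD (16 * b)
  refine ⟨n, hn, fun c hc φ h => h.cesaro_of_osc hD hc.le hn fun x y => ?_⟩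
  have h1 := one_le_height Γ x
  have h2 := one_le_height Γ y
  rcases le_total (height Γ x + height Γ y) (16 * b) with hR | hR
  · have hdiv : Cls τ b 1 1 fun x => φ x / c := by
      unfold Cls
      rw [one_mul, one_mul, one_mul, one_mul]
      exact Reg.div hc h
    have hit : ∀ j x, (avg τ)^[j] (fun x => φ x / c) x = (avg τ)^[j] φ x / c := by
      intro j
      induction j with
      | zero => intro x; rfl
      | succ j ih =>
        intro x
        rw [Function.iterate_succ_apply', Function.iterate_succ_apply', funext ih]
        exact integral_div _ _
    have hce : ∀ x, cesaro τ n (fun x => φ x / c) x = cesaro τ n φ x / c := fun x => by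
      unfold cesaro
      rw [mul_div_assoc, Finset.sum_div]
      congr 1
      exact Finset.sum_congr rfl fun j _ => hit _ _
    have := hnear _ hdiv x y hR
    rw [hce, hce, ← sub_div, abs_div, abs_of_pos hc, div_le_one hc] at this
    refine this.trans ?_
    have := mul_le_mul_of_nonneg_left (show 2 ≤ height Γ x + height Γ y by linarith) hc.le
    linarith
  · refine (h.cesaro_osc hD hc.le hn x y).trans ?_
    have := mul_le_mul_of_nonneg_left (show 1 / 8 * (height Γ x + height Γ y) + 4 * b ≤
      1 / 2 * (height Γ x + height Γ y) by linarith) hc.le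
    linarith

end Contraction

section Horocycle

variable {Γ : Subgroup SL2}

/-- the average over a piece of length `P` of the horocycle through `y₀`, translated by `amat t` -/
def horo (y₀ : XQuot Γ) (P t : ℝ) (φ : XQuot Γ → ℝ) : ℝ :=
  P⁻¹ * ∫ x in (0 : ℝ)..P, φ (rmul Γ y₀ (lmat x * amat t))

theorem periodic_rmul_lmat {y₀ : XQuot Γ} {P : ℝ} (hper : rmul Γ y₀ (lmat P) = y₀) (g : SL2) :
    Function.Periodic (fun x => rmul Γ y₀ (lmat x * g)) P := fun x => by
  change rmul Γ y₀ (lmat (x + P) * g) = rmul Γ y₀ (lmat x * g)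
  rw [add_comm x P, lmat_add, mul_assoc, rmul_mul, hper]

theorem horo_shift {y₀ : XQuot Γ} {P : ℝ} (hper : rmul Γ y₀ (lmat P) = y₀) (φ : XQuot Γ → ℝ)
    (t v r : ℝ) : horo y₀ P t (fun z => φ (rmul Γ z (lmat v * amat r))) = horo y₀ P (t + r) φ := by
  unfold horo
  congr 1
  have h1 : ∀ x, rmul Γ (rmul Γ y₀ (lmat x * amat t)) (lmat v * amat r) =
      rmul Γ y₀ (lmat (x + Real.exp (-t) * v) * amat (t + r)) := fun x => by
    rw [← rmul_mul, mul_assoc, ← mul_assoc (amat t), amat_mul_lmat, mul_assoc, ← amat_add, ← mul_assoc,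
      ← lmat_add]
  simp only [h1]
  rw [intervalIntegral.integral_comp_add_right
    (fun x => φ (rmul Γ y₀ (lmat x * amat (t + r)))) (Real.exp (-t) * v), zero_add, add_comm P]
  have hp : Function.Periodic (fun x => φ (rmul Γ y₀ (lmat x * amat (t + r)))) P := fun x =>
    congrArg φ (periodic_rmul_lmat hper (amat (t + r)) x)
  have := hp.intervalIntegral_add_eq (Real.exp (-t) * v) 0
  rwa [zero_add] at this

theorem continuous_rmul_lmat_amat (y₀ : XQuot Γ) :
    Continuous fun q : ℝ × ℝ => rmul Γ y₀ (lmat q.1 * amat q.2) :=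
  (continuous_rmul_right y₀).comp
    ((continuous_lmat.comp continuous_fst).mul (continuous_amat.comp continuous_snd))

theorem continuous_rmul_lmat_mul (y₀ : XQuot Γ) (g : SL2) :
    Continuous fun x : ℝ => rmul Γ y₀ (lmat x * g) := by
  have h : Continuous fun x : ℝ => lmat x * g := continuous_lmat.mul continuous_const
  exact (continuous_rmul_right y₀).comp h

theorem continuous_horo {φ : XQuot Γ → ℝ} (hφ : Continuous φ) (y₀ : XQuot Γ) (P : ℝ) :
    Continuous fun t => horo y₀ P t φ := by
  refine continuous_const.mul (intervalIntegral.continuous_parametric_intervalIntegral_of_continuous'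
    (f := fun t x => φ (rmul Γ y₀ (lmat x * amat t))) ?_ 0 P)
  have h : Continuous fun q : ℝ × ℝ => lmat q.2 * amat q.1 :=
    (continuous_lmat.comp continuous_snd).mul (continuous_amat.comp continuous_fst)
  exact hφ.comp ((continuous_rmul_right y₀).comp h)

theorem horo_const_mul (y₀ : XQuot Γ) (P t A : ℝ) (φ : XQuot Γ → ℝ) :
    horo y₀ P t (fun z => A * φ z) = A * horo y₀ P t φ := by
  unfold horo
  rw [intervalIntegral.integral_const_mul]; ring

theorem horo_step_eq {τ : ℝ} {y₀ : XQuot Γ} {P : ℝ} (hP : 0 < P) (hper : rmul Γ y₀ (lmat P) = y₀) (t : ℝ) (φ : XQuot Γ → ℝ)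
    (p : ℝ × ℝ) : horo y₀ P (t + (τ + p.2)) φ =
      P⁻¹ * ∫ x in Set.Ioc 0 P, φ (rmul Γ (rmul Γ y₀ (lmat x * amat t)) (step τ p)) := by
  rw [← horo_shift hper φ t p.1 (τ + p.2), horo, intervalIntegral.integral_of_le hP.le]
  rfl

theorem horo_sub_const {φ : XQuot Γ → ℝ} (hφ : Continuous φ) (y₀ : XQuot Γ) {P : ℝ} (hP : 0 < P)
    (t m : ℝ) : horo y₀ P t (fun z => φ z - m) = horo y₀ P t φ - m := by
  unfold horo
  have hc : Continuous fun x => φ (rmul Γ y₀ (lmat x * amat t)) :=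
    hφ.comp (continuous_rmul_lmat_mul y₀ _)
  rw [intervalIntegral.integral_sub (hc.intervalIntegrable _ _) (by simp)]
  simp
  field_simp

variable [DiscreteTopology Γ]

theorem integrable_comp_of_le_height {α : Type*} [TopologicalSpace α] [MeasurableSpace α]
    [OpensMeasurableSpace α] {ν : Measure α} [IsFiniteMeasure ν] {K : Set α} (hK : IsCompact K)
    (hν : ∀ᵐ a ∂ν, a ∈ K) {h : α → XQuot Γ} (hh : Continuous h) {φ : XQuot Γ → ℝ}
    (hm : Measurable φ) {A : ℝ} (hA : 0 ≤ A) (hφ : ∀ x, |φ x| ≤ A * height Γ x) :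
    Integrable (fun a => φ (h a)) ν := by
  obtain ⟨M, hM⟩ := exists_height_le_of_isCompact (hK.image hh)
  refine Integrable.of_bound (hm.comp hh.measurable).aestronglyMeasurable (A * M) ?_
  filter_upwards [hν] with a ha
  exact (hφ _).trans (mul_le_mul_of_nonneg_left (hM _ ⟨a, ha, rfl⟩) hA)

theorem ae_mem_Icc (P : ℝ) : ∀ᵐ x ∂(volume.restrict (Set.Ioc 0 P)), x ∈ Set.Icc 0 P := by
  filter_upwards [ae_restrict_mem measurableSet_Ioc] with x hx using Set.Ioc_subset_Icc_self hx

variable {τ b : ℝ} {y₀ : XQuot Γ} {P : ℝ}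

theorem intervalIntegrable_horo (hP : 0 < P) (t : ℝ) {φ : XQuot Γ → ℝ} (hm : Measurable φ) {A : ℝ}
    (hA : 0 ≤ A) (hφ : ∀ x, |φ x| ≤ A * height Γ x) :
    IntervalIntegrable (fun x => φ (rmul Γ y₀ (lmat x * amat t))) volume 0 P := by
  rw [intervalIntegrable_iff_integrableOn_Ioc_of_le hP.le]
  exact integrable_comp_of_le_height isCompact_Icc (ae_mem_Icc P)
    (continuous_rmul_lmat_mul y₀ _) hm hA hφ

theorem integrable_prod_horo (t : ℝ) {φ : XQuot Γ → ℝ}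
    (hm : Measurable φ) {A : ℝ} (hA : 0 ≤ A) (hφ : ∀ x, |φ x| ≤ A * height Γ x) :
    Integrable (fun q : ℝ × (ℝ × ℝ) => φ (rmul Γ (rmul Γ y₀ (lmat q.1 * amat t)) (step τ q.2)))
      ((volume.restrict (Set.Ioc 0 P)).prod sqMeas) := by
  have hν : ∀ᵐ q ∂((volume.restrict (Set.Ioc 0 P)).prod sqMeas), q ∈ Set.Icc 0 P ×ˢ unitSq := by
    rw [sqMeas, Measure.prod_restrict]
    filter_upwards [ae_restrict_mem (measurableSet_Ioc.prod measurableSet_unitSq)] with q hq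
    exact ⟨Set.Ioc_subset_Icc_self hq.1, hq.2⟩
  have hc : Continuous fun q : ℝ × (ℝ × ℝ) =>
      rmul Γ (rmul Γ y₀ (lmat q.1 * amat t)) (step τ q.2) := by
    simp only [← rmul_mul]
    have h1 : Continuous fun q : ℝ × (ℝ × ℝ) => lmat q.1 * amat t * step τ q.2 :=
      ((continuous_lmat.comp continuous_fst).mul continuous_const).mul
        ((continuous_step τ).comp continuous_snd)
    exact (continuous_rmul_right y₀).comp h1
  exact integrable_comp_of_le_height (isCompact_Icc.prod isCompact_unitSq) hν hc hm hA hφ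

theorem integrable_horo_step (hP : 0 < P) (hper : rmul Γ y₀ (lmat P) = y₀) (t : ℝ)
    {φ : XQuot Γ → ℝ} (hm : Measurable φ) {A : ℝ} (hA : 0 ≤ A) (hφ : ∀ x, |φ x| ≤ A * height Γ x) :
    Integrable (fun p : ℝ × ℝ => horo y₀ P (t + (τ + p.2)) φ) sqMeas := by
  simp only [horo_step_eq hP hper]
  exact (integrable_prod_horo t hm hA hφ).integral_prod_right.const_mul _

theorem horo_avg (hP : 0 < P) (hper : rmul Γ y₀ (lmat P) = y₀) (t : ℝ) {φ : XQuot Γ → ℝ}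
    (hm : Measurable φ) {A : ℝ} (hA : 0 ≤ A) (hφ : ∀ x, |φ x| ≤ A * height Γ x) :
    horo y₀ P t (avg τ φ) = ∫ p, horo y₀ P (t + (τ + p.2)) φ ∂sqMeas := by
  simp only [horo_step_eq hP hper]
  rw [integral_const_mul, horo, intervalIntegral.integral_of_le hP.le]
  congr 1
  exact integral_integral_swap (integrable_prod_horo t hm hA hφ)

theorem horo_mono (hP : 0 < P) (t : ℝ) {φ ψ : XQuot Γ → ℝ} (hm : Measurable φ) (hm' : Measurable ψ)
    {A A' : ℝ} (hA : 0 ≤ A) (hA' : 0 ≤ A') (hφ : ∀ x, |φ x| ≤ A * height Γ x)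
    (hψ : ∀ x, |ψ x| ≤ A' * height Γ x) (h : ∀ x, φ x ≤ ψ x) : horo y₀ P t φ ≤ horo y₀ P t ψ :=
  mul_le_mul_of_nonneg_left (intervalIntegral.integral_mono_on hP.le
    (intervalIntegrable_horo hP t hm hA hφ) (intervalIntegrable_horo hP t hm' hA' hψ)
    fun _ _ => h _) (by positivity)

theorem abs_horo_le (hP : 0 < P) (t : ℝ) {φ : XQuot Γ → ℝ} (hm : Measurable φ)
    {A : ℝ} (hA : 0 ≤ A) (hφ : ∀ x, |φ x| ≤ A * height Γ x) :
    |horo y₀ P t φ| ≤ A * horo y₀ P t (height Γ) := by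
  have hV : ∀ x, |A * height Γ x| ≤ A * height Γ x := fun x =>
    (abs_of_nonneg (mul_nonneg hA (height_pos Γ x).le)).le
  rw [← horo_const_mul, abs_le, ← neg_one_mul, ← horo_const_mul]
  have hm' : Measurable fun z => A * height Γ z := (measurable_height Γ).const_mul _
  constructor
  · exact horo_mono hP t (hm'.const_mul _) hm hA hA (fun x => by rw [neg_one_mul, abs_neg]; exact hV x) hφ
      fun x => by have := (abs_le.1 (hφ x)).1; linarith
  · exact horo_mono hP t hm hm' hA hA hφ hV fun x => (abs_le.1 (hφ x)).2

theorem distort_amat_le {s : ℝ} (hs : |s| ≤ 1) : distort (amat s) ≤ 2 := by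
  have h := nrm_amat_le hs
  unfold distort
  rw [nrm_inv]
  have h3 : Real.exp (1 / 2) * Real.exp (1 / 2) = Real.exp 1 := by rw [← Real.exp_add]; norm_num
  have h4 := Real.exp_one_lt_d9
  calc _ ≤ ((2 : ℝ) ^ (4 : ℝ)) ^ (1 / 4 : ℝ) := by
        refine Real.rpow_le_rpow (mul_nonneg (nrm_nonneg _) (nrm_nonneg _)) ?_ (by norm_num)
        refine (mul_le_mul h h (nrm_nonneg _) (by positivity)).trans ?_
        norm_num
        linarith
    _ = 2 := by rw [← Real.rpow_mul (by norm_num)]; norm_num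

theorem exists_horo_height_le (hD : Drift Γ τ b) (hP : 0 < P) (hper : rmul Γ y₀ (lmat P) = y₀) :
    ∃ U, 0 < U ∧ ∀ t, 0 ≤ t → horo y₀ P t (height Γ) ≤ U := by
  have hb := hD.nonneg'
  have hτ := hD.nonneg
  have hmV := measurable_height Γ
  have hVV : ∀ x, |height Γ x| ≤ 1 * height Γ x := fun x => by
    rw [one_mul, abs_of_pos (height_pos Γ x)]
  have hrec (t : ℝ) : horo y₀ P (t + (τ + 1)) (height Γ) ≤ 2 * (1 / 8 * horo y₀ P t (height Γ) + b) := by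
    have h1 : horo y₀ P t (avg τ (height Γ)) ≤ 1 / 8 * horo y₀ P t (height Γ) + b := by
      unfold horo
      have hi := intervalIntegrable_horo (y₀ := y₀) hP t hmV zero_le_one hVV
      have hi2 : IntervalIntegrable (fun x => 1 / 8 * height Γ (rmul Γ y₀ (lmat x * amat t)) + b)
        volume 0 P := (hi.const_mul _).add (by simp)
      have e : ∫ x in (0 : ℝ)..P, (1 / 8 * height Γ (rmul Γ y₀ (lmat x * amat t)) + b) =
          1 / 8 * (∫ x in (0 : ℝ)..P, height Γ (rmul Γ y₀ (lmat x * amat t))) + P * b := by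
        rw [intervalIntegral.integral_add (hi.const_mul _) (by simp),
          intervalIntegral.integral_const_mul]
        simp
      have h2 : ∫ x in (0 : ℝ)..P, avg τ (height Γ) (rmul Γ y₀ (lmat x * amat t)) ≤
          ∫ x in (0 : ℝ)..P, (1 / 8 * height Γ (rmul Γ y₀ (lmat x * amat t)) + b) := by
        rw [intervalIntegral.integral_of_le hP.le, intervalIntegral.integral_of_le hP.le]
        refine integral_mono_of_nonneg (ae_of_all _ fun x => ?_)
          ((intervalIntegrable_iff_integrableOn_Ioc_of_le hP.le).1 hi2) (ae_of_all _ fun x => hD.le _)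
        exact integral_nonneg fun p => (height_pos Γ _).le
      rw [e] at h2
      calc _ ≤ P⁻¹ * (1 / 8 * (∫ x in (0 : ℝ)..P, height Γ (rmul Γ y₀ (lmat x * amat t))) + P * b) :=
            mul_le_mul_of_nonneg_left h2 (by positivity)
        _ = _ := by field_simp
    rw [horo_avg hP hper t hmV zero_le_one hVV] at h1
    have h2 : ∀ p ∈ unitSq, horo y₀ P (t + (τ + 1)) (height Γ) ≤
        2 * horo y₀ P (t + (τ + p.2)) (height Γ) := fun p hp => by
      have hσ : |1 - p.2| ≤ 1 := by
        obtain ⟨-, h3, h4⟩ := hp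
        rw [abs_le]; constructor <;> linarith
      rw [show t + (τ + 1) = t + (τ + p.2) + (1 - p.2) by ring, ← horo_shift hper _ _ 0,
        ← horo_const_mul]
      have hle : ∀ x, height Γ (rmul Γ x (lmat 0 * amat (1 - p.2))) ≤ 2 * height Γ x := fun x => by
        rw [lmat_zero, one_mul]
        exact (height_rmul_le Γ x _).trans
          (mul_le_mul_of_nonneg_right (distort_amat_le hσ) (height_pos Γ x).le)
      refine horo_mono hP _ (hmV.comp (continuous_rmul_left _).measurable) (hmV.const_mul _) (A := 2)
        (A' := 2) (by norm_num) (by norm_num) (fun x => ?_) (fun x => ?_) hle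
      · rw [abs_of_pos (height_pos Γ _)]; exact hle x
      · rw [abs_of_pos (mul_pos two_pos (height_pos Γ _))]
    have hi : Integrable (fun p : ℝ × ℝ => horo y₀ P (t + (τ + p.2)) (height Γ)) sqMeas :=
      integrable_horo_step hP hper t hmV zero_le_one hVV
    have h3 : horo y₀ P (t + (τ + 1)) (height Γ) / 2 ≤
        ∫ p, horo y₀ P (t + (τ + p.2)) (height Γ) ∂sqMeas := by
      have : ∫ p : ℝ × ℝ, horo y₀ P (t + (τ + 1)) (height Γ) / 2 ∂sqMeas ≤
          ∫ p, horo y₀ P (t + (τ + p.2)) (height Γ) ∂sqMeas := by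
        refine integral_mono_ae (integrable_const _) hi ?_
        filter_upwards [ae_mem_unitSq] with p hp
        linarith [h2 p hp]
      simpa using this
    linarith
  have hC : IsCompact ((fun q : ℝ × ℝ => rmul Γ y₀ (lmat q.1 * amat q.2)) ''
      (Set.Icc 0 P ×ˢ Set.Icc 0 (τ + 1))) :=
    (isCompact_Icc.prod isCompact_Icc).image (continuous_rmul_lmat_amat y₀)
  obtain ⟨W, hW⟩ := exists_height_le_of_isCompact hC
  have hbase : ∀ t ∈ Set.Icc 0 (τ + 1), horo y₀ P t (height Γ) ≤ W := fun t ht => by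
    have h1 : ∫ x in (0 : ℝ)..P, height Γ (rmul Γ y₀ (lmat x * amat t)) ≤ ∫ x in (0 : ℝ)..P, W :=
      intervalIntegral.integral_mono_on hP.le (intervalIntegrable_horo hP t hmV zero_le_one hVV)
        (by simp) fun x hx => hW _ ⟨(x, t), ⟨hx, ht⟩, rfl⟩
    rw [intervalIntegral.integral_const, sub_zero, smul_eq_mul] at h1
    unfold horo
    rwa [inv_mul_le_iff₀ hP]
  refine ⟨max W (4 * b) + 1, by have := le_max_right W (4 * b); linarith, ?_⟩
  set U := max W (4 * b) + 1
  have hU1 : W ≤ U := (le_max_left W (4 * b)).trans (by simp [U])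
  have hU2 : 4 * b ≤ U := (le_max_right W (4 * b)).trans (by simp [U])
  have hind : ∀ k : ℕ, ∀ t ∈ Set.Icc (0 : ℝ) ((k + 1) * (τ + 1)), horo y₀ P t (height Γ) ≤ U := by
    intro k
    induction k with
    | zero => intro t ht; exact (hbase t (by simpa using ht)).trans hU1
    | succ k ih =>
      intro t ht
      rcases le_total t (τ + 1) with h | h
      · exact (hbase t ⟨ht.1, h⟩).trans hU1
      · have h1 := hrec (t - (τ + 1))
        rw [sub_add_cancel] at h1
        have h2 := ih (t - (τ + 1)) ⟨by linarith, by
          have := ht.2; push_cast at this; linarith⟩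
        linarith
  intro t ht
  obtain ⟨k, hk⟩ := exists_nat_ge t
  refine hind k t ⟨ht, ?_⟩
  have : (0 : ℝ) ≤ k := Nat.cast_nonneg k
  nlinarith

end Horocycle

section Equidistribution

variable {Γ : Subgroup SL2} {τ b : ℝ} {y₀ : XQuot Γ} {P : ℝ}

/-- the integral over a segment of translates of a horocycle -/
def horoInt (y₀ : XQuot Γ) (P T : ℝ) (φ : XQuot Γ → ℝ) : ℝ := ∫ t in (0 : ℝ)..T, horo y₀ P t φ

theorem horoInt_cesaro {φ : XQuot Γ → ℝ} (hφ : ∀ j, Continuous ((avg τ)^[j] φ)) (n : ℕ) (T : ℝ) :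
    horoInt y₀ P T (cesaro τ n φ) =
      (n : ℝ)⁻¹ * ∑ j ∈ Finset.range n, horoInt y₀ P T ((avg τ)^[j + 1] φ) := by
  have h1 : ∀ t, horo y₀ P t (cesaro τ n φ) =
      (n : ℝ)⁻¹ * ∑ j ∈ Finset.range n, horo y₀ P t ((avg τ)^[j + 1] φ) := fun t => by
    unfold horo cesaro
    rw [intervalIntegral.integral_const_mul, intervalIntegral.integral_finsetSum]
    · rw [← Finset.mul_sum]; ring
    · exact fun j _ => ((hφ _).comp (continuous_rmul_lmat_mul y₀ (amat t))).intervalIntegrable _ _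
  unfold horoInt
  simp only [h1]
  rw [intervalIntegral.integral_const_mul, intervalIntegral.integral_finsetSum]
  exact fun j _ => (continuous_horo (hφ _) y₀ P).intervalIntegrable _ _

theorem Cls.sub_const {k c : ℝ} {φ : XQuot Γ → ℝ} (h : Cls τ b k c φ) (m : ℝ) :
    Cls τ b k c fun x => φ x - m := by
  have e : ∀ u v, φ u - m - (φ v - m) = φ u - φ v := fun u v => by ring
  refine ⟨fun x y => ?_, fun x y hy => ?_, fun x y hy => ?_, fun x y hy => ?_⟩
  · rw [e]; exact h.osc x y
  · rw [e]; exact h.lmat x y hy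
  · rw [e]; exact h.amat x y hy
  · rw [e]; exact h.umat x y hy

variable [DiscreteTopology Γ]

theorem integrable_of_le_height {μ : Measure (XQuot Γ)} [IsProbabilityMeasure μ]
    (hinv : ∀ g : SL2, Measure.map (fun x => rmul Γ x g) μ = μ) {φ : XQuot Γ → ℝ}
    (hφ : Continuous φ) {A : ℝ} (h : ∀ x, |φ x| ≤ A * height Γ x) : Integrable φ μ :=
  ((integrable_height hinv).const_mul A).mono' hφ.aestronglyMeasurable (ae_of_all _ h)

theorem Reg.exists_le_height {k mL mA mU : ℝ} {φ : XQuot Γ → ℝ} (h : Reg τ k mL mA mU φ) :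
    ∃ A, 0 ≤ A ∧ ∀ x, |φ x| ≤ A * height Γ x := by
  set x₁ : XQuot Γ := qmk Γ 1
  have hv := height_pos Γ x₁
  refine ⟨|k| * (1 + height Γ x₁) + |φ x₁|, by positivity, fun x => ?_⟩
  have h1 := h.osc x x₁
  have h2 := one_le_height Γ x
  have h3 : k * (height Γ x + height Γ x₁) ≤ |k| * (height Γ x + height Γ x₁) :=
    mul_le_mul_of_nonneg_right (le_abs_self k) (by linarith)
  have h4 := mul_le_mul_of_nonneg_left h2 (mul_nonneg (abs_nonneg k) hv.le)
  have h5 := mul_le_mul_of_nonneg_left h2 (abs_nonneg (φ x₁))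
  have h6 := abs_sub_abs_le_abs_sub (φ x) (φ x₁)
  linarith

theorem Cls.integral_cesaro {μ : Measure (XQuot Γ)} [IsProbabilityMeasure μ]
    (hinv : ∀ g : SL2, Measure.map (fun x => rmul Γ x g) μ = μ) (hD : Drift Γ τ b) {c : ℝ}
    (hc : 0 ≤ c) {φ : XQuot Γ → ℝ} (h : Cls τ b 1 c φ) {n : ℕ} (hn : 0 < n) :
    ∫ x, cesaro τ n φ x ∂μ = ∫ x, φ x ∂μ := by
  have hi : ∀ j, Continuous ((_root_.avg τ)^[j] φ) ∧ Integrable ((_root_.avg τ)^[j] φ) μ := fun j => by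
    have h1 := (h.iterate hD hc j).2
    obtain ⟨A, -, hA⟩ := Reg.exists_le_height h1
    exact ⟨h1.continuous hD hc, integrable_of_le_height hinv (h1.continuous hD hc) hA⟩
  have he : ∀ j, ∫ x, (_root_.avg τ)^[j] φ x ∂μ = ∫ x, φ x ∂μ := fun j => by
    induction j with
    | zero => rfl
    | succ j ih =>
      rw [Function.iterate_succ_apply', integral_avg hinv τ (hi j).1.measurable (hi j).2, ih]
  unfold cesaro
  rw [integral_const_mul, integral_finsetSum _ fun j _ => (hi (j + 1)).2]
  simp only [he]
  have : (n : ℝ) ≠ 0 := by positivity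
  simp
  field_simp

theorem Cls.abs_le_of_integral_eq_zero {μ : Measure (XQuot Γ)} [IsProbabilityMeasure μ]
    (hinv : ∀ g : SL2, Measure.map (fun x => rmul Γ x g) μ = μ) (hD : Drift Γ τ b) {c : ℝ}
    (hc : 0 ≤ c) {φ : XQuot Γ → ℝ} (h : Cls τ b 1 c φ) (h0 : ∫ x, φ x ∂μ = 0) (x : XQuot Γ) :
    |φ x| ≤ c * (1 + ∫ y, height Γ y ∂μ) * height Γ x := by
  have hcont := h.continuous hD hc
  obtain ⟨A, -, hA⟩ := Reg.exists_le_height h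
  have hi := integrable_of_le_height hinv hcont hA
  have hV := integrable_height (Γ := Γ) hinv
  have e : φ x = ∫ y, (φ x - φ y) ∂μ := by
    rw [integral_sub (integrable_const _) hi, h0]; simp
  have hi2 : Integrable (fun y => height Γ x + height Γ y) μ := (integrable_const _).add hV
  have h1 : |φ x| ≤ ∫ y, c * (height Γ x + height Γ y) ∂μ := by
    rw [e]
    refine abs_integral_le_integral_abs.trans (integral_mono ((integrable_const _).sub hi).abs
      (hi2.const_mul c) fun y => ?_)
    have := h.osc x y
    rwa [mul_one] at this
  rw [integral_const_mul, integral_add (integrable_const _) hV] at h1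
  simp only [integral_const, probReal_univ, one_smul] at h1
  have h2 : 0 ≤ ∫ y, height Γ y ∂μ := integral_nonneg fun y => (height_pos Γ y).le
  have h3 := mul_le_mul_of_nonneg_left (one_le_height Γ x) (mul_nonneg hc h2)
  linarith

theorem abs_horoInt_le (hP : 0 < P) {U : ℝ} (hU : ∀ t, 0 ≤ t → horo y₀ P t (height Γ) ≤ U) {T : ℝ}
    (hT : 0 ≤ T) {φ : XQuot Γ → ℝ} (hφ : Continuous φ) {A : ℝ} (hA : 0 ≤ A)
    (h : ∀ x, |φ x| ≤ A * height Γ x) : |horoInt y₀ P T φ| ≤ A * U * T := by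
  have := intervalIntegral.norm_integral_le_of_norm_le_const (a := (0 : ℝ)) (b := T)
    (f := fun t => horo y₀ P t φ) (C := A * U) fun t ht => by
      rw [Set.uIoc_of_le hT] at ht
      exact (abs_horo_le hP t hφ.measurable hA h).trans (mul_le_mul_of_nonneg_left (hU t ht.1.le) hA)
  rwa [sub_zero, abs_of_nonneg hT] at this

theorem abs_integral_shift_le {g : ℝ → ℝ} (hg : Continuous g) {M : ℝ}
    (hM : ∀ t, 0 ≤ t → |g t| ≤ M) {T r R : ℝ} (hT : 0 ≤ T) (hr : 0 ≤ r) (hrR : r ≤ R) :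
    |(∫ t in (0 : ℝ)..T, g (t + r)) - ∫ t in (0 : ℝ)..T, g t| ≤ 2 * R * M := by
  have hi : ∀ a b, IntervalIntegrable g volume a b := fun a b => hg.intervalIntegrable a b
  have hb : ∀ a, 0 ≤ a → |∫ t in a..a + r, g t| ≤ M * R := fun a ha => by
    have := intervalIntegral.norm_integral_le_of_norm_le_const (a := a) (b := a + r)
      (f := g) (C := M) fun t ht => by
        rw [Set.uIoc_of_le (by linarith)] at ht
        exact hM t (by linarith [ht.1])
    rw [add_sub_cancel_left, abs_of_nonneg hr] at this
    exact this.trans (mul_le_mul_of_nonneg_left hrR ((abs_nonneg _).trans (hM 0 le_rfl)))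
  rw [intervalIntegral.integral_comp_add_right]
  have h1 := intervalIntegral.integral_add_adjacent_intervals (hi 0 (0 + r)) (hi (0 + r) (T + r))
  have h2 := intervalIntegral.integral_add_adjacent_intervals (hi 0 T) (hi T (T + r))
  have h3 := hb 0 le_rfl
  have h4 := hb T hT
  rw [abs_le] at h3 h4 ⊢
  constructor <;> linarith

theorem horoInt_avg (hP : 0 < P) (hper : rmul Γ y₀ (lmat P) = y₀) {T : ℝ} (hT : 0 ≤ T)
    {φ : XQuot Γ → ℝ} (hφ : Continuous φ) {A : ℝ} (hA : 0 ≤ A) (h : ∀ x, |φ x| ≤ A * height Γ x) :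
    horoInt y₀ P T (avg τ φ) = ∫ p, (∫ t in (0 : ℝ)..T, horo y₀ P (t + (τ + p.2)) φ) ∂sqMeas := by
  unfold horoInt
  simp only [horo_avg hP hper _ hφ.measurable hA h, intervalIntegral.integral_of_le hT]
  set F : ℝ → ℝ × ℝ → ℝ := fun t p => horo y₀ P (t + (τ + p.2)) φ with hF
  have hc : Continuous fun q : ℝ × (ℝ × ℝ) => F q.1 q.2 :=
    (continuous_horo hφ y₀ P).comp (continuous_fst.add (continuous_const.add
      (continuous_snd.comp continuous_snd)))
  have hi : IntegrableOn (fun q : ℝ × (ℝ × ℝ) => F q.1 q.2)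
      (Set.Icc 0 T ×ˢ unitSq) (volume.prod volume) := by
    have hK : IsCompact (Set.Icc 0 T ×ˢ unitSq) := isCompact_Icc.prod isCompact_unitSq
    exact hc.continuousOn.integrableOn_compact hK
  have hi' : Integrable (Function.uncurry F) ((volume.restrict (Set.Ioc 0 T)).prod sqMeas) := by
    rw [sqMeas, Measure.prod_restrict]
    exact hi.mono_set (Set.prod_mono Set.Ioc_subset_Icc_self subset_rfl)
  change ∫ t in Set.Ioc 0 T, ∫ p, F t p ∂sqMeas = ∫ p, (∫ t in Set.Ioc 0 T, F t p) ∂sqMeas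
  clear_value F
  exact integral_integral_swap hi'

theorem abs_horoInt_avg_sub_le (hD : Drift Γ τ b) (hP : 0 < P) (hper : rmul Γ y₀ (lmat P) = y₀)
    {U : ℝ} (hU : ∀ t, 0 ≤ t → horo y₀ P t (height Γ) ≤ U) {T : ℝ} (hT : 0 ≤ T)
    {φ : XQuot Γ → ℝ} (hφ : Continuous φ) {A : ℝ} (hA : 0 ≤ A) (h : ∀ x, |φ x| ≤ A * height Γ x) :
    |horoInt y₀ P T (avg τ φ) - horoInt y₀ P T φ| ≤ 2 * (τ + 1) * (A * U) := by
  have hch := continuous_horo hφ y₀ P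
  have hc : Continuous fun p : ℝ × ℝ => ∫ t in (0 : ℝ)..T, horo y₀ P (t + (τ + p.2)) φ := by
    refine intervalIntegral.continuous_parametric_intervalIntegral_of_continuous'
      (f := fun (p : ℝ × ℝ) t => horo y₀ P (t + (τ + p.2)) φ) ?_ 0 T
    exact hch.comp (by fun_prop : Continuous fun q : (ℝ × ℝ) × ℝ => q.2 + (τ + q.1.2))
  have e : horoInt y₀ P T (avg τ φ) - horoInt y₀ P T φ =
      ∫ p, ((∫ t in (0 : ℝ)..T, horo y₀ P (t + (τ + p.2)) φ) - horoInt y₀ P T φ) ∂sqMeas := by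
    rw [integral_sub (integrable_sqMeas hc) (integrable_const _), ← horoInt_avg hP hper hT hφ hA h]
    simp
  rw [e]
  refine abs_integral_sqMeas_le fun p hp => ?_
  refine abs_integral_shift_le hch (fun t ht => (abs_horo_le hP t hφ.measurable hA h).trans
    (mul_le_mul_of_nonneg_left (hU t ht) hA)) hT ?_ ?_
  · exact add_nonneg hD.nonneg hp.2.1
  · linarith [show p.2 ≤ 1 from hp.2.2]

theorem Cls.abs_iterate_le (hD : Drift Γ τ b) {c : ℝ} (hc : 0 ≤ c) {φ : XQuot Γ → ℝ}
    (h : Cls τ b 1 c φ) {A : ℝ} (hA : 0 ≤ A) (hφ : ∀ x, |φ x| ≤ A * height Γ x) (j : ℕ) (x : XQuot Γ) :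
    |(_root_.avg τ)^[j] φ x| ≤ A * (1 + 2 * b) * height Γ x := by
  have hb := hD.nonneg'
  have key : ∀ j x, |(_root_.avg τ)^[j] φ x - 0| ≤
      A * (1 / 8) ^ j * height Γ x + A * (2 * b * (1 - (1 / 8) ^ j)) := by
    intro j
    induction j with
    | zero => simpa using hφ
    | succ j ih =>
      intro x
      rw [Function.iterate_succ_apply']
      refine (avg_sub_const_le hD ((h.iterate hD hc j).2.continuous hD hc) (by positivity) ih x).trans ?_
      have : 0 ≤ A * ((1 / 8 : ℝ) ^ j * b) := by positivity
      rw [pow_succ]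
      linarith
  have h1 := key j x
  rw [sub_zero] at h1
  refine h1.trans ?_
  have h3 : (1 / 8 : ℝ) ^ j ≤ 1 := pow_le_one₀ (by norm_num) (by norm_num)
  have h4 : 0 ≤ A * ((1 / 8 : ℝ) ^ j * b) := by positivity
  have h5 := mul_le_mul_of_nonneg_left h3 (mul_nonneg hA (height_pos Γ x).le)
  have h6 := mul_le_mul_of_nonneg_left (one_le_height Γ x) (mul_nonneg hA hb)
  linarith

theorem abs_horoInt_cesaro_sub_le (hD : Drift Γ τ b) (hP : 0 < P) (hper : rmul Γ y₀ (lmat P) = y₀)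
    {U : ℝ} (hU0 : 0 ≤ U) (hU : ∀ t, 0 ≤ t → horo y₀ P t (height Γ) ≤ U) {T : ℝ} (hT : 0 ≤ T)
    {c : ℝ} (hc : 0 ≤ c) {φ : XQuot Γ → ℝ} (h : Cls τ b 1 c φ) {A : ℝ} (hA : 0 ≤ A)
    (hφ : ∀ x, |φ x| ≤ A * height Γ x) {n : ℕ} (hn : 0 < n) :
    |horoInt y₀ P T (cesaro τ n φ) - horoInt y₀ P T φ| ≤
      A * (n * (2 * (τ + 1) * ((1 + 2 * b) * U))) := by
  have hb := hD.nonneg'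
  have hτ := hD.nonneg
  have hcont : ∀ j, Continuous ((avg τ)^[j] φ) := fun j => (h.iterate hD hc j).2.continuous hD hc
  set B := 2 * (τ + 1) * (A * (1 + 2 * b) * U) with hB
  have hB0 : 0 ≤ B := by positivity
  have h1 : ∀ j : ℕ, |horoInt y₀ P T ((avg τ)^[j] φ) - horoInt y₀ P T φ| ≤ j * B := by
    intro j
    induction j with
    | zero => simp
    | succ j ih =>
      have := abs_horoInt_avg_sub_le hD hP hper hU hT (hcont j) (A := A * (1 + 2 * b)) (by positivity)
        (fun x => h.abs_iterate_le hD hc hA hφ j x)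
      rw [← Function.iterate_succ_apply' (avg τ)] at this
      push_cast
      rw [abs_le] at *
      constructor <;> linarith
  have e : horoInt y₀ P T (cesaro τ n φ) - horoInt y₀ P T φ = (n : ℝ)⁻¹ *
      ∑ j ∈ Finset.range n, (horoInt y₀ P T ((avg τ)^[j + 1] φ) - horoInt y₀ P T φ) := by
    have : (n : ℝ) ≠ 0 := by positivity
    rw [horoInt_cesaro hcont, Finset.sum_sub_distrib, mul_sub]
    simp
    field_simp
  rw [e, abs_mul, abs_of_nonneg (by positivity), inv_mul_le_iff₀ (by positivity)]
  refine (Finset.abs_sum_le_sum_abs _ _).trans ((Finset.sum_le_sum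
    fun j hj => (h1 (j + 1)).trans (mul_le_mul_of_nonneg_right (?_ : _ ≤ (n : ℝ)) hB0)).trans
      (le_of_eq ?_))
  · exact_mod_cast Finset.mem_range.1 hj
  · simp only [Finset.sum_const, Finset.card_range, nsmul_eq_mul, hB]
    ring

theorem exists_abs_horoInt_le {μ : Measure (XQuot Γ)} [IsProbabilityMeasure μ]
    (hlat : IsLatticeSL2 Γ)
    (hinv : ∀ g : SL2, Measure.map (fun x => rmul Γ x g) μ = μ) (hD : Drift Γ τ b)
    (hP : 0 < P) (hper : rmul Γ y₀ (lmat P) = y₀) {c : ℝ} (hc : 0 < c) {φ : XQuot Γ → ℝ}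
    (h : Cls τ b 1 c φ) (h0 : ∫ x, φ x ∂μ = 0) :
    ∃ K, ∀ T, 0 ≤ T → |horoInt y₀ P T φ| ≤ K := by
  obtain ⟨n, hn, hcon⟩ := exists_cesaro_contract hlat hinv hD
  obtain ⟨U, hU0, hU⟩ := exists_horo_height_le hD hP hper
  have hk : ∀ k : ℕ, Cls τ b 1 (c / 2 ^ k) ((cesaro τ n)^[k] φ) ∧
      ∫ x, (cesaro τ n)^[k] φ x ∂μ = 0 := fun k => by
    induction k with
    | zero => simpa using ⟨h, h0⟩
    | succ k ih =>
      rw [Function.iterate_succ_apply']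
      refine ⟨?_, (ih.1.integral_cesaro hinv hD (by positivity) hn).trans ih.2⟩
      have := hcon _ (by positivity) _ ih.1
      rwa [div_div, ← pow_succ] at this
  set I := 1 + ∫ y, height Γ y ∂μ with hI
  have hI0 : 0 ≤ I := add_nonneg zero_le_one (integral_nonneg fun y => (height_pos Γ y).le)
  set K := n * (2 * (τ + 1) * ((1 + 2 * b) * U)) with hK
  have hb : ∀ k : ℕ, ∀ x, |(cesaro τ n)^[k] φ x| ≤ c / 2 ^ k * I * height Γ x := fun k x =>
    (hk k).1.abs_le_of_integral_eq_zero hinv hD (by positivity) (hk k).2 x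
  refine ⟨2 * (c * I * K), fun T hT => ?_⟩
  have key : ∀ k : ℕ, |horoInt y₀ P T φ| ≤ 2 * (c * I * K) * (1 - 1 / 2 ^ k) +
      c / 2 ^ k * I * U * T := by
    have hstep : ∀ k : ℕ, |horoInt y₀ P T ((cesaro τ n)^[k] φ) - horoInt y₀ P T φ| ≤
        2 * (c * I * K) * (1 - 1 / 2 ^ k) := by
      intro k
      induction k with
      | zero => simp
      | succ k ih =>
        have := abs_horoInt_cesaro_sub_le hD hP hper hU0.le hU hT (by positivity) (hk k).1
          (A := c / 2 ^ k * I) (by positivity) (hb k) hn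
        rw [← Function.iterate_succ_apply' (cesaro τ n), ← hK] at this
        have e : c / 2 ^ k * I * K = 2 * (c * I * K) * (1 / 2 ^ k - 1 / 2 ^ (k + 1)) := by
          rw [pow_succ]; field_simp; ring
        rw [e] at this
        rw [abs_le] at *
        constructor <;> linarith
    intro k
    have h1 := hstep k
    have h2 := abs_horoInt_le (y₀ := y₀) hP hU hT ((hk k).1.continuous hD (by positivity))
      (A := c / 2 ^ k * I) (by positivity) (hb k)
    rw [abs_le] at *
    constructor <;> linarith
  have h2 : Tendsto (fun k : ℕ => (1 / 2 : ℝ) ^ k) atTop (𝓝 0) :=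
    tendsto_pow_atTop_nhds_zero_of_lt_one (by norm_num) (by norm_num)
  have hlim : Tendsto (fun k : ℕ => 2 * (c * I * K) * (1 - 1 / 2 ^ k) + c / 2 ^ k * I * U * T) atTop
      (𝓝 (2 * (c * I * K) * (1 - 0) + c * I * U * T * 0)) := by
    have := ((h2.const_sub 1).const_mul (2 * (c * I * K))).add (h2.const_mul (c * I * U * T))
    refine this.congr fun k => ?_
    rw [_root_.one_div_pow]; ring
  have := ge_of_tendsto' hlim key
  simpa using this

theorem exists_abs_horoInt_sub_le {μ : Measure (XQuot Γ)} [IsProbabilityMeasure μ]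
    (hlat : IsLatticeSL2 Γ)
    (hinv : ∀ g : SL2, Measure.map (fun x => rmul Γ x g) μ = μ) (hD : Drift Γ τ b)
    (hP : 0 < P) (hper : rmul Γ y₀ (lmat P) = y₀) {c : ℝ} (hc : 0 < c) {φ : XQuot Γ → ℝ}
    (h : Cls τ b 1 c φ) :
    ∃ K, ∀ T, 0 ≤ T → |horoInt y₀ P T φ - T * ∫ x, φ x ∂μ| ≤ K := by
  have hcont := h.continuous hD hc.le
  obtain ⟨A, -, hA⟩ := Reg.exists_le_height h
  have hi := integrable_of_le_height hinv hcont hA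
  obtain ⟨K, hK⟩ := exists_abs_horoInt_le (φ := fun x => φ x - ∫ y, φ y ∂μ) hlat hinv hD hP hper hc
    (h.sub_const _) (by rw [integral_sub hi (integrable_const _)]; simp)
  refine ⟨K, fun T hT => ?_⟩
  have := hK T hT
  unfold horoInt at this ⊢
  simp only [horo_sub_const hcont y₀ hP] at this
  rw [intervalIntegral.integral_sub ((continuous_horo hcont y₀ P).intervalIntegrable _ _) (by simp)] at this
  simpa using this

end Equidistribution

section Regular

variable {Γ : Subgroup SL2}

theorem exists_isCompact_lift {S : Set (XQuot Γ)} (hS : IsCompact S) :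
    ∃ K : Set SL2, IsCompact K ∧ S ⊆ qmk Γ '' K := by
  refine hS.induction_on (p := fun S => ∃ K : Set SL2, IsCompact K ∧ S ⊆ qmk Γ '' K)
    ⟨∅, isCompact_empty, by simp⟩ ?_ ?_ ?_
  · rintro s t hst ⟨K, hK, h⟩
    exact ⟨K, hK, hst.trans h⟩
  · rintro s t ⟨K, hK, h⟩ ⟨K', hK', h'⟩
    exact ⟨K ∪ K', hK.union hK', by rw [Set.image_union]; exact Set.union_subset_union h h'⟩
  · intro x _
    obtain ⟨g, rfl⟩ := qmk_surjective (Γ := Γ) x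
    obtain ⟨K, hK, hg⟩ := exists_compact_mem_nhds g
    exact ⟨_, mem_nhdsWithin_of_mem_nhds (isOpenMap_qmk.image_mem_nhds hg), K, hK, subset_rfl⟩

/-- Lipschitz functions for the right action -/
def RLip (C : ℝ) (ψ : XQuot Γ → ℝ) : Prop :=
  ∀ (x : XQuot Γ) (k : SL2), |ψ (rmul Γ x k) - ψ x| ≤ C * nrm ((k : Matrix (Fin 2) (Fin 2) ℝ) - 1)

theorem norm_le_nrm (A : Matrix (Fin 2) (Fin 2) ℝ) : ‖(fun i j => A i j : Fin 2 → Fin 2 → ℝ)‖ ≤ nrm A := by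
  have h : ∀ i j, |A i j| ≤ nrm A := fun i j => by
    unfold nrm
    have := abs_nonneg (A 0 0); have := abs_nonneg (A 0 1)
    have := abs_nonneg (A 1 0); have := abs_nonneg (A 1 1)
    fin_cases i <;> fin_cases j <;> simp <;> linarith
  exact (pi_norm_le_iff_of_nonneg (nrm_nonneg A)).2 fun i =>
    (pi_norm_le_iff_of_nonneg (nrm_nonneg A)).2 fun j => h i j

theorem nrm_inv_sub_one (k : SL2) : nrm (((k⁻¹ : SL2) : Matrix (Fin 2) (Fin 2) ℝ) - 1) =
    nrm ((k : Matrix (Fin 2) (Fin 2) ℝ) - 1) := by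
  rw [Matrix.SpecialLinearGroup.coe_inv, Matrix.adjugate_fin_two]
  simp [nrm]
  ring

theorem exists_bound_of_smooth {ψ : XQuot Γ → ℝ} (hs : IsSmoothQuot Γ ψ) (hc : HasCompactSupport ψ) :
    Continuous ψ ∧ ∃ B, 0 ≤ B ∧ ∀ x, |ψ x| ≤ B := by
  obtain ⟨Ψ, hΨ, hψ⟩ := hs
  have h1 : Continuous fun g : SL2 => ψ (qmk Γ g) := by
    simp only [hψ]
    exact hΨ.continuous.comp (continuous_pi fun i => continuous_pi fun j => continuous_SL2_apply i j)
  have h2 : Continuous ψ := isOpenQuotientMap_qmk.isQuotientMap.continuous_iff.2 h1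
  obtain ⟨B, hB⟩ := hc.exists_bound_of_continuous h2
  exact ⟨h2, B, (norm_nonneg _).trans (hB (qmk Γ 1)), hB⟩

theorem exists_rLip_of_smooth {ψ : XQuot Γ → ℝ} (hs : IsSmoothQuot Γ ψ) (hc : HasCompactSupport ψ) :
    ∃ C, 0 ≤ C ∧ RLip C ψ := by
  obtain ⟨hcont, B, hB0, hB⟩ := exists_bound_of_smooth hs hc
  obtain ⟨Ψ, hΨ, hψ⟩ := hs
  obtain ⟨K, hK, hSK⟩ := exists_isCompact_lift (show IsCompact (tsupport ψ) from hc)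
  obtain ⟨N, hN⟩ := hK.exists_bound_of_continuousOn
    (continuous_nrm.comp isClosedEmbedding_coe_SL2.continuous).continuousOn
  have hN' : ∀ g ∈ K, nrm (g : Matrix (Fin 2) (Fin 2) ℝ) ≤ N := fun g hg =>
    (le_abs_self _).trans (hN g hg)
  obtain ⟨D, hD⟩ := (isCompact_closedBall (0 : Fin 2 → Fin 2 → ℝ) (3 * N)).exists_bound_of_continuousOn
    (hΨ.continuous_fderiv (by simp)).continuousOn
  have key : ∀ g ∈ K, ∀ k : SL2, nrm ((k : Matrix (Fin 2) (Fin 2) ℝ) - 1) ≤ 1 →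
      |ψ (qmk Γ (g * k)) - ψ (qmk Γ g)| ≤ |D| * N * nrm ((k : Matrix (Fin 2) (Fin 2) ℝ) - 1) := by
    intro g hg k hk
    have hN0 : 0 ≤ N := (nrm_nonneg _).trans (hN' g hg)
    have e : ((g * k : SL2) : Matrix (Fin 2) (Fin 2) ℝ) - g =
        (g : Matrix (Fin 2) (Fin 2) ℝ) * ((k : Matrix (Fin 2) (Fin 2) ℝ) - 1) := by
      rw [mul_sub, mul_one, Matrix.SpecialLinearGroup.coe_mul]
    have h1 : nrm (((g * k : SL2) : Matrix (Fin 2) (Fin 2) ℝ) - g) ≤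
        N * nrm ((k : Matrix (Fin 2) (Fin 2) ℝ) - 1) := by
      rw [e]
      exact (nrm_mul_le _ _).trans (mul_le_mul_of_nonneg_right (hN' g hg) (nrm_nonneg _))
    have h2 : nrm ((g * k : SL2) : Matrix (Fin 2) (Fin 2) ℝ) ≤ 3 * N := by
      have := nrm_add_le (((g * k : SL2) : Matrix (Fin 2) (Fin 2) ℝ) - g) g
      rw [sub_add_cancel] at this
      have := hN' g hg
      have := mul_le_mul_of_nonneg_left hk hN0
      linarith
    rw [hψ, hψ]
    have h3 := (convex_closedBall (0 : Fin 2 → Fin 2 → ℝ) (3 * N)).norm_image_sub_le_of_norm_fderiv_le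
      (f := Ψ) (𝕜 := ℝ) (C := |D|) (fun x _ => (hΨ.differentiable (by simp)).differentiableAt)
      (fun x hx => (hD x hx).trans (le_abs_self D))
      (x := fun i j => (g : Matrix (Fin 2) (Fin 2) ℝ) i j)
      (y := fun i j => ((g * k : SL2) : Matrix (Fin 2) (Fin 2) ℝ) i j)
      (mem_closedBall_zero_iff.2 ((norm_le_nrm _).trans (by linarith [hN' g hg])))
      (mem_closedBall_zero_iff.2 ((norm_le_nrm _).trans h2))
    refine h3.trans ?_
    rw [mul_assoc]
    exact mul_le_mul_of_nonneg_left ((norm_le_nrm (((g * k : SL2) : Matrix (Fin 2) (Fin 2) ℝ) - g)).trans h1)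
      (abs_nonneg D)
  set C := |D| * |N| + 2 * B with hC
  have hC0 : 0 ≤ C := by positivity
  refine ⟨C, hC0, fun x k => ?_⟩
  have hn := nrm_nonneg ((k : Matrix (Fin 2) (Fin 2) ℝ) - 1)
  rcases le_total 1 (nrm ((k : Matrix (Fin 2) (Fin 2) ℝ) - 1)) with h1 | h1
  · have a1 := hB (rmul Γ x k)
    have a2 := hB x
    have a3 := mul_le_mul_of_nonneg_left h1 hB0
    have a4 : 0 ≤ |D| * |N| * nrm ((k : Matrix (Fin 2) (Fin 2) ℝ) - 1) := by positivity
    rw [abs_le] at a1 a2 ⊢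
    constructor <;> linarith
  · have hle : |D| * N * nrm ((k : Matrix (Fin 2) (Fin 2) ℝ) - 1) ≤
        C * nrm ((k : Matrix (Fin 2) (Fin 2) ℝ) - 1) := by
      refine mul_le_mul_of_nonneg_right ?_ hn
      have := mul_le_mul_of_nonneg_left (le_abs_self N) (abs_nonneg D)
      linarith
    by_cases hx : x ∈ tsupport ψ
    · obtain ⟨g, hg, rfl⟩ := hSK hx
      exact (key g hg k h1).trans hle
    · by_cases hx' : rmul Γ x k ∈ tsupport ψ
      · obtain ⟨g, hg, hgx⟩ := hSK hx'
        have e : x = qmk Γ (g * k⁻¹) := by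
          rw [← rmul_qmk, hgx, rmul_rmul_inv]
        have := key g hg k⁻¹ (by rwa [nrm_inv_sub_one])
        rw [nrm_inv_sub_one, ← e, hgx, abs_sub_comm] at this
        exact this.trans hle
      · rw [image_eq_zero_of_notMem_tsupport hx, image_eq_zero_of_notMem_tsupport hx']
        simpa using mul_nonneg hC0 hn

theorem RLip.comp_rmul {C : ℝ} {ψ : XQuot Γ → ℝ} (hC : 0 ≤ C) (h : RLip C ψ) (w : SL2) :
    ∃ C', 0 ≤ C' ∧ RLip C' fun x => ψ (rmul Γ x w) := by
  set a := nrm ((w⁻¹ : SL2) : Matrix (Fin 2) (Fin 2) ℝ)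
  set d := nrm (w : Matrix (Fin 2) (Fin 2) ℝ)
  have ha : 0 ≤ a := nrm_nonneg _
  have hd : 0 ≤ d := nrm_nonneg _
  refine ⟨C * (a * d), by positivity, fun x k => ?_⟩
  have e : rmul Γ (rmul Γ x k) w = rmul Γ (rmul Γ x w) (w⁻¹ * k * w) := by
    rw [← rmul_mul, ← rmul_mul]
    congr 1
    group
  have e2 : ((w⁻¹ * k * w : SL2) : Matrix (Fin 2) (Fin 2) ℝ) - 1 =
      ((w⁻¹ : SL2) : Matrix (Fin 2) (Fin 2) ℝ) * ((k : Matrix (Fin 2) (Fin 2) ℝ) - 1) * w := by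
    rw [mul_sub, sub_mul, mul_one, ← Matrix.SpecialLinearGroup.coe_mul,
      ← Matrix.SpecialLinearGroup.coe_mul, ← Matrix.SpecialLinearGroup.coe_mul, inv_mul_cancel,
      Matrix.SpecialLinearGroup.coe_one]
  change |ψ (rmul Γ (rmul Γ x k) w) - ψ (rmul Γ x w)| ≤ _
  rw [e]
  refine (h _ _).trans ?_
  rw [e2, mul_assoc C]
  refine mul_le_mul_of_nonneg_left ?_ hC
  have h1 := nrm_mul_le (((w⁻¹ : SL2) : Matrix (Fin 2) (Fin 2) ℝ) * ((k : Matrix (Fin 2) (Fin 2) ℝ) - 1)) w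
  have h2 := nrm_mul_le ((w⁻¹ : SL2) : Matrix (Fin 2) (Fin 2) ℝ) ((k : Matrix (Fin 2) (Fin 2) ℝ) - 1)
  have h3 := mul_le_mul_of_nonneg_right h2 hd
  linarith

theorem nrm_lmat_sub_one (y : ℝ) : nrm ((lmat y : Matrix (Fin 2) (Fin 2) ℝ) - 1) = |y| := by
  rw [coe_lmat]; simp [nrm]

theorem nrm_umat_sub_one (y : ℝ) : nrm ((umat y : Matrix (Fin 2) (Fin 2) ℝ) - 1) = |y| := by
  rw [coe_umat]; simp [nrm]

theorem nrm_amat_sub_one_le {s : ℝ} (hs : |s| ≤ 1) :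
    nrm ((amat s : Matrix (Fin 2) (Fin 2) ℝ) - 1) ≤ 2 * |s| := by
  rw [coe_amat]
  have h1 : |s / 2| ≤ 1 := by rw [abs_div, abs_two]; linarith
  have a1 := Real.abs_exp_sub_one_le h1
  have a2 := Real.abs_exp_sub_one_le (x := -(s / 2)) (by rwa [abs_neg])
  rw [abs_neg] at a2
  rw [abs_div, abs_two] at a1 a2
  simp [nrm]
  linarith

variable [DiscreteTopology Γ] {τ b : ℝ}

theorem RLip.exists_cls (hD : Drift Γ τ b) {C B : ℝ} {ψ : XQuot Γ → ℝ} (hC : 0 ≤ C) (h : RLip C ψ)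
    (hB : ∀ x, |ψ x| ≤ B) : ∃ c, 0 < c ∧ Cls τ b 1 c ψ := by
  have hs := stepDistort_pos τ
  have hb := hD.nonneg'
  have hB0 : 0 ≤ B := (abs_nonneg _).trans (hB (qmk Γ 1))
  have hL : 0 < cL τ b := by unfold cL; positivity
  have hA : 0 < cA τ b := by unfold cA; positivity
  have hU : 0 < cU τ b := by unfold cU; positivity
  refine ⟨1 + B + C / cL τ b + 2 * C / cA τ b + C / cU τ b, by positivity, ?_⟩
  have h1 : ∀ {y m : ℝ} (x : XQuot Γ), 0 ≤ m → C ≤ m → C * |y| ≤ m * |y| * height Γ x := by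
    intro y m x hm hCm
    have a1 := mul_le_mul_of_nonneg_right hCm (abs_nonneg y)
    have a2 := mul_le_mul_of_nonneg_left (one_le_height Γ x) (mul_nonneg hm (abs_nonneg y))
    linarith
  have e : Real.exp (-(τ + 2)) ≤ 1 := Real.exp_le_one_iff.2 (by linarith [hD.nonneg])
  have hreg : Reg τ B C (2 * C) C ψ := by
    refine ⟨fun x y => ?_, fun x y _ => ?_, fun x s hs => ?_, fun x z _ => ?_⟩
    · have a1 := hB x
      have a2 := hB y
      have a3 := mul_le_mul_of_nonneg_left (one_le_height Γ x) hB0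
      have a4 := mul_le_mul_of_nonneg_left (one_le_height Γ y) hB0
      rw [abs_le] at a1 a2 ⊢
      constructor <;> linarith
    · have := h x (lmat y)
      rw [nrm_lmat_sub_one] at this
      exact this.trans (h1 x hC le_rfl)
    · have := (h x (amat s)).trans (mul_le_mul_of_nonneg_left (nrm_amat_sub_one_le (by linarith)) hC)
      have a2 := mul_le_mul_of_nonneg_left (one_le_height Γ x) (mul_nonneg hC (abs_nonneg s))
      linarith
    · have := h x (umat z)
      rw [nrm_umat_sub_one] at this
      exact this.trans (h1 x hC le_rfl)
  have p1 : 0 ≤ C / cL τ b := by positivity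
  have p2 : 0 ≤ 2 * C / cA τ b := by positivity
  have p3 : 0 ≤ C / cU τ b := by positivity
  refine hreg.mono (by linarith) ?_ ?_ ?_
  · rw [← div_le_iff₀ hL]; linarith
  · rw [← div_le_iff₀ hA]; linarith
  · rw [← div_le_iff₀ hU]; linarith

end Regular

section Cusp
variable {Γ : Subgroup SL2}

theorem nrm_conj_amat {Y : Matrix (Fin 2) (Fin 2) ℝ} (hY : Y 1 1 = -Y 0 0) (u : ℝ) :
    nrm (((amat u)⁻¹ : SL2) * Y * (amat u : Matrix (Fin 2) (Fin 2) ℝ)) =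
      2 * |Y 0 0| + Real.exp (-u) * |Y 0 1| + Real.exp u * |Y 1 0| := by
  have e1 : Real.exp (-(u / 2)) * Real.exp (u / 2) = 1 := by rw [← Real.exp_add]; simp
  have e2 : Real.exp (-(u / 2)) * Real.exp (-(u / 2)) = Real.exp (-u) := by
    rw [← Real.exp_add]; ring_nf
  have e3 : Real.exp (u / 2) * Real.exp (u / 2) = Real.exp u := by
    rw [← Real.exp_add]; ring_nf
  have e4 : -((-u) / 2) = u / 2 := by ring
  have e5 : (-u) / 2 = -(u / 2) := by ring
  rw [amat_inv, coe_amat, coe_amat, e4, e5]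
  unfold nrm
  simp only [Matrix.mul_apply, Fin.sum_univ_two, Matrix.of_apply, Matrix.cons_val', Matrix.cons_val_zero,
    Matrix.cons_val_one, Matrix.cons_val_fin_one, mul_zero, zero_mul, add_zero, zero_add, hY]
  simp only [abs_mul, abs_neg, Real.abs_exp]
  rw [← e2, ← e3]
  linear_combination (2 * |Y 0 0|) * e1

variable [DiscreteTopology Γ]

theorem exists_small_of_height_le {g : SL2} {ε : ℝ} (hε : 0 < ε)
    (h : 2 + ε ^ (-(1 / 4) : ℝ) ≤ heightG Γ g) :
    ∃ γ ∈ Γ, conjTl g γ ≠ 0 ∧ nrm (conjTl g γ) ≤ ε := by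
  by_contra! hcon
  have : heightG Γ g ≤ 1 + ε ^ (-(1 / 4) : ℝ) := by
    refine heightG_le Γ fun γ hγ => ?_
    by_cases h0 : conjTl g γ = 0
    · rw [h0, weight_zero]; positivity
    · exact weight_le_of_le hε (hcon γ hγ h0).le
  linarith

/-- If the geodesic ray `g a(-s)` diverges, then its endpoint is a cusp. -/
theorem exists_lower_conjTl_of_divergent (g : SL2)
    (hdiv : ∀ R : ℝ, ∃ s₁ : ℝ, ∀ s, s₁ ≤ s → R ≤ heightG Γ (g * amat (-s))) :
    ∃ A ∈ Γ, conjTl g A ≠ 0 ∧ conjTl g A 0 0 = 0 ∧ conjTl g A 0 1 = 0 := by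
  have hsmall : ∀ ε : ℝ, 0 < ε → ∃ s₁ : ℝ, ∀ s, s₁ ≤ s → ∃ γ ∈ Γ, conjTl (g * amat (-s)) γ ≠ 0 ∧
      nrm (conjTl (g * amat (-s)) γ) ≤ ε := by
    intro ε hε
    obtain ⟨s₁, h⟩ := hdiv (2 + ε ^ (-(1 / 4) : ℝ))
    exact ⟨s₁, fun s hs => exists_small_of_height_le hε (h s hs)⟩
  obtain ⟨s₁, h₁⟩ := hsmall (1 / 1000) (by norm_num)
  have hmin : ∀ n : ℕ, ∃ A ∈ Γ, conjTl (g * amat (-(s₁ + n))) A ≠ 0 ∧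
      ∀ B ∈ Γ, conjTl (g * amat (-(s₁ + n))) B ≠ 0 →
        nrm (conjTl (g * amat (-(s₁ + n))) A) ≤ 2 * nrm (conjTl (g * amat (-(s₁ + n))) B) := by
    intro n
    obtain ⟨γ, hγ, hne, -⟩ := h₁ (s₁ + n) (by simp)
    exact exists_nearMin Γ _ ⟨γ, hγ, hne⟩
  choose A hA hA0 hAm using hmin
  have hA3 : ∀ n : ℕ, nrm (conjTl (g * amat (-(s₁ + n))) (A n)) ≤ 1 / 500 := by
    intro n
    obtain ⟨γ, hγ, hne, hle⟩ := h₁ (s₁ + n) (by simp)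
    have := hAm n γ hγ hne
    linarith
  have hform : ∀ (s : ℝ) (γ : SL2), nrm (conjTl (g * amat (-s)) γ) = 2 * |conjTl g γ 0 0| +
      Real.exp s * |conjTl g γ 0 1| + Real.exp (-s) * |conjTl g γ 1 0| := by
    intro s γ
    rw [conjTl_mul, nrm_conj_amat (conjTl_trace g γ), neg_neg]
  have hzero : ∀ (s : ℝ) (γ : SL2), conjTl (g * amat (-s)) γ = 0 ↔ conjTl g γ = 0 := by
    intro s γ
    rw [conjTl_mul, conj_eq_zero_iff]
  have hstep : ∀ n : ℕ, ∃ c : ℝ, conjTl g (A (n + 1)) = c • conjTl g (A n) := by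
    intro n
    have hB : nrm (conjTl (g * amat (-(s₁ + n))) (A (n + 1))) < 1 / 72 := by
      have h3 := hA3 (n + 1)
      rw [hform] at h3 ⊢
      push_cast at h3
      have e1 : Real.exp (-(s₁ + n)) = Real.exp 1 * Real.exp (-(s₁ + (n + 1))) := by
        rw [← Real.exp_add]; ring_nf
      have e2 : Real.exp (s₁ + n) ≤ Real.exp (s₁ + (n + 1)) := Real.exp_le_exp.2 (by linarith)
      have e3 := Real.exp_one_lt_three
      have q1 := mul_le_mul_of_nonneg_right e2 (abs_nonneg (conjTl g (A (n + 1)) 0 1))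
      have p3 : 0 ≤ Real.exp (-(s₁ + (n + 1))) * |conjTl g (A (n + 1)) 1 0| := by positivity
      have q2 := mul_le_mul_of_nonneg_right e3.le p3
      have p1 := abs_nonneg (conjTl g (A (n + 1)) 0 0)
      have p2 : 0 ≤ Real.exp (s₁ + (n + 1)) * |conjTl g (A (n + 1)) 0 1| := by positivity
      rw [e1, mul_assoc]
      linarith
    obtain ⟨c, hc⟩ := exists_smul_of_nearMin Γ (hA n) (hA (n + 1)) (hA0 n) (hAm n)
      (by linarith [hA3 n]) hB
    refine ⟨c, ?_⟩
    rw [conjTl_mul, conjTl_mul] at hc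
    rw [← sub_eq_zero, ← conj_eq_zero_iff (amat (-(s₁ + n))), mul_sub, sub_mul, hc]
    simp
  have hpar : ∀ n : ℕ, ∃ c : ℝ, conjTl g (A n) = c • conjTl g (A 0) := by
    intro n
    induction n with
    | zero => exact ⟨1, by simp⟩
    | succ k ih =>
      obtain ⟨c, hc⟩ := ih
      obtain ⟨d, hd⟩ := hstep k
      exact ⟨d * c, by rw [hd, hc, smul_smul]⟩
  obtain ⟨r, hr, hlow⟩ := exists_lower_bound_conjTl Γ g
  have hY0 : conjTl g (A 0) ≠ 0 := fun h => hA0 0 ((hzero _ _).2 h)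
  have hYn := nrm_pos hY0
  have hc0 : ∀ ε : ℝ, 0 < ε → |conjTl g (A 0) 0 0| + |conjTl g (A 0) 0 1| ≤ ε := by
    intro ε hε
    set δ := ε * (r / nrm (conjTl g (A 0))) / 2 with hδ
    have hδ0 : 0 < δ := by positivity
    obtain ⟨s₂, h₂⟩ := hsmall δ hδ0
    obtain ⟨n, hn⟩ := exists_nat_ge (max (s₂ - s₁) (-s₁))
    have hn1 := (le_max_left _ _).trans hn
    have hn2 := (le_max_right _ _).trans hn
    obtain ⟨γ, hγ, hne, hle⟩ := h₂ (s₁ + n) (by linarith)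
    have hm := hAm n γ hγ hne
    obtain ⟨c, hc⟩ := hpar n
    have hcn := hlow (A n) (hA n) fun h => hA0 n ((hzero _ _).2 h)
    rw [hc, nrm_smul, ← div_le_iff₀ hYn] at hcn
    rw [hform, hc] at hm
    simp only [Matrix.smul_apply, smul_eq_mul, abs_mul] at hm
    have hexp : 1 ≤ Real.exp (s₁ + n) := Real.one_le_exp (by linarith)
    have p0 : 0 ≤ |c| * |conjTl g (A 0) 0 1| := by positivity
    have p1 := mul_le_mul_of_nonneg_right hexp p0
    have p2 : 0 ≤ Real.exp (-(s₁ + n)) * (|c| * |conjTl g (A 0) 1 0|) := by positivity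
    have p3 : 0 ≤ |c| * |conjTl g (A 0) 0 0| := by positivity
    have p4 : |c| * (|conjTl g (A 0) 0 0| + |conjTl g (A 0) 0 1|) ≤
        ε * (r / nrm (conjTl g (A 0))) := by
      rw [hδ] at hle
      linarith
    have hq : 0 < r / nrm (conjTl g (A 0)) := by positivity
    have p5 := mul_le_mul_of_nonneg_right hcn
      (add_nonneg (abs_nonneg (conjTl g (A 0) 0 0)) (abs_nonneg (conjTl g (A 0) 0 1)))
    refine le_of_mul_le_mul_left ?_ hq
    linarith
  have hz : |conjTl g (A 0) 0 0| + |conjTl g (A 0) 0 1| ≤ 0 :=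
    le_of_forall_pos_le_add fun ε hε => by linarith [hc0 ε hε]
  have a1 := abs_nonneg (conjTl g (A 0) 0 0)
  have a2 := abs_nonneg (conjTl g (A 0) 0 1)
  exact ⟨A 0, hA 0, hY0, abs_eq_zero.1 (by linarith), abs_eq_zero.1 (by linarith)⟩

theorem exists_period_of_divergent (y : XQuot Γ)
    (hdiv : ∀ R : ℝ, ∃ s₁ : ℝ, ∀ s, s₁ ≤ s → R ≤ height Γ (rmul Γ y (amat (-s)))) :
    ∃ P > 0, rmul Γ y (lmat P) = y := by
  obtain ⟨g, rfl⟩ := qmk_surjective y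
  obtain ⟨A, hA, hne, h00, h01⟩ := exists_lower_conjTl_of_divergent (Γ := Γ) g fun R => by
    obtain ⟨s₁, h⟩ := hdiv R
    refine ⟨s₁, fun s hs => ?_⟩
    have := h s hs
    rwa [rmul_qmk, height_qmk] at this
  set h : SL2 := g⁻¹ * A * g with hh
  have htl : conjTl g A = tl h := rfl
  rw [htl] at hne h00 h01
  rw [tl_zero_zero] at h00
  rw [tl_zero_one] at h01
  have h10 : h 1 0 ≠ 0 := by
    intro h0
    refine hne ?_
    have h11 := tl_trace (h : Matrix (Fin 2) (Fin 2) ℝ)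
    ext i j
    fin_cases i <;> fin_cases j
    · simpa [tl_zero_zero] using h00
    · simpa [tl_zero_one] using h01
    · simpa [tl_one_zero] using h0
    · simpa [h11, tl_zero_zero] using h00
  have hd := det_SL2 h
  have hdiag : h 1 1 = h 0 0 := by linarith
  rw [hdiag, h01] at hd
  have hsq : h 0 0 * h 0 0 = 1 := by linarith
  have h2 : h * h = lmat (2 * h 0 0 * h 1 0) := by
    refine Subtype.ext ?_
    rw [Matrix.SpecialLinearGroup.coe_mul, coe_lmat]
    ext i j
    fin_cases i <;> fin_cases j <;>
      simp [Matrix.mul_apply, Fin.sum_univ_two, hdiag, h01, hsq]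
    ring
  have hp : 2 * h 0 0 * h 1 0 ≠ 0 := by
    have : h 0 0 ≠ 0 := fun h0 => by rw [h0] at hsq; norm_num at hsq
    exact mul_ne_zero (mul_ne_zero two_ne_zero this) h10
  have hper : rmul Γ (qmk Γ g) (lmat (2 * h 0 0 * h 1 0)) = qmk Γ g := by
    rw [rmul_qmk, ← h2, qmk_eq_qmk_iff, hh]
    have : g * (g * (g⁻¹ * A * g * (g⁻¹ * A * g)))⁻¹ = A⁻¹ * A⁻¹ := by group
    rw [this]
    exact mul_mem (inv_mem hA) (inv_mem hA)
  rcases lt_or_gt_of_ne hp with hneg | hpos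
  · refine ⟨-(2 * h 0 0 * h 1 0), by linarith, ?_⟩
    conv_lhs => rw [← hper]
    rw [← rmul_mul, ← lmat_add]
    simp [lmat_zero, rmul_one]
  · exact ⟨_, hpos, hper⟩

end Cusp

section Averaging

theorem abs_integral_sub_integral_mean_le {g : ℝ → ℝ} (hg : Continuous g) {M : ℝ}
    (hM : ∀ t, 0 ≤ t → |g t| ≤ M) {κ T : ℝ} (hκ : 0 < κ) (hT : 0 ≤ T) :
    |(∫ t in (0 : ℝ)..T, κ⁻¹ * ∫ w in (0 : ℝ)..κ, g (t + w)) - ∫ t in (0 : ℝ)..T, g t| ≤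
      2 * κ * M := by
  have hswap : (∫ t in (0 : ℝ)..T, ∫ w in (0 : ℝ)..κ, g (t + w)) =
      ∫ w in (0 : ℝ)..κ, ∫ t in (0 : ℝ)..T, g (t + w) := by
    refine intervalIntegral_intervalIntegral_swap ?_
    have hc : Continuous (Function.uncurry fun t w => g (t + w)) :=
      hg.comp (continuous_fst.add continuous_snd)
    exact (hc.continuousOn.integrableOn_compact (isCompact_uIcc.prod isCompact_uIcc)).mono_set
      (Set.prod_mono Set.uIoc_subset_uIcc Set.uIoc_subset_uIcc)
  have hcont : Continuous fun w => ∫ t in (0 : ℝ)..T, g (t + w) :=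
    intervalIntegral.continuous_parametric_intervalIntegral_of_continuous'
      (f := fun w t => g (t + w)) (hg.comp (continuous_snd.add continuous_fst)) 0 T
  have hb : |∫ w in (0 : ℝ)..κ, ((∫ t in (0 : ℝ)..T, g (t + w)) - ∫ t in (0 : ℝ)..T, g t)| ≤
      2 * κ * M * κ := by
    have := intervalIntegral.norm_integral_le_of_norm_le_const (a := 0) (b := κ)
      (f := fun w => (∫ t in (0 : ℝ)..T, g (t + w)) - ∫ t in (0 : ℝ)..T, g t)
      (C := 2 * κ * M) fun w hw => by
        rw [Set.uIoc_of_le hκ.le] at hw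
        exact abs_integral_shift_le hg hM hT hw.1.le hw.2
    rwa [sub_zero, abs_of_pos hκ] at this
  rw [intervalIntegral.integral_sub (hcont.intervalIntegrable _ _) (by simp)] at hb
  rw [intervalIntegral.integral_const_mul, hswap]
  set I := ∫ w in (0 : ℝ)..κ, ∫ t in (0 : ℝ)..T, g (t + w)
  set J := ∫ t in (0 : ℝ)..T, g t
  simp only [intervalIntegral.integral_const, sub_zero, smul_eq_mul] at hb
  have e : κ⁻¹ * I - J = κ⁻¹ * (I - κ * J) := by field_simp
  rw [e, abs_mul, abs_of_pos (inv_pos.2 hκ), inv_mul_le_iff₀ hκ]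
  linarith

theorem mean_comp_affine {h : ℝ → ℝ} {P p : ℝ} (hP : 0 < P) (hp : p ≠ 0)
    (hper : Function.Periodic h P) (a : ℝ) :
    (P / |p|)⁻¹ * ∫ w in (0 : ℝ)..P / |p|, h (a + p * w) = P⁻¹ * ∫ x in (0 : ℝ)..P, h x := by
  rw [intervalIntegral.integral_comp_add_mul _ hp, mul_zero, add_zero, smul_eq_mul]
  rcases lt_or_gt_of_ne hp with hn | hn
  · rw [abs_of_neg hn]
    have e : a + p * (P / -p) = a - P := by field_simp; ring
    have e2 := hper.intervalIntegral_add_eq (a - P) 0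
    rw [sub_add_cancel, zero_add] at e2
    rw [e, intervalIntegral.integral_symm, e2]
    field_simp
  · rw [abs_of_pos hn]
    have e : a + p * (P / p) = a + P := by field_simp
    have e2 := hper.intervalIntegral_add_eq a 0
    rw [zero_add] at e2
    rw [e, e2]
    field_simp

/-- Equidistribution of an exponentially expanding orbit in a slowly varying periodic function. -/
theorem exists_abs_integral_exp_sub_le {P p B L : ℝ} (hP : 0 < P) (hp : p ≠ 0) (hB : 0 ≤ B)
    (hL : 0 ≤ L) : ∃ K, ∀ f : ℝ → ℝ → ℝ, Continuous (Function.uncurry f) →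
      (∀ s, Function.Periodic (fun x => f x s) P) → (∀ x s, |f x s| ≤ B) →
      (∀ x s s', |f x s - f x s'| ≤ L * |s - s'|) → ∀ S, 0 ≤ S →
      |(∫ s in (0 : ℝ)..S, f (p * Real.exp s) s) -
        ∫ s in (0 : ℝ)..S, P⁻¹ * ∫ x in (0 : ℝ)..P, f x s| ≤ K := by
  set κ := P / |p| with hκdef
  have hκ : 0 < κ := by positivity
  refine ⟨2 * κ * B + (L + B) * κ, fun f hf hper hfB hfL S hS => ?_⟩
  set ρ : ℝ → ℝ := fun t => 1 + max t 0 with hρ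
  have hρ1 : ∀ t, 1 ≤ ρ t := fun t => by simp [hρ]
  have hρ0 : ∀ t, 0 < ρ t := fun t => by linarith [hρ1 t]
  have hρt : ∀ t, 0 ≤ t → ρ t = 1 + t := fun t ht => by simp [hρ, ht]
  have hρc : Continuous ρ := by fun_prop
  have hlog : Continuous fun t => Real.log (ρ t) := hρc.log fun t => (hρ0 t).ne'
  set G : ℝ → ℝ := fun t => f (p * (1 + t)) (Real.log (ρ t)) / ρ t with hG
  set fbar : ℝ → ℝ := fun s => P⁻¹ * ∫ x in (0 : ℝ)..P, f x s with hfbar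
  set H : ℝ → ℝ := fun t => fbar (Real.log (ρ t)) / ρ t with hH
  have hbarc : Continuous fbar := continuous_const.mul
    (intervalIntegral.continuous_parametric_intervalIntegral_of_continuous'
      (f := fun s x => f x s) (hf.comp (continuous_snd.prodMk continuous_fst)) 0 P)
  have hGc : Continuous G := by
    have h1 : Continuous fun t : ℝ => p * (1 + t) := by fun_prop
    exact (hf.comp (h1.prodMk hlog)).div hρc fun t => (hρ0 t).ne'
  have hHc : Continuous H := (hbarc.comp hlog).div hρc fun t => (hρ0 t).ne'
  have hsub : ∀ F : ℝ → ℝ → ℝ, Continuous (Function.uncurry F) →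
      (∫ s in (0 : ℝ)..S, F (Real.exp s) s) =
        ∫ t in (0 : ℝ)..Real.exp S - 1, F (1 + t) (Real.log (ρ t)) / ρ t := by
    intro F hF
    have h1 : Continuous fun t : ℝ => 1 + t := by fun_prop
    have hc : Continuous fun t => F (1 + t) (Real.log (ρ t)) / ρ t :=
      (hF.comp (h1.prodMk hlog)).div hρc fun t => (hρ0 t).ne'
    have := intervalIntegral.integral_comp_mul_deriv (a := 0) (b := S)
      (f := fun s => Real.exp s - 1) (f' := Real.exp)
      (fun x _ => (Real.hasDerivAt_exp x).sub_const 1) Real.continuous_exp.continuousOn hc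
    simp only [Real.exp_zero, sub_self] at this
    rw [← this]
    refine intervalIntegral.integral_congr fun s hs => ?_
    rw [Set.uIcc_of_le hS] at hs
    have e : ρ (Real.exp s - 1) = Real.exp s := by
      rw [hρt _ (by linarith [Real.one_le_exp hs.1])]; ring
    simp only [Function.comp, e, Real.log_exp, add_sub_cancel]
    field_simp
  have hY : 0 ≤ Real.exp S - 1 := by linarith [Real.one_le_exp hS]
  have e1 := hsub (fun v s => f (p * v) s)
    (hf.comp ((continuous_const.mul continuous_fst).prodMk continuous_snd))
  have e2 := hsub (fun _ s => fbar s) (hbarc.comp continuous_snd)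
  rw [e1, e2]
  set Y := Real.exp S - 1
  change |(∫ t in (0 : ℝ)..Y, G t) - ∫ t in (0 : ℝ)..Y, H t| ≤ _
  have hGB : ∀ t, 0 ≤ t → |G t| ≤ B := fun t _ => by
    rw [hG, abs_div, abs_of_pos (hρ0 t), div_le_iff₀ (hρ0 t)]
    nlinarith [hfB (p * (1 + t)) (Real.log (ρ t)), hρ1 t]
  have hmean := abs_integral_sub_integral_mean_le hGc hGB hκ hY
  have hHe : ∀ t, 0 ≤ t → H t = κ⁻¹ * ∫ w in (0 : ℝ)..κ, f (p * (1 + t) + p * w) (Real.log (ρ t)) / ρ t := by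
    intro t ht
    have := mean_comp_affine hP hp (hper (Real.log (ρ t))) (p * (1 + t))
    rw [hH, hfbar]
    simp only
    rw [← this, intervalIntegral.integral_div, mul_div_assoc]
  have hpt : ∀ t, 0 ≤ t → ∀ w ∈ Set.uIoc 0 κ,
      ‖G (t + w) - f (p * (1 + t) + p * w) (Real.log (ρ t)) / ρ t‖ ≤ (L + B) * κ / (1 + t) ^ 2 := by
    intro t ht w hw
    rw [Set.uIoc_of_le hκ.le] at hw
    have hw0 := hw.1.le
    have ht1 : 0 < 1 + t := by linarith
    have htw : 0 < 1 + (t + w) := by linarith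
    have ep : p * (1 + (t + w)) = p * (1 + t) + p * w := by ring
    rw [hG]
    simp only
    rw [hρt t ht, hρt (t + w) (by linarith), ep, Real.norm_eq_abs]
    set X := p * (1 + t) + p * w
    have hl : |Real.log (1 + (t + w)) - Real.log (1 + t)| ≤ κ / (1 + t) := by
      rw [← Real.log_div htw.ne' ht1.ne', abs_of_nonneg
        (Real.log_nonneg (by rw [le_div_iff₀ ht1]; linarith))]
      have := Real.log_le_sub_one_of_pos (show 0 < (1 + (t + w)) / (1 + t) by positivity)
      refine this.trans ?_
      rw [show (1 + (t + w)) / (1 + t) - 1 = w / (1 + t) by field_simp; ring]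
      gcongr
      exact hw.2
    have h1 := (hfL X (Real.log (1 + (t + w))) (Real.log (1 + t))).trans
      (mul_le_mul_of_nonneg_left hl hL)
    have h2 := hfB X (Real.log (1 + t))
    set u := f X (Real.log (1 + (t + w)))
    set v := f X (Real.log (1 + t))
    have e : u / (1 + (t + w)) - v / (1 + t) =
        (u - v) / (1 + (t + w)) - v * w / ((1 + t) * (1 + (t + w))) := by
      field_simp; ring
    have h3 : |(u - v) / (1 + (t + w))| ≤ L * κ / (1 + t) ^ 2 := by
      rw [abs_div, abs_of_pos htw]
      calc |u - v| / (1 + (t + w)) ≤ (L * (κ / (1 + t))) / (1 + t) := by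
            gcongr
            linarith
        _ = _ := by field_simp
    have h4 : |v * w / ((1 + t) * (1 + (t + w)))| ≤ B * κ / (1 + t) ^ 2 := by
      rw [abs_div, abs_mul, abs_of_nonneg hw0, abs_of_pos (mul_pos ht1 htw), pow_two]
      gcongr
      · exact hw.2
      · linarith
    rw [e]
    have h5 : (L + B) * κ / (1 + t) ^ 2 = L * κ / (1 + t) ^ 2 + B * κ / (1 + t) ^ 2 := by ring
    rw [h5]
    exact (abs_sub _ _).trans (add_le_add h3 h4)
  have hmc : Continuous fun t => κ⁻¹ * ∫ w in (0 : ℝ)..κ, G (t + w) :=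
    continuous_const.mul (intervalIntegral.continuous_parametric_intervalIntegral_of_continuous'
      (f := fun t w => G (t + w)) (hGc.comp (continuous_fst.add continuous_snd)) 0 κ)
  have hinner : ∀ t, 0 ≤ t → |(κ⁻¹ * ∫ w in (0 : ℝ)..κ, G (t + w)) - H t| ≤
      (L + B) * κ / (1 + t) ^ 2 := by
    intro t ht
    have hc1 : Continuous fun w => G (t + w) := hGc.comp (continuous_const.add continuous_id)
    have hc2 : Continuous fun w => f (p * (1 + t) + p * w) (Real.log (ρ t)) / ρ t := by
      have h1 : Continuous fun w : ℝ => p * (1 + t) + p * w := by fun_prop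
      exact (hf.comp (h1.prodMk continuous_const)).div_const _
    rw [hHe t ht, ← mul_sub, ← intervalIntegral.integral_sub (hc1.intervalIntegrable _ _)
      (hc2.intervalIntegrable _ _), abs_mul, abs_of_pos (inv_pos.2 hκ), inv_mul_le_iff₀ hκ]
    have := intervalIntegral.norm_integral_le_of_norm_le_const (hpt t ht)
    rw [sub_zero, abs_of_pos hκ] at this
    rw [mul_comm κ]
    exact this
  have hint : (∫ t in (0 : ℝ)..Y, (L + B) * κ / (1 + t) ^ 2) ≤ (L + B) * κ := by
    have hd : ∀ t ∈ Set.uIcc 0 Y, HasDerivAt (fun t => -((L + B) * κ / (1 + t)))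
        ((L + B) * κ / (1 + t) ^ 2) t := by
      intro t ht
      rw [Set.uIcc_of_le hY] at ht
      have ht1 : 1 + t ≠ 0 := by linarith [ht.1]
      have h1 : HasDerivAt (fun t : ℝ => 1 + t) 1 t := (hasDerivAt_id t).const_add 1
      have := ((h1.inv ht1).const_mul ((L + B) * κ)).neg
      refine (this.congr_deriv ?_)
      ring
    have hcd : ContinuousOn (fun t : ℝ => (L + B) * κ / (1 + t) ^ 2) (Set.uIcc 0 Y) := by
      refine ContinuousOn.div (by fun_prop) (by fun_prop) fun t ht => ?_
      rw [Set.uIcc_of_le hY] at ht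
      have := ht.1
      positivity
    rw [intervalIntegral.integral_eq_sub_of_hasDerivAt hd hcd.intervalIntegrable]
    have : 0 ≤ (L + B) * κ / (1 + Y) := by positivity
    simp only [add_zero, div_one]
    linarith
  have hdiff : |∫ t in (0 : ℝ)..Y, ((κ⁻¹ * ∫ w in (0 : ℝ)..κ, G (t + w)) - H t)| ≤ (L + B) * κ := by
    refine le_trans ?_ hint
    rw [← Real.norm_eq_abs]
    refine intervalIntegral.norm_integral_le_of_norm_le hY ?_ ?_
    · exact Eventually.of_forall fun t ht => hinner t ht.1.le
    · refine ContinuousOn.intervalIntegrable ?_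
      refine ContinuousOn.div (by fun_prop) (by fun_prop) fun t ht => ?_
      rw [Set.uIcc_of_le hY] at ht
      have := ht.1
      positivity
  rw [intervalIntegral.integral_sub (hmc.intervalIntegrable _ _) (hHc.intervalIntegrable _ _)] at hdiff
  rw [abs_le] at *
  constructor <;> linarith

end Averaging

section Translates
variable {Γ : Subgroup SL2}

theorem RLip.abs_sub_amat_le {C B : ℝ} {ψ : XQuot Γ → ℝ} (hC : 0 ≤ C) (h : RLip C ψ)
    (hB : ∀ x, |ψ x| ≤ B) (x : XQuot Γ) (s : ℝ) :
    |ψ (rmul Γ x (amat s)) - ψ x| ≤ (2 * C + 2 * B) * |s| := by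
  have hB0 : 0 ≤ B := (abs_nonneg _).trans (hB x)
  rcases le_total |s| 1 with hs | hs
  · have := (h x (amat s)).trans (mul_le_mul_of_nonneg_left (nrm_amat_sub_one_le hs) hC)
    have h2 : 0 ≤ 2 * B * |s| := by positivity
    linarith
  · have h1 := hB x
    have h2 := hB (rmul Γ x (amat s))
    have h3 : |ψ (rmul Γ x (amat s)) - ψ x| ≤ 2 * B := by
      rw [abs_le] at *
      constructor <;> linarith
    have h4 := mul_le_mul_of_nonneg_left hs (show 0 ≤ 2 * B by positivity)
    have h5 : 0 ≤ 2 * C * |s| := by positivity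
    linarith

theorem continuous_expanding (p T z : ℝ) :
    Continuous fun s : ℝ => lmat (p * Real.exp s) * amat (T - s) * umat z := by
  have h1 : Continuous fun s : ℝ => lmat (p * Real.exp s) := continuous_lmat.comp (by fun_prop)
  have h2 : Continuous fun s : ℝ => amat (T - s) := continuous_amat.comp (by fun_prop)
  exact (h1.mul h2).mul continuous_const

variable {τ b P p r : ℝ} {y₀ : XQuot Γ}

theorem weight_le_height_horocycle [DiscreteTopology Γ] (hP : 0 < P)
    (hper : rmul Γ y₀ (lmat P) = y₀) (x u : ℝ) :
    (P * Real.exp u) ^ (-(1 / 4) : ℝ) ≤ height Γ (rmul Γ y₀ (lmat x * amat u)) := by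
  obtain ⟨g, rfl⟩ := qmk_surjective y₀
  rw [rmul_qmk, qmk_eq_qmk_iff] at hper
  rw [rmul_qmk, height_qmk]
  have hw := weight_le_heightG Γ (g * (lmat x * amat u)) (inv_mem hper)
  have e : conjTl (g * (lmat x * amat u)) (g * (g * lmat P)⁻¹)⁻¹ =
      tl (lmat (P * Real.exp u) : Matrix (Fin 2) (Fin 2) ℝ) := by
    unfold conjTl
    have e1 : (g * (lmat x * amat u))⁻¹ * (g * (g * lmat P)⁻¹)⁻¹ * (g * (lmat x * amat u)) =
        (amat u)⁻¹ * ((lmat x)⁻¹ * (lmat P * lmat x)) * amat u := by group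
    rw [e1, ← lmat_add, lmat_inv, ← lmat_add, mul_assoc, lmat_mul_amat, ← mul_assoc, inv_mul_cancel,
      one_mul]
    ring_nf
  rw [e] at hw
  have hn : nrm (tl (lmat (P * Real.exp u) : Matrix (Fin 2) (Fin 2) ℝ)) = P * Real.exp u := by
    rw [nrm_tl_eq, tl_zero_zero, tl_zero_one, tl_one_zero, coe_lmat]
    simp [abs_of_pos hP]
  rw [weight, hn] at hw
  linarith

theorem distort_umat_le {z R : ℝ} (hz : |z| ≤ R) : distort (umat z) ≤ 2 + R := by
  unfold distort
  rw [nrm_inv, nrm_umat]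
  have h0 : 0 ≤ |z| := abs_nonneg z
  calc ((2 + |z|) * (2 + |z|)) ^ (1 / 4 : ℝ) ≤ ((2 + |z|) * (2 + |z|)) ^ (1 / 2 : ℝ) :=
        Real.rpow_le_rpow_of_exponent_le (by nlinarith) (by norm_num)
    _ = 2 + |z| := by rw [← Real.sqrt_eq_rpow, Real.sqrt_mul_self (by linarith)]
    _ ≤ _ := by linarith

/-- The translated orbit leaves the region below height `R` after time `T + O(1)`. -/
theorem exists_le_height_of_lt [DiscreteTopology Γ] (hP : 0 < P)
    (hper : rmul Γ y₀ (lmat P) = y₀) (r R : ℝ) : ∃ M > 0, ∀ T s x : ℝ, 0 ≤ T → T + M < s →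
      R ≤ height Γ (rmul Γ y₀ (lmat x * amat (T - s) * umat (r * Real.exp (-T)))) := by
  set D := 2 + |r| with hD
  have hD0 : 0 < D := by positivity
  set R' := max R 1 with hR'
  have hR0 : 0 < R' := by positivity
  set ε := (D * R') ^ (-4 : ℝ) with hε
  have hε0 : 0 < ε := by positivity
  refine ⟨max 1 (Real.log (P / ε)), by positivity, fun T s x hT hs => ?_⟩
  have hexp : P * Real.exp (T - s) ≤ ε := by
    have h1 : T - s ≤ -Real.log (P / ε) := by linarith [le_max_right 1 (Real.log (P / ε))]
    have h2 := Real.exp_le_exp.2 h1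
    rw [Real.exp_neg, Real.exp_log (by positivity), inv_div] at h2
    calc P * Real.exp (T - s) ≤ P * (ε / P) := by gcongr
      _ = ε := by field_simp
  have h1 := weight_le_height_horocycle hP hper x (T - s)
  have h2 := Real.rpow_le_rpow_of_nonpos (by positivity) hexp (show (-(1 / 4) : ℝ) ≤ 0 by norm_num)
  rw [hε, ← Real.rpow_mul (by positivity)] at h2
  norm_num at h2
  have h3 := height_le_rmul Γ (rmul Γ y₀ (lmat x * amat (T - s))) (umat (r * Real.exp (-T)))
  rw [← rmul_mul] at h3
  have h4 : distort (umat (r * Real.exp (-T))) ≤ D := distort_umat_le (by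
    rw [abs_mul, Real.abs_exp]
    exact mul_le_of_le_one_right (abs_nonneg r) (Real.exp_le_one_iff.2 (by linarith)))
  have h5 := height_pos Γ (rmul Γ y₀ (lmat x * amat (T - s) * umat (r * Real.exp (-T))))
  have h6 := mul_le_mul_of_nonneg_right h4 h5.le
  have h7 : D * R' ≤ D * height Γ (rmul Γ y₀ (lmat x * amat (T - s) * umat (r * Real.exp (-T)))) := by
    norm_num at h1
    linarith
  exact (le_max_left R 1).trans (le_of_mul_le_mul_left h7 hD0)

variable [DiscreteTopology Γ] {μ : Measure (XQuot Γ)} [IsProbabilityMeasure μ]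

theorem exists_abs_integral_expanding_sub_le (hlat : IsLatticeSL2 Γ)
    (hinv : ∀ g : SL2, Measure.map (fun x => rmul Γ x g) μ = μ)
    (hP : 0 < P) (hper : rmul Γ y₀ (lmat P) = y₀) (hp : p ≠ 0) (r : ℝ)
    {ψ : XQuot Γ → ℝ} (hψ : Continuous ψ) {B C M : ℝ} (hB : ∀ x, |ψ x| ≤ B) (hC : 0 ≤ C)
    (hL : RLip C ψ) (hM : 0 ≤ M) : ∃ K, ∀ T, 0 ≤ T →
      |(∫ s in (0 : ℝ)..T + M,
        ψ (rmul Γ y₀ (lmat (p * Real.exp s) * amat (T - s) * umat (r * Real.exp (-T))))) -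
          T * ∫ x, ψ x ∂μ| ≤ K := by
  have hB0 : 0 ≤ B := (abs_nonneg _).trans (hB y₀)
  obtain ⟨τ, b, hD⟩ := exists_drift Γ
  obtain ⟨c, hc, hcls⟩ := hL.exists_cls hD hC hB
  obtain ⟨K₁, hK₁⟩ := exists_abs_horoInt_sub_le hlat hinv hD hP hper hc hcls
  obtain ⟨K₂, hK₂⟩ := exists_abs_integral_exp_sub_le hP hp hB0
    (show 0 ≤ 2 * C + 2 * B by positivity)
  refine ⟨C * |r| * (1 + M) + K₂ + B * M + K₁, fun T hT => ?_⟩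
  set f : ℝ → ℝ → ℝ := fun x s => ψ (rmul Γ y₀ (lmat x * amat (T - s))) with hf
  have hfc : Continuous (Function.uncurry f) := by
    have h : Continuous fun q : ℝ × ℝ => lmat q.1 * amat (T - q.2) :=
      (continuous_lmat.comp continuous_fst).mul
        (continuous_amat.comp (continuous_const.sub continuous_snd))
    exact hψ.comp ((continuous_rmul_right y₀).comp h)
  have hfL : ∀ x s s', |f x s - f x s'| ≤ (2 * C + 2 * B) * |s - s'| := by
    intro x s s'
    have := hL.abs_sub_amat_le hC hB (rmul Γ y₀ (lmat x * amat (T - s'))) (s' - s)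
    rw [← rmul_mul, mul_assoc, ← amat_add, sub_add_sub_cancel, abs_sub_comm s' s] at this
    exact this
  have h2 := hK₂ f hfc (fun s x => by
    have := periodic_rmul_lmat hper (amat (T - s)) x
    simp only [hf] at this ⊢
    rw [this]) (fun _ _ => hB _) hfL (T + M) (by linarith)
  have h1 := hK₁ T hT
  have hhor : ∀ s, P⁻¹ * (∫ x in (0 : ℝ)..P, f x s) = horo y₀ P (T - s) ψ := fun _ => rfl
  simp only [hhor] at h2
  have hhc := continuous_horo hψ y₀ P
  have hhB : ∀ t, |horo y₀ P t ψ| ≤ B := by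
    intro t
    have := intervalIntegral.norm_integral_le_of_norm_le_const (a := 0) (b := P)
      (f := fun x => ψ (rmul Γ y₀ (lmat x * amat t))) (C := B) fun _ _ => hB _
    rw [sub_zero, abs_of_pos hP] at this
    unfold horo
    rw [abs_mul, abs_of_pos (inv_pos.2 hP), inv_mul_le_iff₀ hP, mul_comm]
    exact this
  have hsplit : (∫ s in (0 : ℝ)..T + M, horo y₀ P (T - s) ψ) =
      (∫ t in -M..0, horo y₀ P t ψ) + horoInt y₀ P T ψ := by
    rw [intervalIntegral.integral_comp_sub_left (fun t => horo y₀ P t ψ)]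
    unfold horoInt
    rw [intervalIntegral.integral_add_adjacent_intervals (hhc.intervalIntegrable _ _)
      (hhc.intervalIntegrable _ _)]
    congr 1 <;> ring
  have hneg : |∫ t in -M..0, horo y₀ P t ψ| ≤ B * M := by
    have := intervalIntegral.norm_integral_le_of_norm_le_const (a := -M) (b := 0)
      (f := fun t => horo y₀ P t ψ) (C := B) fun t _ => hhB t
    rwa [zero_sub, neg_neg, abs_of_nonneg hM] at this
  have hc1 : Continuous fun s => f (p * Real.exp s) s := by
    have h : Continuous fun s : ℝ => lmat (p * Real.exp s) * amat (T - s) := by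
      simpa [umat_zero] using continuous_expanding p T 0
    exact hψ.comp ((continuous_rmul_right y₀).comp h)
  have hc2 : Continuous fun s =>
      ψ (rmul Γ y₀ (lmat (p * Real.exp s) * amat (T - s) * umat (r * Real.exp (-T)))) := by
    exact hψ.comp ((continuous_rmul_right y₀).comp (continuous_expanding p T (r * Real.exp (-T))))
  have hU : |∫ s in (0 : ℝ)..T + M,
      (ψ (rmul Γ y₀ (lmat (p * Real.exp s) * amat (T - s) * umat (r * Real.exp (-T)))) -
        f (p * Real.exp s) s)| ≤ C * |r| * (1 + M) := by
    have := intervalIntegral.norm_integral_le_of_norm_le_const (a := 0) (b := T + M)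
      (f := fun s => ψ (rmul Γ y₀ (lmat (p * Real.exp s) * amat (T - s) * umat (r * Real.exp (-T)))) -
        f (p * Real.exp s) s) (C := C * (|r| * Real.exp (-T))) fun s _ => by
          have := hL (rmul Γ y₀ (lmat (p * Real.exp s) * amat (T - s))) (umat (r * Real.exp (-T)))
          rwa [← rmul_mul, nrm_umat_sub_one, abs_mul, Real.abs_exp] at this
    rw [sub_zero, abs_of_nonneg (by linarith : 0 ≤ T + M)] at this
    refine this.trans ?_
    have e1 : Real.exp (-T) * (T + M) ≤ 1 + M := by
      have h3 : Real.exp (-T) * T ≤ 1 := by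
        rw [Real.exp_neg, inv_mul_le_iff₀ (Real.exp_pos T)]
        linarith [Real.add_one_le_exp T]
      have h4 : Real.exp (-T) * M ≤ M :=
        mul_le_of_le_one_left hM (Real.exp_le_one_iff.2 (by linarith))
      linarith
    calc C * (|r| * Real.exp (-T)) * (T + M) = C * |r| * (Real.exp (-T) * (T + M)) := by ring
      _ ≤ _ := by gcongr
  rw [intervalIntegral.integral_sub (hc2.intervalIntegrable _ _) (hc1.intervalIntegrable _ _)] at hU
  rw [hsplit] at h2
  rw [abs_le] at *
  constructor <;> linarith

end Translates

section Final

/-- conjugates `hmat` into the diagonal group -/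
def diagonalizer : SL2 := lmat (1 / 2) * umat (-1)

/-- the Weyl element -/
def weyl : SL2 := ⟨!![0, -1; 1, 0], by rw [Matrix.det_fin_two_of]; norm_num⟩

theorem coe_diagonalizer : (diagonalizer : Matrix (Fin 2) (Fin 2) ℝ) = !![1, -1; 1 / 2, 1 / 2] := by
  rw [diagonalizer, Matrix.SpecialLinearGroup.coe_mul, coe_lmat, coe_umat, Matrix.mul_fin_two]
  norm_num

theorem hmat_eq (s : ℝ) : hmat s = diagonalizer⁻¹ * amat (-s) * diagonalizer := by
  rw [mul_assoc, eq_inv_mul_iff_mul_eq]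
  apply SL2_ext'
  rw [Matrix.SpecialLinearGroup.coe_mul, Matrix.SpecialLinearGroup.coe_mul, coe_diagonalizer,
    coe_hmat, coe_amat, Matrix.mul_fin_two, Matrix.mul_fin_two, Real.cosh_eq, Real.sinh_eq,
    neg_div, neg_neg]
  ext i j
  fin_cases i <;> fin_cases j <;> simp <;> ring

theorem diagonalizer_eq_mul_weyl : diagonalizer = lmat (-(1 / 2)) * umat 1 * weyl := by
  apply SL2_ext'
  rw [coe_diagonalizer, Matrix.SpecialLinearGroup.coe_mul, Matrix.SpecialLinearGroup.coe_mul,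
    coe_lmat, coe_umat, weyl, Matrix.mul_fin_two, Matrix.mul_fin_two]
  norm_num

theorem weyl_mul_amat (t : ℝ) : weyl * amat (-t) = amat t * weyl := by
  apply SL2_ext'
  rw [Matrix.SpecialLinearGroup.coe_mul, Matrix.SpecialLinearGroup.coe_mul, coe_amat, coe_amat, weyl,
    Matrix.mul_fin_two, Matrix.mul_fin_two, neg_div, neg_neg]
  norm_num

theorem amat_mul_lmat_mul_umat_mul_amat (p r s T : ℝ) :
    amat (-s) * (lmat p * umat r) * amat T =
      lmat (p * Real.exp s) * amat (T - s) * umat (r * Real.exp (-T)) := by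
  rw [← mul_assoc, mul_assoc _ (umat r), umat_mul_amat, amat_mul_lmat, neg_neg, ← mul_assoc,
    mul_assoc (lmat _) (amat _), ← amat_add, mul_comm p, mul_comm r]
  ring_nf

theorem hmat_mul_amat (s T : ℝ) : hmat s * amat T =
    diagonalizer⁻¹ *
      (lmat (1 / 2 * Real.exp s) * amat (T - s) * umat (-1 * Real.exp (-T))) := by
  rw [← amat_mul_lmat_mul_umat_mul_amat, hmat_eq, diagonalizer]
  group

theorem hmat_mul_amat_neg (s T : ℝ) : hmat s * amat (-T) =
    diagonalizer⁻¹ *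
      (lmat (-(1 / 2) * Real.exp s) * amat (T - s) * umat (1 * Real.exp (-T))) * weyl := by
  rw [← amat_mul_lmat_mul_umat_mul_amat, hmat_eq]
  conv_lhs => rw [mul_assoc _ diagonalizer, diagonalizer_eq_mul_weyl, mul_assoc _ weyl, weyl_mul_amat]
  rw [← diagonalizer_eq_mul_weyl]
  simp only [mul_assoc]

variable {Γ : Subgroup SL2} [DiscreteTopology Γ]

theorem exists_forall_integral_expanding {μ : Measure (XQuot Γ)} [IsProbabilityMeasure μ]
    (hlat : IsLatticeSL2 Γ) (hinv : ∀ g : SL2, Measure.map (fun x => rmul Γ x g) μ = μ)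
    {y₀ : XQuot Γ} {P p : ℝ} (hP : 0 < P) (hper : rmul Γ y₀ (lmat P) = y₀) (hp : p ≠ 0) (r : ℝ)
    {ψ : XQuot Γ → ℝ} (hψ : Continuous ψ) {B C R : ℝ} (hB : ∀ x, |ψ x| ≤ B) (hC : 0 ≤ C)
    (hL : RLip C ψ) (hR : ∀ x, R ≤ height Γ x → ψ x = 0) :
    ∃ M > 0, ∃ K, ∀ F : ℝ → ℝ → ℝ, (∀ T s, F T s =
        ψ (rmul Γ y₀ (lmat (p * Real.exp s) * amat (T - s) * umat (r * Real.exp (-T))))) →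
      ∀ T, 0 ≤ T → (∀ M', M ≤ M' → ∫ s in Set.Ioi (0 : ℝ), F T s =
        ∫ s in Set.Ioc (0 : ℝ) (T + M'), F T s) ∧
        |(∫ s in Set.Ioi (0 : ℝ), F T s) - T * ∫ x, ψ x ∂μ| ≤ K := by
  obtain ⟨M, hM, hMR⟩ := exists_le_height_of_lt hP hper r R
  obtain ⟨K, hK⟩ := exists_abs_integral_expanding_sub_le hlat hinv hP hper hp r hψ hB hC hL hM.le
  refine ⟨M, hM, K, fun F hF T hT => ?_⟩
  have h1 : ∀ M', M ≤ M' → ∫ s in Set.Ioi (0 : ℝ), F T s =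
      ∫ s in Set.Ioc (0 : ℝ) (T + M'), F T s := by
    intro M' hM'
    refine (setIntegral_eq_of_subset_of_forall_sdiff_eq_zero measurableSet_Ioi
      (fun s hs => hs.1) fun s hs => ?_)
    rw [hF]
    refine hR _ (hMR T s _ hT ?_)
    by_contra hcon
    exact hs.2 ⟨hs.1, by linarith⟩
  refine ⟨h1, ?_⟩
  have := hK T hT
  rw [intervalIntegral.integral_of_le (by linarith)] at this
  rw [h1 M le_rfl]
  simp only [hF]
  exact this

end Final

/-- limits of translates of a divergent geodesic. -/
theorem translates_of_divergent_geodesic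
    (Γ : Subgroup SL2) (hlat : IsLatticeSL2 Γ)
    (hnonuniform : ¬ IsCompact (Set.univ : Set (XQuot Γ)))
    (μ : Measure (XQuot Γ)) (hprob : IsProbabilityMeasure μ)
    (hinv : ∀ g : SL2, Measure.map (fun x => rmul Γ x g) μ = μ)
    (x₀ : XQuot Γ)
    (hdiv : ∀ C : Set (XQuot Γ), IsCompact C →
      ∃ s₁ : ℝ, 0 < s₁ ∧ ∀ s : ℝ, s₁ ≤ s → rmul Γ x₀ (hmat s) ∉ C)
    (ψ : XQuot Γ → ℝ) (hsmooth : IsSmoothQuot Γ ψ) (hsupp : HasCompactSupport ψ) :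
    ∃ C₀ > (0:ℝ), ∃ M > (0:ℝ), ∀ T : ℝ, 1 ≤ |T| →
      (∫ s in Set.Ioi (0:ℝ), ψ (rmul Γ x₀ (hmat s * amat T))
          = ∫ s in Set.Ioc (0:ℝ) (|T| + M), ψ (rmul Γ x₀ (hmat s * amat T))) ∧
      |(∫ s in Set.Ioi (0:ℝ), ψ (rmul Γ x₀ (hmat s * amat T)))
          - |T| * ∫ x, ψ x ∂μ| ≤ C₀ := by
  have hd : DiscreteTopology Γ := hlat.1
  set y₀ := rmul Γ x₀ diagonalizer⁻¹ with hy₀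
  obtain ⟨P, hP, hper⟩ := exists_period_of_divergent y₀ fun R => by
    obtain ⟨S, hS, hSR⟩ := exists_isCompact_of_height_le hlat (distort diagonalizer * R)
    obtain ⟨s₁, -, h⟩ := hdiv S hS
    refine ⟨s₁, fun s hs => ?_⟩
    by_contra! hlt
    refine h s hs (hSR _ ?_)
    have h1 := height_rmul_le Γ (rmul Γ y₀ (amat (-s))) diagonalizer
    rw [hy₀, ← rmul_mul, ← rmul_mul, ← mul_assoc, ← hmat_eq] at h1
    refine h1.trans (mul_le_mul_of_nonneg_left ?_ (by linarith [one_le_distort diagonalizer]))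
    exact hlt.le
  obtain ⟨hψ, B, hB0, hB⟩ := exists_bound_of_smooth hsmooth hsupp
  obtain ⟨C, hC, hL⟩ := exists_rLip_of_smooth hsmooth hsupp
  obtain ⟨C', hC', hL'⟩ := hL.comp_rmul hC weyl
  obtain ⟨R, hR⟩ := exists_height_le_of_isCompact (show IsCompact (tsupport ψ) from hsupp)
  have hvan : ∀ x, R + 1 ≤ height Γ x → ψ x = 0 := fun x hx => by
    by_contra hne
    linarith [hR x (subset_tsupport ψ hne)]
  have hvan' : ∀ x, distort weyl * (R + 1) ≤ height Γ x → ψ (rmul Γ x weyl) = 0 := fun x hx => by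
    refine hvan _ (le_of_mul_le_mul_left (hx.trans (height_le_rmul Γ x weyl)) ?_)
    linarith [one_le_distort weyl]
  have hψ' : Continuous fun x => ψ (rmul Γ x weyl) := hψ.comp (continuous_rmul_left weyl)
  have hint : ∫ x, ψ (rmul Γ x weyl) ∂μ = ∫ x, ψ x ∂μ := by
    rw [← integral_map (φ := fun x => rmul Γ x weyl) (continuous_rmul_left weyl).measurable.aemeasurable
      hψ.stronglyMeasurable.aestronglyMeasurable, hinv]
  obtain ⟨M₁, hM₁, K₁, h₁⟩ := exists_forall_integral_expanding hlat hinv hP hper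
    (show (1 / 2 : ℝ) ≠ 0 by norm_num) (-1) hψ hB hC hL hvan
  obtain ⟨M₂, hM₂, K₂, h₂⟩ := exists_forall_integral_expanding hlat hinv hP hper
    (show (-(1 / 2) : ℝ) ≠ 0 by norm_num) 1 hψ' (fun x => hB _) hC' hL' hvan'
  have h₁' := h₁ (fun T s => ψ (rmul Γ x₀ (hmat s * amat T))) fun T s => by
    rw [hmat_mul_amat, rmul_mul]
  have h₂' := h₂ (fun T s => ψ (rmul Γ x₀ (hmat s * amat (-T)))) fun T s => by
    rw [hmat_mul_amat_neg, rmul_mul, rmul_mul]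
  rw [hint] at h₂'
  refine ⟨max 1 (max K₁ K₂), by positivity, max M₁ M₂, by positivity, fun T _ => ?_⟩
  rcases le_total 0 T with hT | hT
  · rw [abs_of_nonneg hT]
    obtain ⟨e, hle⟩ := h₁' T hT
    exact ⟨e _ (le_max_left _ _), hle.trans ((le_max_left _ _).trans (le_max_right _ _))⟩
  · rw [abs_of_nonpos hT]
    obtain ⟨e, hle⟩ := h₂' (-T) (by linarith)
    simp only [neg_neg] at e hle
    exact ⟨e _ (le_max_right _ _), hle.trans ((le_max_right _ _).trans (le_max_right _ _))⟩
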